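/- For every ε > 0 there is a constant C_ε such that the following holds. Let K, P ≥ 1/2 and N ≥ K·P, let a : O∖{0} → ℂ be constant on associate classes, and for c ∈ O∖{0} put Φ(c) = Σ_m Σ_n a_m·conj(a_n)·S(m,n;c)·𝓗(2π·√(mn)/c), both sums over generators m, n with argument in [0, π/2) satisfying N < |m|, |n| ≤ √2·N (the value 𝓗(2π·√(mn)/c) is independent of the choice of square root since 𝓗 is even). Then Σ_{c ∈ O∖{0}} |Φ(c)|/|c|² ≤ C_ε·(K²+P²)·N^{2+ε}·(K·e^{−K²/9} + P·e^{−P²} + 1/(K·P))·‖a_N‖₂². -/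

import Mathlib

open scoped Real ComplexConjugate
open Complex

/-- `e[z] = exp(2πi Re z)`. -/
noncomputable def efn (z : ℂ) : ℂ := Complex.exp (2 * Real.pi * Complex.I * z.re)

/-- The Kloosterman sum `S(m, n; c)` over the Gaussian integers: the sum over invertible
residues `α` modulo `c` (with `δ` the inverse residue) of `e[(αm + δn)/c]`. -/
noncomputable def kloosterman (m n c : GaussianInt) : ℂ :=
  ∑ᶠ u : (GaussianInt ⧸ Ideal.span {c})ˣ,
    efn (((Quotient.out (u : GaussianInt ⧸ Ideal.span {c}) : GaussianInt) * m +
          (Quotient.out ((u⁻¹ : (GaussianInt ⧸ Ideal.span {c})ˣ) :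
              GaussianInt ⧸ Ideal.span {c}) : GaussianInt) * n : GaussianInt) / (c : ℂ))

/-- `n` is the distinguished generator of its ideal: nonzero with argument in `[0, π/2)`. -/
def IsGen (n : GaussianInt) : Prop :=
  n ≠ 0 ∧ 0 ≤ Complex.arg (n : ℂ) ∧ Complex.arg (n : ℂ) < Real.pi / 2

/-- distinguished generator in the annulus `N < |n| ≤ √2·N`. -/
def InAnn (N : ℝ) (n : GaussianInt) : Prop :=
  IsGen n ∧ N < ‖(n : ℂ)‖ ∧ ‖(n : ℂ)‖ ≤ Real.sqrt 2 * N

/-- `‖b_N‖₂² = Σ_{N < |n| ≤ √2 N} |b_n|²`, over distinguished generators. -/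
noncomputable def sqNorm (b : GaussianInt → ℂ) (N : ℝ) : ℝ :=
  ∑ᶠ n ∈ {n : GaussianInt | InAnn N n}, ‖b n‖ ^ 2

/-- The quadratic form
`B(θ,c,N) = Σ_m Σ_n b_m conj(b_n) S(m,n;c) cos(4π Re(√(mn) θ / c))`. -/
noncomputable def Bform (b : GaussianInt → ℂ) (θ : ℂ) (c : GaussianInt) (N : ℝ) : ℂ :=
  ∑ᶠ m ∈ {m : GaussianInt | InAnn N m}, ∑ᶠ n ∈ {n : GaussianInt | InAnn N n},
    b m * conj (b n) * kloosterman m n c *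
      Real.cos (4 * Real.pi * ((((m : ℂ) * (n : ℂ)) ^ ((1:ℂ)/2) * θ / (c : ℂ)).re))

/-- `trh(r,ω) = cosh r cos ω + i sinh r sin ω`. -/
noncomputable def trh (r ω : ℝ) : ℂ :=
  (Real.cosh r * Real.cos ω : ℝ) + Complex.I * (Real.sinh r * Real.sin ω : ℝ)

/-- `k(r) = √π K exp(−K²r²)`. -/
noncomputable def kfun (K r : ℝ) : ℝ := Real.sqrt Real.pi * K * Real.exp (-(K ^ 2 * r ^ 2))

/-- `θ(ω) = √π P Σ_{q∈ℤ} exp(−P²(ω+πq)²)`. -/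
noncomputable def thetafun (P ω : ℝ) : ℝ :=
  Real.sqrt Real.pi * P * ∑' q : ℤ, Real.exp (-(P ^ 2 * (ω + Real.pi * q) ^ 2))

/-- The Bessel integral
`𝓗(z) = −∫_ℝ ∫₀^π cos(2 Re(z trh(r,ω))) (k''(r)θ(ω) + k(r)θ''(ω)) dω dr`. -/
noncomputable def HH (K P : ℝ) (z : ℂ) : ℝ :=
  -(∫ r : ℝ, ∫ ω in (0:ℝ)..Real.pi,
      Real.cos (2 * (z * trh r ω).re) *
        (deriv (deriv (kfun K)) r * thetafun P ω +
          kfun K r * deriv (deriv (thetafun P)) ω))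

/-- `Φ(c) = Σ_m Σ_n a_m conj(a_n) S(m,n;c) 𝓗(2π √(mn)/c)`, the sums over distinguished
generators in the annulus `N < |·| ≤ √2 N`. -/
noncomputable def PhiSum (K P N : ℝ) (a : GaussianInt → ℂ) (c : GaussianInt) : ℂ :=
  ∑ᶠ m ∈ {m : GaussianInt | InAnn N m}, ∑ᶠ n ∈ {n : GaussianInt | InAnn N n},
    a m * conj (a n) * kloosterman m n c *
      ((HH K P (2 * Real.pi * ((m : ℂ) * (n : ℂ)) ^ ((1:ℂ)/2) / (c : ℂ)) : ℝ) : ℂ)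

lemma gi_normsq (n : GaussianInt) : ‖(n:ℂ)‖^2 = (n.re:ℝ)^2 + (n.im:ℝ)^2 := by
  rw [← Complex.normSq_eq_norm_sq, Complex.normSq_apply, ← GaussianInt.intCast_re,
    ← GaussianInt.intCast_im]; ring

lemma gi_one_le {n : GaussianInt} (h : n ≠ 0) : 1 ≤ ‖(n:ℂ)‖ := by
  have h1 : 0 < n.norm := GaussianInt.norm_pos.2 h
  have h2 : (1:ℝ) ≤ (n.norm : ℝ) := by exact_mod_cast h1
  rw [GaussianInt.intCast_real_norm, Complex.normSq_eq_norm_sq] at h2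
  nlinarith [norm_nonneg (n:ℂ)]

lemma gi_abs_re (n : GaussianInt) : |(n.re:ℝ)| ≤ ‖(n:ℂ)‖ := by
  rw [GaussianInt.intCast_re]; exact Complex.abs_re_le_norm _

lemma gi_abs_im (n : GaussianInt) : |(n.im:ℝ)| ≤ ‖(n:ℂ)‖ := by
  rw [GaussianInt.intCast_im]; exact Complex.abs_im_le_norm _

/-- bounded sets of Gaussian integers sit in an explicit box -/
lemma gi_box (R : ℝ) (hR : 0 ≤ R) : ∃ s : Finset GaussianInt,
    (∀ n : GaussianInt, ‖(n:ℂ)‖ ≤ R → n ∈ s) ∧ (s.card : ℝ) ≤ (2*R+1)^2 := by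
  classical
  let I := Finset.Icc (-⌊R⌋) ⌊R⌋
  refine ⟨(I ×ˢ I).image (fun p => (⟨p.1, p.2⟩ : GaussianInt)), ?_, ?_⟩
  · intro n hn
    refine Finset.mem_image.2 ⟨(n.re, n.im), ?_, rfl⟩
    have h1 := abs_le.1 ((gi_abs_re n).trans hn)
    have h2 := abs_le.1 ((gi_abs_im n).trans hn)
    simp only [I, Finset.mem_product, Finset.mem_Icc]
    refine ⟨⟨?_, ?_⟩, ⟨?_, ?_⟩⟩
    · rw [neg_le]; apply Int.le_floor.2; push_cast; linarith
    · apply Int.le_floor.2; linarith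
    · rw [neg_le]; apply Int.le_floor.2; push_cast; linarith
    · apply Int.le_floor.2; linarith
  · have hc : (I.card : ℝ) ≤ 2*R+1 := by
      have : 0 ≤ ⌊R⌋ := Int.floor_nonneg.2 hR
      have e : (I.card : ℤ) = 2*⌊R⌋+1 := by
        simp only [I, Int.card_Icc]; omega
      have e' : (I.card : ℝ) = 2*(⌊R⌋:ℝ)+1 := by exact_mod_cast e
      rw [e']; linarith [Int.floor_le R]
    calc _ ≤ ((I ×ˢ I).card : ℝ) := by exact_mod_cast Finset.card_image_le
      _ = (I.card:ℝ)^2 := by rw [Finset.card_product]; push_cast; ring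
      _ ≤ _ := by gcongr

lemma gi_finite (R : ℝ) : {n : GaussianInt | ‖(n:ℂ)‖ ≤ R}.Finite := by
  by_cases hR : 0 ≤ R
  · obtain ⟨s, hs, -⟩ := gi_box R hR
    exact s.finite_toSet.subset (fun n hn => hs n hn)
  · convert Set.finite_empty
    ext n; simp; linarith [norm_nonneg (n:ℂ)]

lemma gi_card_le (R : ℝ) (hR : 0 ≤ R) (s : Finset GaussianInt) (hs : ∀ n ∈ s, ‖(n:ℂ)‖ ≤ R) :
    (s.card : ℝ) ≤ (2*R+1)^2 := by
  obtain ⟨t, ht, hc⟩ := gi_box R hR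
  refine le_trans ?_ hc
  exact_mod_cast Finset.card_le_card (fun n hn => ht n (hs n hn))

lemma inAnn_finite (N : ℝ) : {m : GaussianInt | InAnn N m}.Finite :=
  (gi_finite (Real.sqrt 2 * N)).subset (fun n hn => hn.2.2)

lemma gi_summable (s : ℝ) (hs : 2 < s) : Summable (fun c : GaussianInt => ‖(c:ℂ)‖^(-s)) := by
  have h := EisensteinSeries.summable_one_div_norm_rpow hs
  let f : GaussianInt → (Fin 2 → ℤ) := fun c => ![c.re, c.im]
  have hf : Function.Injective f := by
    intro a b hab
    have h0 := congrFun hab 0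
    have h1 := congrFun hab 1
    simp [f] at h0 h1
    exact Zsqrtd.ext h0 h1
  refine Summable.of_nonneg_of_le (fun c => by positivity) (fun c => ?_) (h.comp_injective hf)
  simp only [Function.comp]
  by_cases hc : c = 0
  · subst hc
    have : f 0 = 0 := by ext i; fin_cases i <;> simp [f]
    rw [this]; simp
  · have h1 : ‖f c‖ ≤ ‖(c:ℂ)‖ := by
      rw [pi_norm_le_iff_of_nonneg (norm_nonneg _)]
      intro i; fin_cases i
      · simpa [f, Int.norm_eq_abs] using gi_abs_re c
      · simpa [f, Int.norm_eq_abs] using gi_abs_im c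
    have h2 : 0 < ‖f c‖ := by
      rw [norm_pos_iff]; intro h0; apply hc; apply hf; rw [h0]
      ext i; fin_cases i <;> simp [f]
    exact Real.rpow_le_rpow_of_nonpos h2 h1 (by linarith)

lemma exp_sum_one (l : ℝ) (hl : 0 < l) :
    Summable (fun k : ℤ => Real.exp (-(l*(k:ℝ)^2))) ∧
    ∑' k : ℤ, Real.exp (-(l*(k:ℝ)^2)) ≤ Real.exp (1/4) * (1 + 2 / Real.sqrt l) := by
  set t := Real.sqrt l with ht
  have htp : 0 < t := Real.sqrt_pos.2 hl
  have htt : t^2 = l := Real.sq_sqrt hl.le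
  set x := Real.exp (-t) with hx
  have hx0 : 0 < x := Real.exp_pos _
  have hx1 : x < 1 := by rw [hx, Real.exp_lt_one_iff]; linarith
  have hg := hasSum_geometric_of_lt_one hx0.le hx1
  have hsum : HasSum (fun k : ℤ => x ^ k.natAbs) (x * (1-x)⁻¹ + (1-x)⁻¹) := by
    have h1 : HasSum (fun n : ℕ => x ^ ((-(n+1:ℕ) : ℤ)).natAbs) (x * (1-x)⁻¹) := by
      have := hg.mul_left x
      refine this.congr_fun ?_ |> fun h => h
      intro n; simp only [Int.natAbs_neg, Int.natAbs_natCast, pow_succ]; ring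
    have h2 : HasSum (fun n : ℕ => x ^ ((n : ℤ)).natAbs) ((1-x)⁻¹) := by simpa using hg
    have := HasSum.of_nat_of_neg_add_one (f := fun k : ℤ => x ^ k.natAbs) h2 (by simpa using h1)
    rwa [add_comm] at this
  have hle : ∀ k : ℤ, Real.exp (-(l*(k:ℝ)^2)) ≤ Real.exp (1/4) * x ^ k.natAbs := by
    intro k
    rw [hx, ← Real.exp_nat_mul, ← Real.exp_add]
    apply Real.exp_le_exp.2
    have : ((k.natAbs : ℕ) : ℝ) = |(k:ℝ)| := by rw [Nat.cast_natAbs]; simp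
    rw [this, ← htt, ← sq_abs (k:ℝ)]
    nlinarith [sq_nonneg (t*|(k:ℝ)| - 1/2)]
  have hS := hsum.mul_left (Real.exp (1/4))
  have hs' : Summable (fun k : ℤ => Real.exp (-(l*(k:ℝ)^2))) :=
    Summable.of_nonneg_of_le (fun _ => (Real.exp_pos _).le) hle hS.summable
  refine ⟨hs', (hs'.tsum_le_tsum hle hS.summable).trans ?_⟩
  rw [hS.tsum_eq]
  apply mul_le_mul_of_nonneg_left _ (Real.exp_pos _).le
  have hkey : x * (1 + t) ≤ 1 := by
    have : 1 + t ≤ Real.exp t := by linarith [Real.add_one_le_exp t]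
    calc x * (1+t) ≤ x * Real.exp t := by gcongr
      _ = 1 := by rw [hx, ← Real.exp_add]; simp
  have h1x : 0 < 1 - x := by linarith
  have : x * (1-x)⁻¹ + (1-x)⁻¹ = (1+x)/(1-x) := by field_simp; ring
  rw [this, div_le_iff₀ h1x]
  have : (1 + 2/t) * (1-x) - (1+x) = 2 * (1 - x*(1+t)) / t := by field_simp; ring
  have h3 : 0 ≤ 2 * (1 - x*(1+t)) / t := by apply div_nonneg _ htp.le; linarith
  linarith

lemma gi_exp_sum (l : ℝ) (hl : 0 < l) (s : Finset GaussianInt) :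
    ∑ h ∈ s, Real.exp (-(l * ‖(h:ℂ)‖^2)) ≤ Real.exp (1/2) * (1 + 2 / Real.sqrt l)^2 := by
  classical
  obtain ⟨hs, hb⟩ := exp_sum_one l hl
  have hprod := hs.mul_of_nonneg hs (fun _ => (Real.exp_pos _).le) (fun _ => (Real.exp_pos _).le)
  have he : ∑' p : ℤ × ℤ, Real.exp (-(l*(p.1:ℝ)^2)) * Real.exp (-(l*(p.2:ℝ)^2)) =
    (∑' k : ℤ, Real.exp (-(l*(k:ℝ)^2))) * ∑' k : ℤ, Real.exp (-(l*(k:ℝ)^2)) :=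
    (hs.tsum_mul_tsum hs hprod).symm
  have h1 : ∑ h ∈ s, Real.exp (-(l * ‖(h:ℂ)‖^2)) =
      ∑ p ∈ s.image (fun h : GaussianInt => ((h.re, h.im) : ℤ × ℤ)), Real.exp (-(l*(p.1:ℝ)^2)) * Real.exp (-(l*(p.2:ℝ)^2)) := by
    rw [Finset.sum_image]
    · refine Finset.sum_congr rfl (fun h _ => ?_)
      rw [gi_normsq, ← Real.exp_add]; congr 1; ring
    · intro a _ b _ hab
      simp only [Prod.mk.injEq] at hab
      exact Zsqrtd.ext hab.1 hab.2
  rw [h1]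
  refine (hprod.sum_le_tsum _ (fun _ _ => by positivity)).trans ?_
  rw [he]
  have hn : 0 ≤ ∑' k : ℤ, Real.exp (-(l*(k:ℝ)^2)) := tsum_nonneg (fun _ => (Real.exp_pos _).le)
  calc _ ≤ (Real.exp (1/4) * (1 + 2 / Real.sqrt l)) * (Real.exp (1/4) * (1 + 2 / Real.sqrt l)) := by
        gcongr
    _ = _ := by
        have : Real.exp (1/2) = Real.exp (1/4) * Real.exp (1/4) := by rw [← Real.exp_add]; norm_num
        rw [this]; ring

/-- the quotient ring -/
abbrev QR (c : GaussianInt) := GaussianInt ⧸ Ideal.span {c}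

lemma efn_add (x y : ℂ) : efn (x+y) = efn x * efn y := by
  simp only [efn]; rw [← Complex.exp_add]; congr 1; rw [Complex.add_re]; push_cast; ring

lemma efn_gi (n : GaussianInt) : efn (n:ℂ) = 1 := by
  simp only [efn]
  rw [← GaussianInt.intCast_re, Complex.exp_eq_one_iff]
  exact ⟨n.re, by push_cast; ring⟩

lemma efn_norm (x : ℂ) : ‖efn x‖ = 1 := by
  simp only [efn]
  rw [show (2 * Real.pi * Complex.I * x.re : ℂ) = ((2*Real.pi*x.re : ℝ):ℂ) * Complex.I by push_cast; ring]
  exact Complex.norm_exp_ofReal_mul_I _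

lemma efn_eq_one {x : ℂ} (h : efn x = 1) : ∃ k : ℤ, x.re = k := by
  simp only [efn] at h
  rw [Complex.exp_eq_one_iff] at h
  obtain ⟨k, hk⟩ := h
  refine ⟨k, ?_⟩
  have h2 : (x.re : ℂ) = k := by
    have : (2 * Real.pi * Complex.I : ℂ) ≠ 0 := Complex.two_pi_I_ne_zero
    apply mul_left_cancel₀ this; rw [hk]; ring
  exact_mod_cast h2

lemma efn_congr (c : GaussianInt) {x y : GaussianInt}
    (h : (Ideal.Quotient.mk (Ideal.span {c}) x) = Ideal.Quotient.mk (Ideal.span {c}) y) :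
    efn ((x:ℂ)/(c:ℂ)) = efn ((y:ℂ)/c) := by
  by_cases hc : c = 0
  · subst hc; simp
  rw [Ideal.Quotient.eq, Ideal.mem_span_singleton] at h
  obtain ⟨t, ht⟩ := h
  have hc' : (c:ℂ) ≠ 0 := by simpa using hc
  have : (x:ℂ)/c = (y:ℂ)/c + (t:ℂ) := by
    have e : (x:ℂ) - y = c * t := by rw [← map_sub, ht, map_mul]
    field_simp; linear_combination e
  rw [this, efn_add, efn_gi, mul_one]

/-- The additive character. -/
noncomputable def psi (c : GaussianInt) : AddChar (QR c) ℂ where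
  toFun x := efn (((Quotient.out x : GaussianInt):ℂ) / (c:ℂ))
  map_zero_eq_one' := by
    rw [efn_congr c (y := 0)]
    · simp [efn]
    · rw [Ideal.Quotient.mk_out]; simp
  map_add_eq_mul' x y := by
    rw [efn_congr c (y := Quotient.out x + Quotient.out y)]
    · rw [map_add, add_div, efn_add]
    · rw [Ideal.Quotient.mk_out, map_add, Ideal.Quotient.mk_out, Ideal.Quotient.mk_out]

lemma psi_mk (c x : GaussianInt) : psi c (Ideal.Quotient.mk _ x) = efn ((x:ℂ)/c) := by
  change efn _ = _
  apply efn_congr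
  rw [Ideal.Quotient.mk_out]

lemma psi_norm (c : GaussianInt) (x : QR c) : ‖psi c x‖ = 1 := efn_norm _

lemma psi_conj (c : GaussianInt) (x : QR c) : conj (psi c x) = psi c (-x) := by
  rw [AddChar.map_neg_eq_inv]
  exact (Complex.inv_eq_conj (psi_norm c x)).symm

lemma psi_prim (c : GaussianInt) (hc : c ≠ 0) : (psi c).IsPrimitive := by
  intro a ha h
  apply ha
  obtain ⟨x, rfl⟩ := Ideal.Quotient.mk_surjective a
  have hc' : (c:ℂ) ≠ 0 := by simpa using hc
  have h1 : efn ((x:ℂ)/c) = 1 := by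
    have := congrArg (fun f => f 1) h
    simpa [AddChar.mulShift_apply, psi_mk] using this
  have h2 : efn (((x * ⟨0,1⟩ : GaussianInt):ℂ)/c) = 1 := by
    have := congrArg (fun f => f (Ideal.Quotient.mk _ ⟨0,1⟩)) h
    simp only [AddChar.mulShift_apply] at this
    rw [← map_mul, psi_mk] at this
    simpa using this
  obtain ⟨k, hk⟩ := efn_eq_one h1
  obtain ⟨l, hl⟩ := efn_eq_one h2
  have e : (((x * ⟨0,1⟩ : GaussianInt):ℂ)/c) = (x:ℂ)/c * Complex.I := by
    rw [map_mul]; simp [GaussianInt.toComplex_def']; ring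
  rw [e, Complex.mul_I_re] at hl
  rw [Ideal.Quotient.eq_zero_iff_mem, Ideal.mem_span_singleton]
  refine ⟨⟨k, -l⟩, ?_⟩
  rw [← GaussianInt.toComplex_inj, map_mul]
  have : (x:ℂ)/c = ((⟨k,-l⟩ : GaussianInt):ℂ) := by
    apply Complex.ext
    · rw [hk]; simp
    · rw [GaussianInt.im_toComplex]; push_cast; linarith
  rw [← this]; field_simp

lemma qr_surj (c : GaussianInt) (hc : c ≠ 0) (x : QR c) :
    ∃ n : GaussianInt, ‖(n:ℂ)‖ ≤ ‖(c:ℂ)‖ ∧ Ideal.Quotient.mk _ n = x := by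
  obtain ⟨y, rfl⟩ := Ideal.Quotient.mk_surjective x
  refine ⟨y % c, ?_, ?_⟩
  · have h := GaussianInt.norm_mod_lt y hc
    have h2 : ((y % c).norm : ℝ) < (c.norm : ℝ) := by exact_mod_cast h
    rw [GaussianInt.intCast_real_norm, GaussianInt.intCast_real_norm,
      Complex.normSq_eq_norm_sq, Complex.normSq_eq_norm_sq] at h2
    exact le_of_abs_le (abs_le_of_sq_le_sq h2.le (norm_nonneg _))
  · rw [Ideal.Quotient.eq, Ideal.mem_span_singleton, GaussianInt.mod_def]
    exact ⟨-(y/c), by ring⟩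

lemma qr_finite (c : GaussianInt) (hc : c ≠ 0) : Finite (QR c) := by
  have : Finite {n : GaussianInt | ‖(n:ℂ)‖ ≤ ‖(c:ℂ)‖} := gi_finite _
  apply Finite.of_surjective (fun n : {n : GaussianInt | ‖(n:ℂ)‖ ≤ ‖(c:ℂ)‖} =>
    (Ideal.Quotient.mk (Ideal.span {c}) n.1))
  intro x
  obtain ⟨n, hn, h⟩ := qr_surj c hc x
  exact ⟨⟨n, hn⟩, h⟩

lemma qr_card (c : GaussianInt) (hc : c ≠ 0) : (Nat.card (QR c) : ℝ) ≤ 9 * ‖(c:ℂ)‖^2 := by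
  obtain ⟨s, hs, hcard⟩ := gi_box ‖(c:ℂ)‖ (norm_nonneg _)
  have h1 : Nat.card (QR c) ≤ s.card := by
    have := Nat.card_le_card_of_surjective (fun n : s => (Ideal.Quotient.mk (Ideal.span {c}) n.1)) (by
      intro x
      obtain ⟨n, hn, h⟩ := qr_surj c hc x
      exact ⟨⟨n, hs n hn⟩, h⟩)
    simpa using this
  have h2 := gi_one_le hc
  calc (Nat.card (QR c) : ℝ) ≤ s.card := by exact_mod_cast h1
    _ ≤ (2*‖(c:ℂ)‖+1)^2 := hcard
    _ ≤ (3*‖(c:ℂ)‖)^2 := by gcongr; linarith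
    _ = _ := by ring

lemma psi_orth (c : GaussianInt) (hc : c ≠ 0) [Fintype (QR c)] [DecidableEq (QR c)] (b : QR c) :
    ∑ x : QR c, psi c (x * b) = if b = 0 then (Nat.card (QR c) : ℂ) else 0 := by
  rw [AddChar.sum_mulShift b (psi_prim c hc), Nat.card_eq_fintype_card]
  split_ifs <;> simp

lemma kloosterman_eq (c m n : GaussianInt) [Fintype (QR c)ˣ] :
    kloosterman m n c = ∑ u : (QR c)ˣ,
      psi c ((u : QR c) * Ideal.Quotient.mk _ m) * psi c (((u⁻¹ : (QR c)ˣ) : QR c) * Ideal.Quotient.mk _ n) := by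
  rw [kloosterman, finsum_eq_sum_of_fintype]
  refine Finset.sum_congr rfl (fun u _ => ?_)
  rw [← AddChar.map_add_eq_mul, ← psi_mk]
  congr 1
  rw [map_add, map_mul, map_mul, Ideal.Quotient.mk_out, Ideal.Quotient.mk_out]

/-- number of divisors -/
noncomputable def tauG (c : GaussianInt) : ℕ := {d : GaussianInt | d ∣ c}.ncard

lemma gi_dvd_norm {d c : GaussianInt} (hc : c ≠ 0) (h : d ∣ c) : ‖(d:ℂ)‖ ≤ ‖(c:ℂ)‖ := by
  obtain ⟨e, rfl⟩ := h
  have he : e ≠ 0 := right_ne_zero_of_mul hc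
  rw [map_mul, norm_mul]
  nlinarith [gi_one_le he, norm_nonneg (d:ℂ)]

lemma divs_finite {c : GaussianInt} (hc : c ≠ 0) : {d : GaussianInt | d ∣ c}.Finite :=
  (gi_finite ‖(c:ℂ)‖).subset (fun _ hd => gi_dvd_norm hc hd)

lemma tauG_pos {c : GaussianInt} (hc : c ≠ 0) : 1 ≤ tauG c := by
  rw [tauG, Nat.one_le_iff_ne_zero, ← Nat.pos_iff_ne_zero, Set.ncard_pos (divs_finite hc)]
  exact ⟨1, one_dvd c⟩

/-- fibres of multiplication by `m` -/
lemma fiber_card (c m : GaussianInt) (hc : c ≠ 0) (hm : m ≠ 0) (t : QR c) :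
    {x : QR c | Ideal.Quotient.mk _ m * x = t}.ncard ≤ Nat.card (QR m) := by
  have := qr_finite c hc
  have := qr_finite m hm
  rcases Set.eq_empty_or_nonempty {x : QR c | Ideal.Quotient.mk _ m * x = t} with he | ⟨x0, hx0⟩
  · rw [he]; simp
  have key : ∀ x : {x : QR c | Ideal.Quotient.mk _ m * x = t}, ∃ y : GaussianInt,
      m * (Quotient.out x.1 - Quotient.out x0) = c * y := by
    rintro ⟨x, hx⟩
    have h1 : Ideal.Quotient.mk (Ideal.span {c}) (m * (Quotient.out x - Quotient.out x0)) = 0 := by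
      rw [map_mul, map_sub, Ideal.Quotient.mk_out, Ideal.Quotient.mk_out, mul_sub]
      rw [Set.mem_ofPred_eq] at hx hx0
      rw [hx, hx0, sub_self]
    rwa [Ideal.Quotient.eq_zero_iff_mem, Ideal.mem_span_singleton] at h1
  choose y hy using key
  rw [← Nat.card_coe_set_eq]
  apply Nat.card_le_card_of_injective (fun x => Ideal.Quotient.mk (Ideal.span {m}) (y x))
  intro x x' hxx
  simp only [] at hxx
  rw [Ideal.Quotient.eq, Ideal.mem_span_singleton] at hxx
  obtain ⟨s, hs⟩ := hxx
  have h2 : m * (Quotient.out x.1 - Quotient.out x'.1) = m * (c * s) := by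
    linear_combination hy x - hy x' + c * hs
  have h3 := mul_left_cancel₀ hm h2
  apply Subtype.ext
  rw [← Ideal.Quotient.mk_out x.1, ← Ideal.Quotient.mk_out x'.1, Ideal.Quotient.eq,
    Ideal.mem_span_singleton]
  exact ⟨s, h3⟩

/-- multiples of `d` in the quotient -/
lemma mult_card (c d e : GaussianInt) (hc : c ≠ 0) (hde : d * e = c) :
    {x : QR c | Ideal.Quotient.mk _ d ∣ x}.ncard ≤ Nat.card (QR e) := by
  have := qr_finite c hc
  have he : e ≠ 0 := by rintro rfl; apply hc; rw [← hde]; simp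
  have := qr_finite e he
  have key : ∀ x : {x : QR c | Ideal.Quotient.mk _ d ∣ x}, ∃ y : GaussianInt,
      x.1 = Ideal.Quotient.mk _ (d * y) := by
    rintro ⟨x, y, rfl⟩
    obtain ⟨y, rfl⟩ := Ideal.Quotient.mk_surjective y
    exact ⟨y, by simp⟩
  choose y hy using key
  rw [← Nat.card_coe_set_eq]
  apply Nat.card_le_card_of_injective (fun x => Ideal.Quotient.mk (Ideal.span {e}) (y x))
  intro x x' hxx
  simp only [] at hxx
  rw [Ideal.Quotient.eq, Ideal.mem_span_singleton] at hxx
  obtain ⟨s, hs⟩ := hxx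
  apply Subtype.ext
  rw [hy, hy, Ideal.Quotient.eq, Ideal.mem_span_singleton]
  exact ⟨s, by rw [← hde]; linear_combination d * hs⟩

lemma exists_coprime_shift (x b : GaussianInt) (h : IsCoprime x b) (c : GaussianInt) (hc : c ≠ 0) :
    ∃ t, IsCoprime (x + b * t) c := by
  induction c using UniqueFactorizationMonoid.induction_on_prime with
  | h₁ => exact absurd rfl hc
  | h₂ u hu => exact ⟨0, by
      obtain ⟨v, hv⟩ := hu.exists_left_inv
      exact ⟨0, v, by rw [hv]; ring⟩⟩
  | h₃ c1 p hc1 hp ih =>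
    obtain ⟨t, ht⟩ := ih hc1
    have hy : IsCoprime (x + b * t) b := by
      exact h.add_mul_left_left t
    by_cases hpy : p ∣ x + b * t
    · refine ⟨t + c1, IsCoprime.mul_right ?_ ?_⟩
      · rw [isCoprime_comm, Irreducible.coprime_iff_not_dvd hp.irreducible]
        intro hd
        have h2 : p ∣ b * c1 := by
          have : b * c1 = (x + b * (t + c1)) - (x + b * t) := by ring
          rw [this]; exact dvd_sub hd hpy
        rcases hp.dvd_or_dvd h2 with h3 | h3
        · exact hp.not_isUnit (hy.isUnit_of_dvd' hpy h3)
        · exact hp.not_isUnit (ht.isUnit_of_dvd' hpy h3)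
      · have : x + b * (t + c1) = (x + b * t) + c1 * b := by ring
        rw [this]; exact ht.add_mul_left_left b
    · refine ⟨t, IsCoprime.mul_right ?_ ht⟩
      rw [isCoprime_comm]
      exact (Irreducible.coprime_iff_not_dvd hp.irreducible).2 hpy

lemma isUnit_mk_of_coprime {c u : GaussianInt} (h : IsCoprime u c) :
    IsUnit (Ideal.Quotient.mk (Ideal.span {c}) u) := by
  obtain ⟨a, b, hab⟩ := h
  apply IsUnit.of_mul_eq_one (Ideal.Quotient.mk (Ideal.span {c}) a)
  rw [← map_mul, ← map_one (Ideal.Quotient.mk (Ideal.span {c})), Ideal.Quotient.eq,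
    Ideal.mem_span_singleton]
  exact ⟨-b, by linear_combination hab⟩

lemma dvd_unit_rep (c : GaussianInt) (hc : c ≠ 0) (x : QR c) :
    ∃ d, d ∣ c ∧ ∃ u : (QR c)ˣ, Ideal.Quotient.mk _ d * (u : QR c) = x := by
  obtain ⟨x, rfl⟩ := Ideal.Quotient.mk_surjective x
  have hg : EuclideanDomain.gcd x c ≠ 0 := by
    intro h; exact hc (EuclideanDomain.gcd_eq_zero_iff.1 h).2
  set d := EuclideanDomain.gcd x c with hd
  obtain ⟨x', hx'⟩ := EuclideanDomain.gcd_dvd_left x c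
  obtain ⟨c', hc'⟩ := EuclideanDomain.gcd_dvd_right x c
  rw [← hd] at hx' hc'
  have hcop : IsCoprime x' c' := by
    have := EuclideanDomain.gcd_eq_gcd_ab x c
    rw [← hd] at this
    refine ⟨EuclideanDomain.gcdA x c, EuclideanDomain.gcdB x c, ?_⟩
    apply mul_left_cancel₀ hg
    linear_combination -this - EuclideanDomain.gcdA x c * hx' - EuclideanDomain.gcdB x c * hc'
  obtain ⟨t, ht⟩ := exists_coprime_shift x' c' hcop c hc
  refine ⟨d, ⟨c', hc'⟩, (isUnit_mk_of_coprime ht).unit, ?_⟩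
  rw [IsUnit.unit_spec, ← map_mul, Ideal.Quotient.eq, Ideal.mem_span_singleton]
  exact ⟨t, by linear_combination -hx' - t * hc'⟩

lemma phi_lower (c : GaussianInt) (hc : c ≠ 0) :
    Nat.card (QR c) ≤ tauG c * Nat.card (QR c)ˣ := by
  have := qr_finite c hc
  have : Finite {d : GaussianInt | d ∣ c} := divs_finite hc
  rw [tauG, ← Nat.card_coe_set_eq, ← Nat.card_prod]
  apply Nat.card_le_card_of_surjective (fun p : {d : GaussianInt | d ∣ c} × (QR c)ˣ =>
    Ideal.Quotient.mk _ p.1.1 * (p.2 : QR c))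
  intro x
  obtain ⟨d, hd, u, hu⟩ := dvd_unit_rep c hc x
  exact ⟨(⟨d, hd⟩, u), hu⟩

/-- Kloosterman sum on the quotient ring -/
noncomputable def KL (c : GaussianInt) [Fintype (QR c)ˣ] (x y : QR c) : ℂ :=
  ∑ u : (QR c)ˣ, psi c ((u : QR c) * x) * psi c (((u⁻¹ : (QR c)ˣ) : QR c) * y)

lemma KL_inv (c : GaussianInt) [Fintype (QR c)ˣ] (x y : QR c) (v : (QR c)ˣ) :
    KL c ((v : QR c) * x) (((v⁻¹ : (QR c)ˣ) : QR c) * y) = KL c x y := by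
  simp only [KL]
  refine Fintype.sum_equiv (Equiv.mulRight v) _ _ (fun u => ?_)
  simp only [Equiv.coe_mulRight, Units.val_mul, mul_inv_rev]
  congr 2 <;> ring

lemma l2_count (c : GaussianInt) (hc : c ≠ 0) [Fintype (QR c)] {ι : Type*} [Fintype ι]
    (A B : ι → QR c) :
    ∑ x : QR c, ∑ y : QR c, ‖∑ p, psi c (A p * x) * psi c (B p * y)‖^2 =
      (Nat.card (QR c) : ℝ)^2 * ({p : ι × ι | A p.1 = A p.2 ∧ B p.1 = B p.2}.ncard : ℝ) := by
  classical
  have h1 : ∀ x y : QR c, ((‖∑ p, psi c (A p * x) * psi c (B p * y)‖^2 : ℝ) : ℂ) =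
      ∑ p, ∑ p', psi c (x * (A p - A p')) * psi c (y * (B p - B p')) := by
    intro x y
    rw [Complex.ofReal_pow, ← Complex.mul_conj', map_sum, Finset.sum_mul_sum]
    refine Finset.sum_congr rfl (fun p _ => Finset.sum_congr rfl (fun p' _ => ?_))
    rw [map_mul (starRingEnd ℂ), psi_conj, psi_conj]
    rw [show x * (A p - A p') = A p * x + -(A p' * x) by ring,
      show y * (B p - B p') = B p * y + -(B p' * y) by ring,
      AddChar.map_add_eq_mul, AddChar.map_add_eq_mul]
    ring
  have h2 : ((∑ x : QR c, ∑ y : QR c, ‖∑ p, psi c (A p * x) * psi c (B p * y)‖^2 : ℝ) : ℂ) =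
      ∑ p, ∑ p', (∑ x : QR c, psi c (x * (A p - A p'))) * ∑ y : QR c, psi c (y * (B p - B p')) := by
    push_cast
    simp_rw [← Complex.ofReal_pow, h1, Finset.sum_mul_sum]
    calc _ = ∑ x : QR c, ∑ p, ∑ y : QR c, ∑ p', psi c (x * (A p - A p')) * psi c (y * (B p - B p')) := by
            refine Finset.sum_congr rfl (fun x _ => Finset.sum_comm)
      _ = ∑ p, ∑ x : QR c, ∑ y : QR c, ∑ p', psi c (x * (A p - A p')) * psi c (y * (B p - B p')) :=
            Finset.sum_comm
      _ = ∑ p, ∑ x : QR c, ∑ p', ∑ y : QR c, psi c (x * (A p - A p')) * psi c (y * (B p - B p')) := by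
            refine Finset.sum_congr rfl (fun p _ => Finset.sum_congr rfl (fun x _ => Finset.sum_comm))
      _ = _ := by
            refine Finset.sum_congr rfl (fun p _ => Finset.sum_comm)
  have h3 : ((∑ x : QR c, ∑ y : QR c, ‖∑ p, psi c (A p * x) * psi c (B p * y)‖^2 : ℝ) : ℂ) =
      (((Nat.card (QR c) : ℝ)^2 * ({p : ι × ι | A p.1 = A p.2 ∧ B p.1 = B p.2}.ncard : ℝ) : ℝ) : ℂ) := by
    rw [h2]
    simp_rw [psi_orth c hc, sub_eq_zero]
    rw [← Fintype.sum_prod_type (f := fun p : ι × ι => (if A p.1 = A p.2 then (Nat.card (QR c) : ℂ) else 0) *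
      (if B p.1 = B p.2 then (Nat.card (QR c) : ℂ) else 0))]
    have : {p : ι × ι | A p.1 = A p.2 ∧ B p.1 = B p.2} =
      ((Finset.univ.filter (fun p : ι × ι => A p.1 = A p.2 ∧ B p.1 = B p.2) : Finset _) : Set (ι × ι)) := by
      ext p; simp
    rw [this, Set.ncard_coe_finset]
    push_cast
    rw [Finset.card_filter]
    push_cast
    rw [Finset.mul_sum]
    refine Finset.sum_congr rfl (fun p _ => ?_)
    by_cases ha : A p.1 = A p.2 <;> by_cases hb : B p.1 = B p.2 <;> simp [ha, hb] <;> ring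
  exact_mod_cast h3

lemma KL_four (c : GaussianInt) (hc : c ≠ 0) [Fintype (QR c)] [Fintype (QR c)ˣ] :
    ∑ x : QR c, ∑ y : QR c, ‖KL c x y‖^4 =
      (Nat.card (QR c) : ℝ)^2 * ({p : ((QR c)ˣ × (QR c)ˣ) × ((QR c)ˣ × (QR c)ˣ) |
        (p.1.1 : QR c) + p.1.2 = p.2.1 + p.2.2 ∧
        ((p.1.1⁻¹ : (QR c)ˣ) : QR c) + (p.1.2⁻¹ : (QR c)ˣ) = (p.2.1⁻¹ : (QR c)ˣ) + (p.2.2⁻¹ : (QR c)ˣ)}.ncard : ℝ) := by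
  rw [← l2_count c hc (ι := (QR c)ˣ × (QR c)ˣ) (fun p => (p.1 : QR c) + p.2)
    (fun p => ((p.1⁻¹ : (QR c)ˣ) : QR c) + (p.2⁻¹ : (QR c)ˣ))]
  refine Finset.sum_congr rfl (fun x _ => Finset.sum_congr rfl (fun y _ => ?_))
  have : (KL c x y)^2 = ∑ p : (QR c)ˣ × (QR c)ˣ, psi c (((p.1 : QR c) + p.2) * x) *
      psi c ((((p.1⁻¹ : (QR c)ˣ) : QR c) + (p.2⁻¹ : (QR c)ˣ)) * y) := by
    rw [sq, KL, Finset.sum_mul_sum, Fintype.sum_prod_type]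
    refine Finset.sum_congr rfl (fun p _ => Finset.sum_congr rfl (fun p' _ => ?_))
    rw [add_mul, add_mul, AddChar.map_add_eq_mul, AddChar.map_add_eq_mul]; ring
  rw [← this, norm_pow]; ring

lemma dvd_of_mk_mul {c A B C : GaussianInt}
    (h : Ideal.Quotient.mk (Ideal.span {c}) A * (Ideal.Quotient.mk _ B * Ideal.Quotient.mk _ C) = 0) :
    ∃ d f g, d * (f * g) = c ∧ d ∣ A ∧ f ∣ B ∧ g ∣ C := by
  rw [← map_mul, ← map_mul, Ideal.Quotient.eq_zero_iff_mem, Ideal.mem_span_singleton] at h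
  obtain ⟨d, e, hd, he, rfl⟩ := exists_dvd_and_dvd_of_dvd_mul h
  obtain ⟨f, g, hf, hg, rfl⟩ := exists_dvd_and_dvd_of_dvd_mul he
  exact ⟨d, f, g, rfl, hd, hf, hg⟩

/-- points with `(2a+x-y)xy=0` -/
lemma triple_count (c : GaussianInt) (hc : c ≠ 0) :
    (({p : QR c × QR c × QR c | (2 * p.1 + p.2.1 - p.2.2) * (p.2.1 * p.2.2) = 0}.ncard : ℕ) : ℝ) ≤
      36 * 729 * ‖(c:ℂ)‖^4 * (tauG c)^2 := by
  classical
  have := qr_finite c hc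
  have := Fintype.ofFinite (QR c)
  let D := (divs_finite hc).toFinset
  have hD : D.card = tauG c := by rw [tauG, Set.ncard_eq_toFinset_card _ (divs_finite hc)]
  let M : GaussianInt → Finset (QR c) := fun d => Finset.univ.filter (fun x => Ideal.Quotient.mk _ d ∣ x)
  have hM : ∀ d e, d * e = c → ((M d).card : ℝ) ≤ 9 * ‖(e:ℂ)‖^2 := by
    intro d e hde
    have he : e ≠ 0 := by rintro rfl; apply hc; rw [← hde]; simp
    have h1 := mult_card c d e hc hde
    have h2 : {x : QR c | Ideal.Quotient.mk _ d ∣ x} = (M d : Set (QR c)) := by ext; simp [M]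
    rw [h2, Set.ncard_coe_finset] at h1
    exact le_trans (by exact_mod_cast h1) (qr_card e he)
  let T : GaussianInt × GaussianInt × GaussianInt → Finset (QR c × QR c × QR c) := fun t =>
    Finset.univ.filter (fun p => Ideal.Quotient.mk _ t.1 ∣ (2 * p.1 + p.2.1 - p.2.2) ∧
      Ideal.Quotient.mk _ t.2.1 ∣ p.2.1 ∧ Ideal.Quotient.mk _ t.2.2 ∣ p.2.2)
  have h2ne : (2 : GaussianInt) ≠ 0 := two_ne_zero
  have hn2 : ‖((2:GaussianInt):ℂ)‖ = 2 := by
    rw [show ((2:GaussianInt):ℂ) = 2 from map_ofNat GaussianInt.toComplex 2]; norm_num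
  have hq2 : Ideal.Quotient.mk (Ideal.span {c}) (2:GaussianInt) = 2 := map_ofNat _ 2
  have hfib : ∀ t : QR c, ((Finset.univ.filter (fun x : QR c => 2 * x = t)).card : ℝ) ≤ 36 := by
    intro t
    have h1 := fiber_card c 2 hc h2ne t
    have h2 : {x : QR c | Ideal.Quotient.mk _ (2:GaussianInt) * x = t} =
      ((Finset.univ.filter (fun x : QR c => 2 * x = t) : Finset (QR c)) : Set (QR c)) := by
        ext; rw [hq2]; simp
    rw [h2, Set.ncard_coe_finset] at h1
    refine le_trans (by exact_mod_cast h1) ((qr_card 2 h2ne).trans ?_)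
    rw [hn2]; norm_num
  have hT : ∀ d f g, d * (f * g) = c → ((T (d, f, g)).card : ℝ) ≤ 36 * 729 * ‖(c:ℂ)‖^4 := by
    intro d f g h
    have hsub : (T (d,f,g)).card ≤ 36 * (M d ×ˢ M f ×ˢ M g).card := by
      refine Finset.card_le_mul_card_image_of_maps_to (s := T (d,f,g)) (t := M d ×ˢ M f ×ˢ M g)
        (f := fun p => (2 * p.1 + p.2.1 - p.2.2, p.2.1, p.2.2)) ?_ 36 ?_
      · intro p hp
        simpa [T, M] using hp
      · rintro ⟨s, x, y⟩ -
        have h1 := hfib (s - x + y)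
        have h2 : (Finset.univ.filter (fun z : QR c => 2 * z = s - x + y)).card ≤ 36 := by
          exact_mod_cast h1
        refine le_trans ?_ h2
        refine Finset.card_le_card_of_injOn (fun p => p.1) ?_ ?_
        · rintro ⟨p1, p2, p3⟩ hp
          simp only [Finset.coe_filter, Set.mem_ofPred_eq, Prod.mk.injEq] at hp
          obtain ⟨-, h3, rfl, rfl⟩ := hp
          simp only [Finset.coe_filter, Set.mem_ofPred_eq, Finset.mem_univ, true_and]
          rw [← h3]; ring
        · rintro ⟨p1, p2, p3⟩ hp ⟨q1, q2, q3⟩ hq h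
          simp only [Finset.coe_filter, Set.mem_ofPred_eq, Prod.mk.injEq] at hp hq h
          obtain ⟨-, -, rfl, rfl⟩ := hp
          obtain ⟨-, -, rfl, rfl⟩ := hq
          subst h; rfl
    have e1 := hM d (f*g) h
    have e2 := hM f (d*g) (by rw [← h]; ring)
    have e3 := hM g (d*f) (by rw [← h]; ring)
    have hcn : ‖(c:ℂ)‖ = ‖(d:ℂ)‖ * (‖(f:ℂ)‖ * ‖(g:ℂ)‖) := by
      rw [← h, map_mul, map_mul, norm_mul, norm_mul]
    rw [map_mul, norm_mul] at e1 e2 e3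
    have hsub' : ((T (d,f,g)).card : ℝ) ≤ 36 * ((M d).card * ((M f).card * (M g).card)) := by
      rw [Finset.card_product, Finset.card_product] at hsub
      exact_mod_cast hsub
    refine hsub'.trans ?_
    calc (36:ℝ) * ((M d).card * ((M f).card * (M g).card)) ≤
        36 * ((9 * (‖(f:ℂ)‖ * ‖(g:ℂ)‖)^2) * ((9 * (‖(d:ℂ)‖ * ‖(g:ℂ)‖)^2) * (9 * (‖(d:ℂ)‖ * ‖(f:ℂ)‖)^2))) := by
          gcongr
      _ = _ := by rw [hcn]; ring
  let S := (D ×ˢ D ×ˢ D).filter (fun t => t.1 * (t.2.1 * t.2.2) = c)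
  have hS : S.card ≤ tauG c ^ 2 := by
    have : S.card ≤ (D ×ˢ D).card := by
      refine Finset.card_le_card_of_injOn (fun t => (t.1, t.2.1)) ?_ ?_
      · rintro ⟨d, f, g⟩ hp
        simp only [S, Finset.coe_filter, Set.mem_ofPred_eq, Finset.mem_product] at hp
        simp only [Finset.coe_product, Set.mem_prod, Finset.mem_coe]
        exact ⟨hp.1.1, hp.1.2.1⟩
      · rintro ⟨d, f, g⟩ hp ⟨d', f', g'⟩ hq h
        simp only [S, Finset.coe_filter, Set.mem_ofPred_eq] at hp hq
        simp only [Prod.mk.injEq] at h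
        obtain ⟨rfl, rfl⟩ := h
        have h5 := hp.2.trans hq.2.symm
        have hd : d ≠ 0 := by rintro rfl; apply hc; rw [← hp.2]; simp
        have hf : f ≠ 0 := by rintro rfl; apply hc; rw [← hp.2]; simp
        have := mul_left_cancel₀ hf (mul_left_cancel₀ hd h5)
        rw [this]
    rw [Finset.card_product, hD] at this
    rw [sq]; exact this
  have hcov : {p : QR c × QR c × QR c | (2 * p.1 + p.2.1 - p.2.2) * (p.2.1 * p.2.2) = 0} ⊆
      ((S.biUnion T : Finset (QR c × QR c × QR c)) : Set (QR c × QR c × QR c)) := by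
    rintro ⟨p1, p2, p3⟩ hp
    simp only [Set.mem_ofPred_eq] at hp
    obtain ⟨A, hA⟩ := Ideal.Quotient.mk_surjective (2 * p1 + p2 - p3)
    obtain ⟨B, hB⟩ := Ideal.Quotient.mk_surjective p2
    obtain ⟨C, hC⟩ := Ideal.Quotient.mk_surjective p3
    rw [← hA] at hp
    nth_rewrite 1 [← hB] at hp
    nth_rewrite 1 [← hC] at hp
    obtain ⟨d, f, g, h, h1, h2, h3⟩ := dvd_of_mk_mul hp
    simp only [Finset.coe_biUnion, Set.mem_iUnion, Finset.mem_coe]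
    refine ⟨(d,f,g), ?_, ?_⟩
    · simp only [S, D, Finset.mem_filter, Finset.mem_product, Set.Finite.mem_toFinset, Set.mem_ofPred_eq]
      refine ⟨⟨?_, ?_, ?_⟩, h⟩
      · exact ⟨_, h.symm⟩
      · exact ⟨d * g, by rw [← h]; ring⟩
      · exact ⟨d * f, by rw [← h]; ring⟩
    · simp only [T, Finset.mem_filter, Finset.mem_univ, true_and]
      refine ⟨?_, ?_, ?_⟩
      · rw [← hA]; exact map_dvd _ h1
      · rw [← hB]; exact map_dvd _ h2
      · rw [← hC]; exact map_dvd _ h3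
  have h6 := Set.ncard_le_ncard hcov (Finset.finite_toSet _)
  rw [Set.ncard_coe_finset] at h6
  have h7 : (((S.biUnion T).card : ℕ) : ℝ) ≤ ∑ t ∈ S, ((T t).card : ℝ) := by
    exact_mod_cast Finset.card_biUnion_le
  calc _ ≤ (((S.biUnion T).card : ℕ) : ℝ) := by exact_mod_cast h6
    _ ≤ ∑ t ∈ S, ((T t).card : ℝ) := h7
    _ ≤ ∑ t ∈ S, 36 * 729 * ‖(c:ℂ)‖^4 := by
        refine Finset.sum_le_sum (fun t ht => ?_)
        obtain ⟨d, f, g⟩ := t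
        exact hT d f g (Finset.mem_filter.mp ht).2
    _ = S.card * (36 * 729 * ‖(c:ℂ)‖^4) := by simp
    _ ≤ ((tauG c ^ 2 : ℕ) : ℝ) * (36 * 729 * ‖(c:ℂ)‖^4) := by
        gcongr
    _ = _ := by push_cast; ring

lemma energy_bound (c : GaussianInt) (hc : c ≠ 0) :
    (({p : ((QR c)ˣ × (QR c)ˣ) × ((QR c)ˣ × (QR c)ˣ) |
        (p.1.1 : QR c) + p.1.2 = p.2.1 + p.2.2 ∧
        ((p.1.1⁻¹ : (QR c)ˣ) : QR c) + (p.1.2⁻¹ : (QR c)ˣ) = (p.2.1⁻¹ : (QR c)ˣ) + (p.2.2⁻¹ : (QR c)ˣ)}.ncard : ℕ) : ℝ) ≤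
      36 * 729 * ‖(c:ℂ)‖^4 * (tauG c)^2 := by
  have := qr_finite c hc
  refine le_trans ?_ (triple_count c hc)
  norm_cast
  refine Set.ncard_le_ncard_of_injOn (fun p => ((p.1.1 : QR c), (p.2.1 : QR c) - p.1.1, (p.2.1 : QR c) - p.1.2)) ?_ ?_ (Set.toFinite _)
  · rintro ⟨⟨u, v⟩, ⟨w, z⟩⟩ ⟨h1, h2⟩
    simp only at h1 h2
    simp only [Set.mem_ofPred_eq]
    have hz : (z : QR c) = u + v - w := by rw [h1]; ring
    have h3 : ((u:QR c) + v) * (w * z) = (w + z) * (u * v) := by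
      have e : ((v : QR c) + u) * (((u⁻¹ : (QR c)ˣ) : QR c) * (v⁻¹ : (QR c)ˣ)) = ((u⁻¹ : (QR c)ˣ) : QR c) + (v⁻¹ : (QR c)ˣ) := by
        have a1 := Units.mul_inv u
        have a2 := Units.mul_inv v
        linear_combination (((v⁻¹ : (QR c)ˣ) : QR c)) * a1 + ((u⁻¹ : (QR c)ˣ) : QR c) * a2
      have a1 := Units.mul_inv u
      have a2 := Units.mul_inv v
      have a3 := Units.mul_inv w
      have a4 := Units.mul_inv z
      have e1 : ((u:QR c) * v * w * z) * (((u⁻¹ : (QR c)ˣ) : QR c) + (v⁻¹ : (QR c)ˣ)) = (u + v) * (w * z) := by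
        linear_combination (v * w * z : QR c) * a1 + (u * w * z : QR c) * a2
      have e2 : ((u:QR c) * v * w * z) * (((w⁻¹ : (QR c)ˣ) : QR c) + (z⁻¹ : (QR c)ˣ)) = (w + z) * (u * v) := by
        linear_combination (u * v * z : QR c) * a3 + (u * v * w : QR c) * a4
      rw [← e1, ← e2, h2]
    have h4 : ((u:QR c) + v) * (u * v - w * z) = 0 := by
      rw [← h1] at h3; linear_combination -h3
    rw [hz] at h4
    linear_combination h4
  · rintro ⟨⟨u, v⟩, ⟨w, z⟩⟩ ⟨h1, h2⟩ ⟨⟨u', v'⟩, ⟨w', z'⟩⟩ ⟨h1', h2'⟩ h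
    simp only at h1 h1'
    simp only [Prod.mk.injEq] at h
    obtain ⟨a, b, d⟩ := h
    have hu : u = u' := Units.ext a
    subst hu
    have hw : w = w' := Units.ext (by linear_combination b)
    subst hw
    have hv : v = v' := Units.ext (by linear_combination -d)
    subst hv
    have hz : z = z' := Units.ext (by linear_combination h1' - h1)
    subst hz
    rfl

lemma KL_bound (c m : GaussianInt) (hc : c ≠ 0) (hm : m ≠ 0) [Fintype (QR c)] [Fintype (QR c)ˣ] (y : QR c) :
    (Nat.card (QR c)ˣ : ℝ) * ‖KL c (Ideal.Quotient.mk _ m) y‖^4 ≤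
      (9 * ‖(m:ℂ)‖^2) * ∑ x : QR c, ∑ y : QR c, ‖KL c x y‖^4 := by
  classical
  set x : QR c := Ideal.Quotient.mk _ m with hx
  have h1 : (Nat.card (QR c)ˣ : ℝ) * ‖KL c x y‖^4 =
      ∑ v : (QR c)ˣ, (fun p : QR c × QR c => ‖KL c p.1 p.2‖^4) ((v : QR c) * x, ((v⁻¹ : (QR c)ˣ) : QR c) * y) := by
    simp only [KL_inv]
    simp
  rw [h1, ← Fintype.sum_prod_type (f := fun p : QR c × QR c => ‖KL c p.1 p.2‖^4), Finset.mul_sum]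
  rw [← Finset.sum_fiberwise (s := (Finset.univ : Finset (QR c)ˣ)) (g := fun v : (QR c)ˣ => ((v : QR c) * x, ((v⁻¹ : (QR c)ˣ) : QR c) * y))]
  refine Finset.sum_le_sum (fun t _ => ?_)
  have h2 : ∑ v ∈ Finset.univ.filter (fun v : (QR c)ˣ => ((v : QR c) * x, ((v⁻¹ : (QR c)ˣ) : QR c) * y) = t),
      (fun p : QR c × QR c => ‖KL c p.1 p.2‖^4) ((v : QR c) * x, ((v⁻¹ : (QR c)ˣ) : QR c) * y) =
      ∑ v ∈ Finset.univ.filter (fun v : (QR c)ˣ => ((v : QR c) * x, ((v⁻¹ : (QR c)ˣ) : QR c) * y) = t),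
        ‖KL c t.1 t.2‖^4 := by
    refine Finset.sum_congr rfl (fun v hv => ?_)
    rw [(Finset.mem_filter.mp hv).2]
  rw [h2, Finset.sum_const, nsmul_eq_mul]
  gcongr
  refine le_trans ?_ (qr_card m hm)
  norm_cast
  refine le_trans ?_ (fiber_card c m hc hm t.1)
  rw [← Set.ncard_coe_finset]
  refine Set.ncard_le_ncard_of_injOn (fun v => (v : QR c)) ?_ ?_ (Set.toFinite _)
  · intro v hv
    simp only [Finset.coe_filter, Set.mem_ofPred_eq] at hv
    simp only [Set.mem_ofPred_eq]
    rw [← hv.2, mul_comm]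
  · intro v _ w _ h
    exact Units.ext h

lemma kloosterman_four (m n c : GaussianInt) (hc : c ≠ 0) (hm : m ≠ 0) :
    ‖kloosterman m n c‖^4 ≤ 39^4 * ‖(m:ℂ)‖^2 * ‖(c:ℂ)‖^6 * (tauG c : ℝ)^4 := by
  have := qr_finite c hc
  have := Fintype.ofFinite (QR c)
  have := Fintype.ofFinite (QR c)ˣ
  have h0 : kloosterman m n c = KL c (Ideal.Quotient.mk _ m) (Ideal.Quotient.mk _ n) := by
    rw [kloosterman_eq, KL]
  rw [h0]
  set S := ‖KL c (Ideal.Quotient.mk _ m) (Ideal.Quotient.mk _ n)‖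
  have h1 := KL_bound c m hc hm (Ideal.Quotient.mk _ n)
  rw [KL_four c hc] at h1
  have h2 := energy_bound c hc
  have h3 : (Nat.card (QR c) : ℝ) ≤ tauG c * Nat.card (QR c)ˣ := by exact_mod_cast phi_lower c hc
  have h4 := qr_card c hc
  have hq : 0 < (Nat.card (QR c) : ℝ) := by exact_mod_cast Nat.card_pos
  have ht : (1:ℝ) ≤ tauG c := by exact_mod_cast tauG_pos hc
  set q := (Nat.card (QR c) : ℝ)
  have h5 : q * S^4 ≤ q * (39^4 * ‖(m:ℂ)‖^2 * ‖(c:ℂ)‖^6 * (tauG c : ℝ)^4) := by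
    calc q * S^4 ≤ tauG c * Nat.card (QR c)ˣ * S^4 := by gcongr
      _ = tauG c * (Nat.card (QR c)ˣ * S^4) := by ring
      _ ≤ tauG c * ((9 * ‖(m:ℂ)‖^2) * (q^2 * (36 * 729 * ‖(c:ℂ)‖^4 * (tauG c)^2))) := by
          refine mul_le_mul_of_nonneg_left (h1.trans ?_) (by positivity)
          gcongr
      _ = q * ((9 * ‖(m:ℂ)‖^2) * (q * (36 * 729 * ‖(c:ℂ)‖^4 * (tauG c)^3))) := by ring
      _ ≤ q * ((9 * ‖(m:ℂ)‖^2) * ((9 * ‖(c:ℂ)‖^2) * (36 * 729 * ‖(c:ℂ)‖^4 * (tauG c)^4))) := by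
          gcongr
          norm_num
      _ = q * (2125764 * (‖(m:ℂ)‖^2 * ‖(c:ℂ)‖^6 * (tauG c : ℝ)^4)) := by ring
      _ ≤ q * (39^4 * (‖(m:ℂ)‖^2 * ‖(c:ℂ)‖^6 * (tauG c : ℝ)^4)) := by gcongr; norm_num
      _ = _ := by ring
  exact le_of_mul_le_mul_left h5 hq

lemma kloosterman_bound (m n c : GaussianInt) (hc : c ≠ 0) (hm : m ≠ 0) :
    ‖kloosterman m n c‖ ≤ 39 * ‖(m:ℂ)‖^((1:ℝ)/2) * ‖(c:ℂ)‖^((3:ℝ)/2) * tauG c := by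
  refine le_of_pow_le_pow_left₀ (n := 4) (by norm_num) (by positivity) ?_
  refine (kloosterman_four m n c hc hm).trans (le_of_eq ?_)
  rw [mul_pow, mul_pow, mul_pow, ← Real.rpow_natCast (‖(m:ℂ)‖^((1:ℝ)/2)), ← Real.rpow_natCast (‖(c:ℂ)‖^((3:ℝ)/2)),
    ← Real.rpow_mul (norm_nonneg _), ← Real.rpow_mul (norm_nonneg _)]
  norm_num

open MeasureTheory

lemma gauss_int (b : ℝ) (hb : 0 < b) : Integrable (fun ξ : ℂ => Real.exp (-b * ‖ξ‖^2)) := by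
  have := (GaussianFourier.integrable_cexp_neg_mul_sq_norm_add (V := ℂ) (b := (b:ℂ)) (by simpa using hb) 0 0).norm
  refine this.congr (Filter.Eventually.of_forall fun ξ => ?_)
  simp only [Complex.norm_exp]
  norm_cast
  simp

lemma gauss_int_shift (b : ℝ) (hb : 0 < b) (s : ℂ) : Integrable (fun ξ : ℂ => Real.exp (-b * ‖ξ - s‖^2)) :=
  (gauss_int b hb).comp_sub_right s

lemma gauss_val (b : ℝ) (hb : 0 < b) (s : ℂ) : ∫ ξ : ℂ, Real.exp (-b * ‖ξ - s‖^2) = π / b := by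
  rw [integral_sub_right_eq_self (fun ξ : ℂ => Real.exp (-b * ‖ξ‖^2)) s]
  rw [GaussianFourier.integral_rexp_neg_mul_sq_norm hb]
  simp

lemma re_inner (w ξ : ℂ) : inner ℝ (conj w) ξ = (w * ξ).re := by
  simp [Complex.inner]; ring

lemma gft (b : ℝ) (hb : 0 < b) (w : ℂ) :
    ∫ ξ : ℂ, (Real.exp (-b * ‖ξ‖^2) : ℂ) * cexp (I * ((w * ξ).re : ℝ)) =
      ((π / b * Real.exp (-‖w‖^2 / (4 * b)) : ℝ) : ℂ) := by
  have := GaussianFourier.integral_cexp_neg_mul_sq_norm_add (V := ℂ) (b := (b:ℂ)) (by simpa using hb) I (conj w)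
  simp only [re_inner, Complex.exp_add] at this
  simp only [Complex.ofReal_exp] 
  push_cast at this ⊢
  rw [this]
  simp

lemma gft_shift (b : ℝ) (hb : 0 < b) (w x : ℂ) :
    ∫ ξ : ℂ, (Real.exp (-b * ‖ξ - x‖^2) : ℂ) * cexp (I * ((w * ξ).re : ℝ)) =
      ((π / b * Real.exp (-‖w‖^2 / (4 * b)) : ℝ) : ℂ) * cexp (I * ((w * x).re : ℝ)) := by
  rw [← gft b hb, ← integral_mul_const]
  rw [← integral_sub_right_eq_self (fun ξ : ℂ => (Real.exp (-b * ‖ξ‖^2) : ℂ) * cexp (I * ((w * ξ).re : ℝ)) * cexp (I * ((w * x).re : ℝ))) x]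
  congr 1
  ext ξ
  rw [mul_assoc, ← Complex.exp_add, ← mul_add, ← Complex.ofReal_add, ← Complex.add_re]
  congr 5
  ring

lemma orth_sum (c : GaussianInt) (hc : c ≠ 0) [Fintype (QR c)] [DecidableEq (QR c)] (M : Finset GaussianInt)
    (g : GaussianInt → ℂ) :
    ((∑ x : QR c, ‖∑ m ∈ M, g m * psi c (x * Ideal.Quotient.mk _ m)‖^2 : ℝ) : ℂ) =
      (Nat.card (QR c) : ℂ) * ∑ m ∈ M, ∑ m' ∈ M,
        if (Ideal.Quotient.mk (Ideal.span {c}) m) = Ideal.Quotient.mk _ m' then g m * conj (g m') else 0 := by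
  have h1 : ∀ x : QR c, ((‖∑ m ∈ M, g m * psi c (x * Ideal.Quotient.mk _ m)‖^2 : ℝ) : ℂ) =
      ∑ m ∈ M, ∑ m' ∈ M, (g m * conj (g m')) * psi c (x * (Ideal.Quotient.mk _ m - Ideal.Quotient.mk _ m')) := by
    intro x
    rw [Complex.ofReal_pow, ← Complex.mul_conj', map_sum, Finset.sum_mul_sum]
    refine Finset.sum_congr rfl (fun p _ => Finset.sum_congr rfl (fun p' _ => ?_))
    rw [map_mul (starRingEnd ℂ), psi_conj, mul_sub, sub_eq_add_neg, AddChar.map_add_eq_mul]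
    ring
  rw [Complex.ofReal_sum]
  simp_rw [h1]
  rw [Finset.sum_comm, Finset.mul_sum]
  refine Finset.sum_congr rfl (fun m _ => ?_)
  rw [Finset.sum_comm, Finset.mul_sum]
  refine Finset.sum_congr rfl (fun m' _ => ?_)
  rw [← Finset.mul_sum, psi_orth c hc]
  simp only [sub_eq_zero]
  split_ifs <;> simp [mul_comm]

lemma orth_le (c : GaussianInt) (hc : c ≠ 0) [Fintype (QR c)] [DecidableEq (QR c)] (M : Finset GaussianInt)
    (g : GaussianInt → ℂ) :
    ∑ x : QR c, ‖∑ m ∈ M, g m * psi c (x * Ideal.Quotient.mk _ m)‖^2 ≤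
      (Nat.card (QR c) : ℝ) * ∑ m ∈ M, ∑ m' ∈ M,
        if (Ideal.Quotient.mk (Ideal.span {c}) m) = Ideal.Quotient.mk _ m' then ‖g m‖ * ‖g m'‖ else 0 := by
  have h := congrArg norm (orth_sum c hc M g)
  rw [Complex.norm_real, Real.norm_of_nonneg (by positivity)] at h
  rw [h, norm_mul, Complex.norm_natCast]
  gcongr
  refine (norm_sum_le _ _).trans (Finset.sum_le_sum fun m _ => ?_)
  refine (norm_sum_le _ _).trans (Finset.sum_le_sum fun m' _ => ?_)
  split_ifs <;> simp

lemma gauss_prod_le (b : ℝ) (hb : 2 ≤ b) (x x' ξ : ℂ) (hx : ‖x‖^2 ≤ 3/2) (hx' : ‖x'‖^2 ≤ 3/2) :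
    Real.exp (-b * ‖ξ - x‖^2) * Real.exp (-b * ‖ξ - x'‖^2) * Real.exp (‖ξ‖^2) ≤
      Real.exp 3 * Real.exp (-b * ‖x - x'‖^2 / 2) * Real.exp (-b * ‖ξ - (x + x')/2‖^2) := by
  rw [← Real.exp_add, ← Real.exp_add, ← Real.exp_add, ← Real.exp_add, Real.exp_le_exp]
  rw [← Complex.normSq_eq_norm_sq] at *
  rw [← Complex.normSq_eq_norm_sq] at *
  simp only [← Complex.normSq_eq_norm_sq]
  rw [Complex.normSq_apply] at *
  rw [Complex.normSq_apply] at *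
  simp only [Complex.normSq_apply, Complex.sub_re, Complex.sub_im, Complex.add_re, Complex.add_im,
    Complex.div_ofNat_re, Complex.div_ofNat_im]
  set p := ξ.re - (x.re+x'.re)/2 with hp
  set q := ξ.im - (x.im+x'.im)/2 with hq
  have h1 : ξ.re = p + (x.re+x'.re)/2 := by rw [hp]; ring
  have h2 : ξ.im = q + (x.im+x'.im)/2 := by rw [hq]; ring
  rw [h1, h2]
  have h3 : 0 ≤ (b-2) * (p*p+q*q) := mul_nonneg (by linarith) (by nlinarith [sq_nonneg p, sq_nonneg q])
  nlinarith [sq_nonneg (p - (x.re+x'.re)/2), sq_nonneg (q - (x.im+x'.im)/2), sq_nonneg (x.re - x'.re), sq_nonneg (x.im-x'.im)]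

lemma exp_consts : (Real.exp 3 + Real.exp 1) / 2 ≤ 20 := by
  have h := Real.exp_one_lt_d9
  have h3 : Real.exp 3 = Real.exp 1 ^ 3 := by rw [← Real.exp_nat_mul]; norm_num
  have h0 := Real.exp_pos 1
  have : Real.exp 1 ^ 3 ≤ 2.7182818286 ^ 3 := by gcongr
  rw [h3]; norm_num at *; linarith

lemma dls (c : GaussianInt) (hc : c ≠ 0) [Fintype (QR c)] [Fintype (QR c)ˣ] [DecidableEq (QR c)]
    (M : Finset GaussianInt) (β X : GaussianInt → ℂ) (hX : ∀ m ∈ M, ‖X m‖^2 ≤ 3/2) (ζ : ℂ) :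
    ∑ u : (QR c)ˣ, ‖∑ m ∈ M, ∑ n ∈ M, β m * conj (β n) *
        (psi c ((u : QR c) * Ideal.Quotient.mk _ m) * psi c (((u⁻¹ : (QR c)ˣ) : QR c) * Ideal.Quotient.mk _ n)) *
        cexp (I * ((ζ * X n * X m).re : ℝ))‖ ≤
      20 * (Nat.card (QR c)) * (2 + ‖ζ‖) * ∑ m ∈ M, ∑ m' ∈ M,
        if (Ideal.Quotient.mk (Ideal.span {c}) m) = Ideal.Quotient.mk _ m' then
          ‖β m‖ * ‖β m'‖ * Real.exp (-(‖ζ‖^2 * ‖X m - X m'‖^2 / 4)) else 0 := by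
  set b : ℝ := max 2 (‖ζ‖^2) with hbdef
  have hb2 : 2 ≤ b := le_max_left _ _
  have hbz : ‖ζ‖^2 ≤ b := le_max_right _ _
  have hb : 0 < b := by linarith
  set t : ℝ := Real.sqrt b with htdef
  have ht : 0 < t := Real.sqrt_pos.mpr hb
  have htt : t * t = b := Real.mul_self_sqrt hb.le
  have htz : t ≤ 2 + ‖ζ‖ := by
    rw [htdef]; apply Real.sqrt_le_iff.mpr
    have := norm_nonneg ζ
    refine ⟨by positivity, max_le (by nlinarith) (by nlinarith)⟩
  set v : GaussianInt → ℝ := fun n => Real.exp (‖ζ * X n‖^2 / (4 * b)) with hv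
  set q : ℝ := (Nat.card (QR c) : ℝ) with hq
  set T : ℝ := ∑ m ∈ M, ∑ m' ∈ M,
        if (Ideal.Quotient.mk (Ideal.span {c}) m) = Ideal.Quotient.mk _ m' then
          ‖β m‖ * ‖β m'‖ * Real.exp (-(‖ζ‖^2 * ‖X m - X m'‖^2 / 4)) else 0 with hT
  have hT0 : 0 ≤ T := Finset.sum_nonneg fun m _ => Finset.sum_nonneg fun m' _ => by split_ifs <;> positivity
  -- the two pieces
  let U : QR c → ℂ → ℂ := fun x ξ => ∑ m ∈ M, (β m * (Real.exp (-b * ‖ξ - X m‖^2) : ℂ)) * psi c (x * Ideal.Quotient.mk _ m)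
  let V : QR c → ℂ → ℂ := fun x ξ => ∑ n ∈ M, (conj (β n) * (v n : ℂ) * cexp (I * ((ζ * X n * ξ).re : ℝ))) * psi c (x * Ideal.Quotient.mk _ n)
  let S : (QR c)ˣ → ℂ := fun u => ∑ m ∈ M, ∑ n ∈ M, β m * conj (β n) *
        (psi c ((u : QR c) * Ideal.Quotient.mk _ m) * psi c (((u⁻¹ : (QR c)ˣ) : QR c) * Ideal.Quotient.mk _ n)) *
        cexp (I * ((ζ * X n * X m).re : ℝ))
  let f : (QR c)ˣ → ℂ → GaussianInt → GaussianInt → ℂ := fun u ξ m n =>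
    (β m * conj (β n) * (psi c ((u : QR c) * Ideal.Quotient.mk _ m) * psi c (((u⁻¹ : (QR c)ˣ) : QR c) * Ideal.Quotient.mk _ n)) * v n) *
      ((Real.exp (-b * ‖ξ - X m‖^2) : ℂ) * cexp (I * ((ζ * X n * ξ).re : ℝ)))
  have hUV : ∀ u : (QR c)ˣ, ∀ ξ, U u ξ * V (u⁻¹ : (QR c)ˣ) ξ = ∑ m ∈ M, ∑ n ∈ M, f u ξ m n := by
    intro u ξ
    simp only [U, V, Finset.sum_mul_sum]
    refine Finset.sum_congr rfl (fun m _ => Finset.sum_congr rfl (fun n _ => ?_))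
    simp only [f]; ring
  have hfint : ∀ u m n, Integrable (fun ξ => f u ξ m n) := by
    intro u m n
    refine Integrable.const_mul ?_ _
    refine ((gauss_int_shift b hb (X m)).ofReal (𝕜 := ℂ)).mul_bdd (c := 1) ?_ ?_
    · exact Continuous.aestronglyMeasurable (by fun_prop)
    · refine Filter.Eventually.of_forall fun ξ => ?_
      rw [mul_comm I, Complex.norm_exp_ofReal_mul_I]
  have hUVint : ∀ u : (QR c)ˣ, Integrable (fun ξ => U u ξ * V (u⁻¹ : (QR c)ˣ) ξ) := by
    intro u
    simp only [hUV]
    exact integrable_finsetSum _ fun m _ => integrable_finsetSum _ fun n _ => hfint u m n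
  have hS : ∀ u : (QR c)ˣ, ∫ ξ, U u ξ * V (u⁻¹ : (QR c)ˣ) ξ = ((π / b : ℝ) : ℂ) * S u := by
    intro u
    simp only [hUV]
    rw [integral_finsetSum _ fun m _ => integrable_finsetSum _ fun n _ => hfint u m n]
    simp only [S, Finset.mul_sum]
    refine Finset.sum_congr rfl (fun m _ => ?_)
    rw [integral_finsetSum _ fun n _ => hfint u m n]
    refine Finset.sum_congr rfl (fun n _ => ?_)
    simp only [f]
    rw [integral_const_mul, gft_shift b hb]
    have : (v n : ℂ) * ((π / b * Real.exp (-‖ζ * X n‖^2 / (4 * b)) : ℝ) : ℂ) = ((π / b : ℝ) : ℂ) := by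
      rw [← Complex.ofReal_mul]; congr 1
      simp only [hv]
      rw [mul_left_comm, ← Real.exp_add, neg_div, add_neg_cancel, Real.exp_zero, mul_one]
    linear_combination (β m * conj (β n) * (psi c ((u : QR c) * Ideal.Quotient.mk _ m) * psi c (((u⁻¹ : (QR c)ˣ) : QR c) * Ideal.Quotient.mk _ n)) * cexp (I * ((ζ * X n * X m).re : ℝ))) * this
  -- U part
  let G : ℂ → ℝ := fun ξ => q * ∑ m ∈ M, ∑ m' ∈ M,
        if (Ideal.Quotient.mk (Ideal.span {c}) m) = Ideal.Quotient.mk _ m' then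
          ‖β m‖ * ‖β m'‖ * (Real.exp 3 * Real.exp (-b * ‖X m - X m'‖^2 / 2) * Real.exp (-b * ‖ξ - (X m + X m')/2‖^2)) else 0
  have hGint0 : ∀ m m', Integrable (fun ξ => if (Ideal.Quotient.mk (Ideal.span {c}) m) = Ideal.Quotient.mk _ m' then
          ‖β m‖ * ‖β m'‖ * (Real.exp 3 * Real.exp (-b * ‖X m - X m'‖^2 / 2) * Real.exp (-b * ‖ξ - (X m + X m')/2‖^2)) else 0) := by
    intro m m'
    split_ifs
    · exact ((gauss_int_shift b hb _).const_mul _).const_mul _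
    · simp
  have hGint : Integrable G := by
    refine Integrable.const_mul ?_ q
    exact integrable_finsetSum _ fun m _ => integrable_finsetSum _ fun m' _ => hGint0 m m'
  have hGval : ∫ ξ, G ξ ≤ q * (Real.exp 3 * (π / b) * T) := by
    simp only [G]
    rw [integral_const_mul, integral_finsetSum _ fun m _ => integrable_finsetSum _ fun m' _ => hGint0 m m']
    refine mul_le_mul_of_nonneg_left ?_ (show 0 ≤ q by positivity)
    rw [hT, Finset.mul_sum]
    refine Finset.sum_le_sum fun m _ => ?_
    rw [integral_finsetSum _ fun m' _ => hGint0 m m', Finset.mul_sum]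
    refine Finset.sum_le_sum fun m' _ => ?_
    split_ifs with h
    · rw [integral_const_mul, integral_const_mul, gauss_val b hb]
      have : Real.exp (-b * ‖X m - X m'‖^2 / 2) ≤ Real.exp (-(‖ζ‖^2 * ‖X m - X m'‖^2 / 4)) := by
        rw [Real.exp_le_exp]
        nlinarith [sq_nonneg ‖X m - X m'‖, mul_le_mul_of_nonneg_right hbz (sq_nonneg ‖X m - X m'‖)]
      calc _ = (‖β m‖ * ‖β m'‖ * Real.exp 3 * (π / b)) * Real.exp (-b * ‖X m - X m'‖^2 / 2) := by ring
        _ ≤ (‖β m‖ * ‖β m'‖ * Real.exp 3 * (π / b)) * Real.exp (-(‖ζ‖^2 * ‖X m - X m'‖^2 / 4)) := by gcongr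
        _ = _ := by ring
    · simp
  have hUG : ∀ ξ, (∑ x : QR c, ‖U x ξ‖^2) * Real.exp (‖ξ‖^2) ≤ G ξ := by
    intro ξ
    refine (mul_le_mul_of_nonneg_right (orth_le c hc M _) (Real.exp_pos _).le).trans ?_
    simp only [G]
    rw [mul_assoc, Finset.sum_mul]
    refine mul_le_mul_of_nonneg_left (Finset.sum_le_sum fun m hm => ?_) (by positivity)
    rw [Finset.sum_mul]
    refine Finset.sum_le_sum fun m' hm' => ?_
    split_ifs with h
    · have := gauss_prod_le b hb2 (X m) (X m') ξ (hX m hm) (hX m' hm')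
      rw [norm_mul, norm_mul, Complex.norm_real, Complex.norm_real, Real.norm_of_nonneg (Real.exp_pos _).le, Real.norm_of_nonneg (Real.exp_pos _).le]
      calc _ = ‖β m‖ * ‖β m'‖ * (Real.exp (-b * ‖ξ - X m‖^2) * Real.exp (-b * ‖ξ - X m'‖^2) * Real.exp (‖ξ‖^2)) := by ring
        _ ≤ _ := by gcongr
    · simp
  -- V part
  let H : ℂ → ℝ := fun ξ => (∑ x : QR c, ‖V x ξ‖^2) * Real.exp (-1 * ‖ξ‖^2)
  let h0 : GaussianInt → GaussianInt → ℂ → ℂ := fun n n' ξ => if (Ideal.Quotient.mk (Ideal.span {c}) n) = Ideal.Quotient.mk _ n' then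
      (conj (β n) * β n' * v n * v n') * ((Real.exp (-1 * ‖ξ‖^2) : ℂ) * cexp (I * ((ζ * (X n - X n') * ξ).re : ℝ))) else 0
  have hH0 : ∀ ξ, (H ξ : ℂ) = (q:ℂ) * ∑ n ∈ M, ∑ n' ∈ M, h0 n n' ξ := by
    intro ξ
    simp only [H]
    rw [Complex.ofReal_mul, orth_sum c hc M, mul_assoc, Finset.sum_mul]
    simp only [hq, Complex.ofReal_natCast]
    congr 1
    refine Finset.sum_congr rfl (fun n _ => ?_)
    rw [Finset.sum_mul]
    refine Finset.sum_congr rfl (fun n' _ => ?_)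
    simp only [h0]
    split_ifs with h
    · rw [map_mul, map_mul, Complex.conj_conj, Complex.conj_ofReal, ← Complex.exp_conj, map_mul, Complex.conj_I, Complex.conj_ofReal]
      have : cexp (I * ((ζ * (X n - X n') * ξ).re : ℝ)) = cexp (I * ((ζ * X n * ξ).re : ℝ)) * cexp (-I * ((ζ * X n' * ξ).re : ℝ)) := by
        rw [← Complex.exp_add]
        congr 1
        rw [show ζ * (X n - X n') * ξ = ζ * X n * ξ - ζ * X n' * ξ by ring, Complex.sub_re]
        push_cast; ring
      rw [this]; ring
    · simp
  have hh0int : ∀ n n', Integrable (h0 n n') := by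
    intro n n'
    simp only [h0]
    split_ifs
    · refine Integrable.const_mul ?_ _
      refine ((gauss_int 1 one_pos).ofReal (𝕜 := ℂ)).mul_bdd (c := 1) ?_ ?_
      · exact Continuous.aestronglyMeasurable (by fun_prop)
      · refine Filter.Eventually.of_forall fun ξ => ?_
        rw [mul_comm I, Complex.norm_exp_ofReal_mul_I]
    · simp
  have hHintC : Integrable (fun ξ => (H ξ : ℂ)) := by
    simp only [hH0]
    exact (integrable_finsetSum _ fun m _ => integrable_finsetSum _ fun m' _ => hh0int m m').const_mul _
  have hHint : Integrable H := by
    have := hHintC.re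
    simpa using this
  have hv1 : ∀ n ∈ M, ‖(v n : ℂ)‖ ≤ Real.exp (1/2) := by
    intro n hn
    rw [Complex.norm_real, Real.norm_of_nonneg (Real.exp_pos _).le]
    change Real.exp _ ≤ _
    rw [Real.exp_le_exp, div_le_iff₀ (by positivity), norm_mul, mul_pow]
    have := hX n hn
    have := mul_le_mul hbz this (by positivity) hb.le
    linarith
  have hHval : ∫ ξ, H ξ ≤ q * (Real.exp 1 * π * T) := by
    have h1 : ((∫ ξ, H ξ : ℝ) : ℂ) = (q:ℂ) * ∑ n ∈ M, ∑ n' ∈ M, ∫ ξ, h0 n n' ξ := by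
      rw [← integral_complex_ofReal]
      simp only [hH0]
      rw [integral_const_mul, integral_finsetSum _ fun m _ => integrable_finsetSum _ fun m' _ => hh0int m m']
      congr 1
      refine Finset.sum_congr rfl (fun n _ => ?_)
      rw [integral_finsetSum _ fun m' _ => hh0int n m']
    have h2 : ∫ ξ, H ξ ≤ ‖((∫ ξ, H ξ : ℝ) : ℂ)‖ := by
      rw [Complex.norm_real]; exact Real.le_norm_self _
    refine h2.trans ?_
    rw [h1, norm_mul, Complex.norm_real, Real.norm_of_nonneg (by positivity)]
    refine mul_le_mul_of_nonneg_left ?_ (by positivity)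
    rw [hT, Finset.mul_sum]
    refine (norm_sum_le _ _).trans (Finset.sum_le_sum fun n hn => ?_)
    rw [Finset.mul_sum]
    refine (norm_sum_le _ _).trans (Finset.sum_le_sum fun n' hn' => ?_)
    simp only [h0]
    split_ifs with h
    · rw [integral_const_mul, gft 1 one_pos]
      simp only [norm_mul, Complex.norm_real, RCLike.norm_conj]
      have e1 := hv1 n hn
      have e2 := hv1 n' hn'
      rw [Complex.norm_real] at e1 e2
      have e3 : Real.exp 1 = Real.exp (1/2) * Real.exp (1/2) := by rw [← Real.exp_add]; norm_num
      have e4 : ‖Real.exp (-(‖ζ‖ * ‖X n - X n'‖)^2 / (4 * 1))‖ = Real.exp (-(‖ζ‖^2 * ‖X n - X n'‖^2 / 4)) := by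
        rw [Real.norm_of_nonneg (Real.exp_pos _).le]; congr 1; ring
      have e5 : ‖π / 1‖ = π := by rw [div_one, Real.norm_of_nonneg Real.pi_pos.le]
      rw [e3, e4, e5]
      calc _ ≤ ‖β n‖ * ‖β n'‖ * Real.exp (1/2) * Real.exp (1/2) * (π * Real.exp (-(‖ζ‖^2 * ‖X n - X n'‖^2 / 4))) := by gcongr
        _ = _ := by ring
    · simp
  -- combine
  have hpt : ∀ ξ, ∑ u : (QR c)ˣ, ‖U u ξ * V (u⁻¹ : (QR c)ˣ) ξ‖ ≤ t/2 * G ξ + 1/(2*t) * H ξ := by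
    intro ξ
    have a1 : ∀ W : QR c → ℂ, ∑ u : (QR c)ˣ, ‖W u‖^2 ≤ ∑ x, ‖W x‖^2 := by
      intro W
      rw [← Finset.sum_image (s := (Finset.univ : Finset (QR c)ˣ)) (g := fun u => (u : QR c)) (f := fun x => ‖W x‖^2) (fun u _ w _ h => Units.ext h)]
      exact Finset.sum_le_sum_of_subset_of_nonneg (Finset.subset_univ _) (fun _ _ _ => by positivity)
    have a2 : ∑ u : (QR c)ˣ, ‖V (u⁻¹ : (QR c)ˣ) ξ‖^2 = ∑ u : (QR c)ˣ, ‖V (u : (QR c)ˣ) ξ‖^2 :=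
      Fintype.sum_equiv (Equiv.inv _) _ _ (fun u => rfl)
    have a3 := a1 (fun x => U x ξ)
    have a4 := a1 (fun x => V x ξ)
    rw [← a2] at a4
    set E := Real.exp (‖ξ‖^2) with hE
    have hE0 : 0 < E := Real.exp_pos _
    have hEi : Real.exp (-1 * ‖ξ‖^2) = E⁻¹ := by rw [hE, ← Real.exp_neg]; congr 1; ring
    have a5 : ∀ u : (QR c)ˣ, ‖U u ξ * V (u⁻¹ : (QR c)ˣ) ξ‖ ≤ t/2 * (‖U u ξ‖^2 * E) + 1/(2*t) * (‖V (u⁻¹ : (QR c)ˣ) ξ‖^2 * E⁻¹) := by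
      intro u
      rw [norm_mul]
      have key : ∀ p r : ℝ, p * r ≤ t/2 * (p^2 * E) + 1/(2*t) * (r^2 * E⁻¹) := by
        intro p r
        have : t/2 * (p^2 * E) + 1/(2*t) * (r^2 * E⁻¹) - p * r = (t*E*p - r)^2 / (2 * t * E) := by
          field_simp; ring
        have h2 : 0 ≤ (t*E*p - r)^2 / (2 * t * E) := by positivity
        linarith
      exact key _ _
    refine (Finset.sum_le_sum fun u _ => a5 u).trans ?_
    rw [Finset.sum_add_distrib, ← Finset.mul_sum, ← Finset.mul_sum, ← Finset.sum_mul, ← Finset.sum_mul]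
    refine add_le_add (mul_le_mul_of_nonneg_left ?_ (by positivity)) (mul_le_mul_of_nonneg_left ?_ (by positivity))
    · exact (mul_le_mul_of_nonneg_right a3 hE0.le).trans (hUG ξ)
    · simp only [H]; rw [hEi]
      exact (mul_le_mul_of_nonneg_right a4 (inv_pos.mpr hE0).le)
  have hfin : ∑ u : (QR c)ˣ, ((π / b) * ‖S u‖) ≤ t/2 * (q * (Real.exp 3 * (π / b) * T)) + 1/(2*t) * (q * (Real.exp 1 * π * T)) := by
    calc ∑ u : (QR c)ˣ, ((π / b) * ‖S u‖) = ∑ u : (QR c)ˣ, ‖∫ ξ, U u ξ * V (u⁻¹ : (QR c)ˣ) ξ‖ := by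
          refine Finset.sum_congr rfl fun u _ => ?_
          rw [hS, norm_mul, Complex.norm_real, Real.norm_of_nonneg (by positivity)]
      _ ≤ ∑ u : (QR c)ˣ, ∫ ξ, ‖U u ξ * V (u⁻¹ : (QR c)ˣ) ξ‖ := Finset.sum_le_sum fun u _ => norm_integral_le_integral_norm _
      _ = ∫ ξ, ∑ u : (QR c)ˣ, ‖U u ξ * V (u⁻¹ : (QR c)ˣ) ξ‖ := (integral_finsetSum _ fun u _ => (hUVint u).norm).symm
      _ ≤ ∫ ξ, (t/2 * G ξ + 1/(2*t) * H ξ) := by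
          refine integral_mono (integrable_finsetSum _ fun u _ => (hUVint u).norm) ((hGint.const_mul _).add (hHint.const_mul _)) hpt
      _ = t/2 * (∫ ξ, G ξ) + 1/(2*t) * (∫ ξ, H ξ) := by
          rw [integral_add (hGint.const_mul _) (hHint.const_mul _)]
          exact congrArg₂ (· + ·) (integral_const_mul _ _) (integral_const_mul _ _)
      _ ≤ _ := add_le_add (mul_le_mul_of_nonneg_left hGval (by positivity)) (mul_le_mul_of_nonneg_left hHval (by positivity))
  rw [← Finset.mul_sum] at hfin
  have hS' : ∑ u : (QR c)ˣ, ‖S u‖ ≤ (Real.exp 3 + Real.exp 1)/2 * q * t * T := by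
    have : (π / b) * ∑ u : (QR c)ˣ, ‖S u‖ ≤ (π / b) * ((Real.exp 3 + Real.exp 1)/2 * q * t * T) := by
      refine hfin.trans (le_of_eq ?_)
      rw [← htt]; field_simp
    exact le_of_mul_le_mul_left this (by positivity)
  refine hS'.trans ?_
  have := exp_consts
  gcongr

/-- finite version of the quadratic form -/
noncomputable def BF (M : Finset GaussianInt) (β : GaussianInt → ℂ) (θ : ℂ) (c : GaussianInt) : ℂ :=
  ∑ m ∈ M, ∑ n ∈ M, β m * conj (β n) * kloosterman m n c *
    ((Real.cos (2 * (2 * Real.pi * ((m : ℂ) * (n : ℂ)) ^ ((1:ℂ)/2) / (c : ℂ) * θ).re) : ℝ) : ℂ)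

lemma half_sq (z : ℂ) : (z ^ ((1:ℂ)/2))^2 = z := by
  rw [← Complex.cpow_nat_mul]; norm_num

lemma cos_sqrt (m n c θ : ℂ) (N : ℝ) (hN : 0 < N) :
    Real.cos (2 * (2 * Real.pi * (m * n) ^ ((1:ℂ)/2) / c * θ).re) =
      Real.cos (((4 * π * N * θ / c) * (n ^ ((1:ℂ)/2) / (Real.sqrt N : ℂ)) * (m ^ ((1:ℂ)/2) / (Real.sqrt N : ℂ))).re) := by
  have hs : (Real.sqrt N : ℂ) * (Real.sqrt N : ℂ) = N := by
    rw [← Complex.ofReal_mul, Real.mul_self_sqrt hN.le]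
  have hs0 : (Real.sqrt N : ℂ) ≠ 0 := by
    have := (Real.sqrt_pos.mpr hN).ne'
    exact_mod_cast this
  have h1 : (4 * π * N * θ / c) * (n ^ ((1:ℂ)/2) / (Real.sqrt N : ℂ)) * (m ^ ((1:ℂ)/2) / (Real.sqrt N : ℂ)) =
    ((2:ℝ):ℂ) * (2 * π * (m ^ ((1:ℂ)/2) * n ^ ((1:ℂ)/2)) / c * θ) := by
    rw [← hs]; push_cast; field_simp; ring
  rw [h1, Complex.re_ofReal_mul]
  have h2 : ((m * n) ^ ((1:ℂ)/2))^2 = (m ^ ((1:ℂ)/2) * n ^ ((1:ℂ)/2))^2 := by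
    rw [mul_pow, half_sq, half_sq, half_sq]
  rcases sq_eq_sq_iff_eq_or_eq_neg.mp h2 with h | h
  · rw [h]
  · rw [h]
    rw [show 2 * (π:ℂ) * -(m ^ ((1:ℂ)/2) * n ^ ((1:ℂ)/2)) / c * θ = -(2 * π * (m ^ ((1:ℂ)/2) * n ^ ((1:ℂ)/2)) / c * θ) by ring,
      Complex.neg_re, mul_neg, Real.cos_neg]

lemma row_sum (M : Finset GaussianInt) (N : ℝ) (hN : 0 < N) (hM : ∀ m ∈ M, ‖(m:ℂ)‖ ≤ Real.sqrt 2 * N)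
    (c : GaussianInt) (hc : c ≠ 0) [DecidableEq (QR c)] (θ : ℝ) (hθ : 0 ≤ θ) (m : GaussianInt) (hm : m ∈ M) :
    (∑ m' ∈ M, (if (Ideal.Quotient.mk (Ideal.span {c}) m) = Ideal.Quotient.mk _ m' then
      Real.exp (-(6 * θ^2 * (‖((m - m' : GaussianInt):ℂ)‖/‖(c:ℂ)‖)^2)) else 0) ≤ (1 + 6 * N / ‖(c:ℂ)‖)^2) ∧
    (0 < θ → ∑ m' ∈ M, (if (Ideal.Quotient.mk (Ideal.span {c}) m) = Ideal.Quotient.mk _ m' then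
      Real.exp (-(6 * θ^2 * (‖((m - m' : GaussianInt):ℂ)‖/‖(c:ℂ)‖)^2)) else 0) ≤ 2 * (1 + 1 / θ)^2) := by
  classical
  have hc1 := gi_one_le hc
  have hc0 : 0 < ‖(c:ℂ)‖ := by linarith
  set M' := M.filter (fun m' => (Ideal.Quotient.mk (Ideal.span {c}) m) = Ideal.Quotient.mk _ m') with hM'
  let h : GaussianInt → GaussianInt := fun m' => (m - m') / c
  have hh : ∀ m' ∈ M', m - m' = c * h m' := by
    intro m' hm'
    have := (Finset.mem_filter.mp hm').2
    rw [Ideal.Quotient.eq, Ideal.mem_span_singleton] at this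
    obtain ⟨k, hk⟩ := this
    simp only [h]
    rw [hk, mul_div_cancel_left₀ k hc]
  have hinj : Set.InjOn h M' := by
    intro a ha b hb hab
    have h1 := hh a ha
    have h2 := hh b hb
    rw [hab, ← h2] at h1
    simpa using h1
  have hval : ∀ m' ∈ M', ‖((m - m' : GaussianInt):ℂ)‖/‖(c:ℂ)‖ = ‖(h m' : ℂ)‖ := by
    intro m' hm'
    rw [hh m' hm', map_mul, norm_mul]; field_simp
  have heq : ∑ m' ∈ M, (if (Ideal.Quotient.mk (Ideal.span {c}) m) = Ideal.Quotient.mk _ m' then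
      Real.exp (-(6 * θ^2 * (‖((m - m' : GaussianInt):ℂ)‖/‖(c:ℂ)‖)^2)) else 0) =
      ∑ k ∈ M'.image h, Real.exp (-(6 * θ^2 * ‖(k:ℂ)‖^2)) := by
    rw [Finset.sum_image hinj, ← Finset.sum_filter]
    refine Finset.sum_congr rfl fun m' hm' => ?_
    rw [hval m' hm']
  rw [heq]
  constructor
  · have hcard := gi_card_le (3 * N / ‖(c:ℂ)‖) (by positivity) (M'.image h) (by
      intro k hk
      obtain ⟨m', hm', rfl⟩ := Finset.mem_image.mp hk
      rw [← hval m' hm', map_sub]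
      have h1 := hM m hm
      have h2 := hM m' (Finset.mem_filter.mp hm').1
      gcongr
      refine (norm_sub_le _ _).trans ?_
      have : Real.sqrt 2 ≤ 3/2 := by rw [Real.sqrt_le_left (by norm_num)]; norm_num
      nlinarith)
    calc _ ≤ ∑ k ∈ M'.image h, (1:ℝ) := by
          refine Finset.sum_le_sum fun k _ => ?_
          rw [Real.exp_le_one_iff]
          have : 0 ≤ 6 * θ^2 * ‖(k:ℂ)‖^2 := by positivity
          linarith
      _ = ((M'.image h).card : ℝ) := by simp
      _ ≤ _ := hcard
      _ = _ := by ring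
  · intro hθ0
    refine (gi_exp_sum (6 * θ^2) (by positivity) _).trans ?_
    have h1 : Real.exp (1/2) ≤ 2 := by
      have := Real.exp_one_lt_d9
      have h2 : Real.exp (1/2) * Real.exp (1/2) = Real.exp 1 := by rw [← Real.exp_add]; norm_num
      nlinarith [Real.exp_pos (1/2)]
    have h2 : 2 * θ ≤ Real.sqrt (6 * θ^2) := by
      apply Real.le_sqrt_of_sq_le; nlinarith
    have h3 : 2 / Real.sqrt (6 * θ^2) ≤ 1 / θ := by
      rw [div_le_div_iff₀ (by positivity) hθ0]; linarith
    gcongr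

lemma schur (M : Finset GaussianInt) (β : GaussianInt → ℂ) (w : GaussianInt → GaussianInt → ℝ)
    (hw : ∀ m n, 0 ≤ w m n) (hs : ∀ m n, w m n = w n m) (R : ℝ) (hR : ∀ m ∈ M, ∑ n ∈ M, w m n ≤ R) :
    ∑ m ∈ M, ∑ n ∈ M, ‖β m‖ * ‖β n‖ * w m n ≤ R * ∑ m ∈ M, ‖β m‖^2 := by
  have h1 : ∑ m ∈ M, ∑ n ∈ M, ‖β m‖ * ‖β n‖ * w m n ≤
      ∑ m ∈ M, ∑ n ∈ M, (‖β m‖^2 * w m n / 2 + ‖β n‖^2 * w m n / 2) := by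
    refine Finset.sum_le_sum fun m _ => Finset.sum_le_sum fun n _ => ?_
    nlinarith [mul_nonneg (hw m n) (sq_nonneg (‖β m‖ - ‖β n‖))]
  have h2 : ∑ m ∈ M, ∑ n ∈ M, ‖β n‖^2 * w m n / 2 = ∑ m ∈ M, ∑ n ∈ M, ‖β m‖^2 * w m n / 2 := by
    rw [Finset.sum_comm]
    refine Finset.sum_congr rfl fun m _ => Finset.sum_congr rfl fun n _ => ?_
    rw [hs]
  refine h1.trans ?_
  simp only [Finset.sum_add_distrib]
  rw [h2, ← Finset.sum_add_distrib, Finset.mul_sum]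
  refine Finset.sum_le_sum fun m hm => ?_
  rw [← Finset.sum_add_distrib]
  calc _ = ‖β m‖^2 * ∑ n ∈ M, w m n := by
        rw [Finset.mul_sum]; refine Finset.sum_congr rfl fun n _ => by ring
    _ ≤ ‖β m‖^2 * R := by gcongr; exact hR m hm
    _ = _ := mul_comm _ _

lemma BF_core (M : Finset GaussianInt) (N : ℝ) (hN : 0 < N) (hM : ∀ m ∈ M, ‖(m:ℂ)‖ ≤ Real.sqrt 2 * N)
    (c : GaussianInt) (hc : c ≠ 0) [DecidableEq (QR c)] (β : GaussianInt → ℂ) (θ : ℂ) (R : ℝ)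
    (hR : ∀ m ∈ M, ∑ m' ∈ M, (if (Ideal.Quotient.mk (Ideal.span {c}) m) = Ideal.Quotient.mk _ m' then
      Real.exp (-(6 * ‖θ‖^2 * (‖((m - m' : GaussianInt):ℂ)‖/‖(c:ℂ)‖)^2)) else 0) ≤ R) :
    ‖BF M β θ c‖ ≤ 180 * ‖(c:ℂ)‖^2 * (2 + 13 * N * ‖θ‖ / ‖(c:ℂ)‖) * (R * ∑ m ∈ M, ‖β m‖^2) := by
  have := qr_finite c hc
  have := Fintype.ofFinite (QR c)
  have := Fintype.ofFinite (QR c)ˣ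
  have hc0 : 0 < ‖(c:ℂ)‖ := by linarith [gi_one_le hc]
  set ζ : ℂ := 4 * π * N * θ / c with hζ
  have hs2 : Real.sqrt 2 ≤ 3/2 := by rw [Real.sqrt_le_left (by norm_num)]; norm_num
  set X : GaussianInt → ℂ := fun m => (m:ℂ) ^ ((1:ℂ)/2) / (Real.sqrt N : ℂ) with hXdef
  have hX2 : ∀ m, (N:ℂ) * (X m)^2 = m := by
    intro m
    simp only [hXdef]
    rw [div_pow, half_sq, ← Complex.ofReal_pow, Real.sq_sqrt hN.le]
    have : (N:ℂ) ≠ 0 := by exact_mod_cast hN.ne'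
    field_simp
  have hX : ∀ m ∈ M, ‖X m‖^2 ≤ 3/2 := by
    intro m hm
    have h1 := congrArg norm (hX2 m)
    rw [norm_mul, Complex.norm_real, Real.norm_of_nonneg hN.le, norm_pow] at h1
    have h2 := hM m hm
    rw [← h1] at h2
    have : N * ‖X m‖^2 ≤ N * (3/2) := by nlinarith
    exact le_of_mul_le_mul_left this hN
  have hζn : ‖ζ‖ = 4 * π * N * ‖θ‖ / ‖(c:ℂ)‖ := by
    rw [hζ]; simp [abs_of_pos Real.pi_pos, abs_of_pos hN]
  set T : ℂ → ℝ := fun ζ => ∑ m ∈ M, ∑ m' ∈ M,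
        if (Ideal.Quotient.mk (Ideal.span {c}) m) = Ideal.Quotient.mk _ m' then
          ‖β m‖ * ‖β m'‖ * Real.exp (-(‖ζ‖^2 * ‖X m - X m'‖^2 / 4)) else 0 with hT
  have hTneg : T (-ζ) = T ζ := by simp only [hT, norm_neg]
  have d1 := dls c hc M β X hX ζ
  have d2 := dls c hc M β X hX (-ζ)
  rw [norm_neg] at d2
  set S : ℂ → (QR c)ˣ → ℂ := fun ζ u => ∑ m ∈ M, ∑ n ∈ M, β m * conj (β n) *
        (psi c ((u : QR c) * Ideal.Quotient.mk _ m) * psi c (((u⁻¹ : (QR c)ˣ) : QR c) * Ideal.Quotient.mk _ n)) *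
        cexp (I * ((ζ * X n * X m).re : ℝ)) with hS
  have hBF : BF M β θ c = ∑ u : (QR c)ˣ, (S ζ u + S (-ζ) u) / 2 := by
    simp only [hS, ← Finset.sum_add_distrib, Finset.sum_div, BF]
    symm
    rw [Finset.sum_comm]
    refine Finset.sum_congr rfl fun m _ => ?_
    rw [Finset.sum_comm]
    refine Finset.sum_congr rfl fun n _ => ?_
    symm
    rw [kloosterman_eq, cos_sqrt m n c θ N hN]
    rw [Finset.mul_sum, Finset.sum_mul]
    refine Finset.sum_congr rfl fun u _ => ?_
    change _ * ((Real.cos ((ζ * X n * X m).re) : ℝ) : ℂ) = _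
    rw [Complex.ofReal_cos, Complex.cos]
    rw [show -ζ * X n * X m = -(ζ * X n * X m) by ring, Complex.neg_re, Complex.ofReal_neg]
    rw [mul_comm (((ζ * X n * X m).re : ℝ) : ℂ) I, show -(((ζ * X n * X m).re : ℝ) : ℂ) * I = I * -(((ζ * X n * X m).re : ℝ) : ℂ) by ring]
    ring
  have hB1 : ‖BF M β θ c‖ ≤ 20 * (Nat.card (QR c)) * (2 + ‖ζ‖) * T ζ := by
    rw [hBF]
    refine (norm_sum_le _ _).trans ?_
    have h1 : ∀ u ∈ (Finset.univ : Finset (QR c)ˣ), ‖(S ζ u + S (-ζ) u) / 2‖ ≤ (‖S ζ u‖ + ‖S (-ζ) u‖)/2 := by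
      intro u _
      rw [norm_div, Complex.norm_ofNat]
      gcongr; exact norm_add_le _ _
    refine (Finset.sum_le_sum h1).trans ?_
    rw [← Finset.sum_div, Finset.sum_add_distrib]
    have e1 : ∑ u : (QR c)ˣ, ‖S ζ u‖ ≤ 20 * (Nat.card (QR c)) * (2 + ‖ζ‖) * T ζ := d1
    have e2 : ∑ u : (QR c)ˣ, ‖S (-ζ) u‖ ≤ 20 * (Nat.card (QR c)) * (2 + ‖ζ‖) * T (-ζ) := by
      simp only [hT, norm_neg]; exact d2
    rw [hTneg] at e2
    linarith
  -- Schur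
  have hTle : T ζ ≤ R * ∑ m ∈ M, ‖β m‖^2 := by
    refine le_trans ?_ (schur M β (fun m m' => if (Ideal.Quotient.mk (Ideal.span {c}) m) = Ideal.Quotient.mk _ m' then
      Real.exp (-(6 * ‖θ‖^2 * (‖((m - m' : GaussianInt):ℂ)‖/‖(c:ℂ)‖)^2)) else 0) ?_ ?_ R hR)
    · simp only [hT]
      refine Finset.sum_le_sum fun m hm => Finset.sum_le_sum fun m' hm' => ?_
      split_ifs
      · refine mul_le_mul_of_nonneg_left ?_ (by positivity)
        rw [Real.exp_le_exp, neg_le_neg_iff]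
        have k1 : ((m - m' : GaussianInt):ℂ) = N * ((X m - X m') * (X m + X m')) := by
          rw [map_sub, ← hX2 m, ← hX2 m']; ring
        have k2 : ‖X m + X m'‖^2 ≤ 6 := by
          have a1 := hX m hm
          have a2 := hX m' hm'
          have a3 := norm_add_le (X m) (X m')
          have a4 := norm_nonneg (X m + X m')
          nlinarith [sq_nonneg (‖X m‖ - ‖X m'‖)]
        rw [hζn, k1, norm_mul, norm_mul, Complex.norm_real, Real.norm_of_nonneg hN.le]
        have hpi : (9:ℝ) ≤ π^2 := by nlinarith [Real.pi_gt_three]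
        have : 6 * ‖θ‖^2 * (N * (‖X m - X m'‖ * ‖X m + X m'‖) / ‖(c:ℂ)‖)^2 =
          (6 * ‖θ‖^2 * N^2 * ‖X m - X m'‖^2 / ‖(c:ℂ)‖^2) * ‖X m + X m'‖^2 := by
          field_simp
        rw [this]
        calc _ ≤ (6 * ‖θ‖^2 * N^2 * ‖X m - X m'‖^2 / ‖(c:ℂ)‖^2) * 6 := by gcongr
          _ = 36 * (‖θ‖^2 * N^2 * ‖X m - X m'‖^2 / ‖(c:ℂ)‖^2) := by ring
          _ ≤ (4 * π^2) * (‖θ‖^2 * N^2 * ‖X m - X m'‖^2 / ‖(c:ℂ)‖^2) := by gcongr; linarith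
          _ = _ := by field_simp
      · simp
    · intro m n; split_ifs <;> positivity
    · intro m n
      simp only [eq_comm (a := Ideal.Quotient.mk (Ideal.span {c}) m)]
      rw [show ((m - n : GaussianInt):ℂ) = -((n - m : GaussianInt):ℂ) by rw [map_sub, map_sub]; ring, norm_neg]
  have hq := qr_card c hc
  have hT0 : 0 ≤ T ζ := Finset.sum_nonneg fun m _ => Finset.sum_nonneg fun m' _ => by split_ifs <;> positivity
  have hz13 : ‖ζ‖ ≤ 13 * N * ‖θ‖ / ‖(c:ℂ)‖ := by
    rw [hζn]; gcongr; linarith [Real.pi_lt_d2]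
  calc ‖BF M β θ c‖ ≤ 20 * (Nat.card (QR c)) * (2 + ‖ζ‖) * T ζ := hB1
    _ ≤ 20 * (9 * ‖(c:ℂ)‖^2) * (2 + 13 * N * ‖θ‖ / ‖(c:ℂ)‖) * (R * ∑ m ∈ M, ‖β m‖^2) := by gcongr
    _ = _ := by ring

lemma BF_good (M : Finset GaussianInt) (N : ℝ) (hN : 0 < N) (hM : ∀ m ∈ M, ‖(m:ℂ)‖ ≤ Real.sqrt 2 * N)
    (c : GaussianInt) (hc : c ≠ 0) (β : GaussianInt → ℂ) (θ : ℂ) (hθ : 1/4 ≤ ‖θ‖) :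
    ‖BF M β θ c‖ ≤ 120000 * (‖(c:ℂ)‖^2 + ‖(c:ℂ)‖ * N * ‖θ‖) * ∑ m ∈ M, ‖β m‖^2 := by
  classical
  have hc0 : 0 < ‖(c:ℂ)‖ := by linarith [gi_one_le hc]
  have h := BF_core M N hN hM c hc β θ 50 (fun m hm => by
    refine ((row_sum M N hN hM c hc ‖θ‖ (norm_nonneg _) m hm).2 (by linarith)).trans ?_
    have : 1 / ‖θ‖ ≤ 4 := by rw [div_le_iff₀ (by linarith)]; linarith
    have h0 : 0 ≤ 1 / ‖θ‖ := by positivity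
    nlinarith)
  refine h.trans ?_
  have hB : 0 ≤ ∑ m ∈ M, ‖β m‖^2 := by positivity
  set B := ∑ m ∈ M, ‖β m‖^2
  have : 180 * ‖(c:ℂ)‖^2 * (2 + 13 * N * ‖θ‖ / ‖(c:ℂ)‖) * (50 * B) = (18000 * ‖(c:ℂ)‖^2 + 117000 * (‖(c:ℂ)‖ * N * ‖θ‖)) * B := by
    field_simp; ring
  rw [this]
  gcongr
  have : 0 ≤ ‖(c:ℂ)‖ * N * ‖θ‖ := by positivity
  nlinarith [sq_nonneg ‖(c:ℂ)‖]

lemma BF_all (M : Finset GaussianInt) (N : ℝ) (hN : 0 < N) (hM : ∀ m ∈ M, ‖(m:ℂ)‖ ≤ Real.sqrt 2 * N)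
    (c : GaussianInt) (hc : c ≠ 0) (β : GaussianInt → ℂ) (θ : ℂ) :
    ‖BF M β θ c‖ ≤ 60000 * (1 + ‖θ‖) * (‖(c:ℂ)‖ + N)^2 * ∑ m ∈ M, ‖β m‖^2 := by
  classical
  have hc0 : 0 < ‖(c:ℂ)‖ := by linarith [gi_one_le hc]
  have hB : 0 ≤ ∑ m ∈ M, ‖β m‖^2 := by positivity
  set A := (1 + 6 * N / ‖(c:ℂ)‖) with hA
  have hA0 : 0 < A := by positivity
  have hcA : ‖(c:ℂ)‖ * A = ‖(c:ℂ)‖ + 6 * N := by rw [hA]; field_simp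
  set B := ∑ m ∈ M, ‖β m‖^2
  rcases (norm_nonneg θ).eq_or_lt' with h0 | h0
  · have h := BF_core M N hN hM c hc β θ (A^2) (fun m hm => (row_sum M N hN hM c hc ‖θ‖ (norm_nonneg _) m hm).1)
    refine h.trans ?_
    rw [h0]
    have : 180 * ‖(c:ℂ)‖^2 * (2 + 13 * N * 0 / ‖(c:ℂ)‖) * (A^2 * B) = 360 * (‖(c:ℂ)‖ * A)^2 * B := by ring
    rw [this, hcA]
    refine mul_le_mul_of_nonneg_right ?_ hB
    nlinarith [mul_pos hc0 hN, sq_nonneg ‖(c:ℂ)‖, sq_nonneg N]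
  · set D := 1 + 1 / ‖θ‖ with hD
    have hD0 : 0 < D := by positivity
    have hDθ : ‖θ‖ * D = 1 + ‖θ‖ := by rw [hD]; field_simp; ring
    set R := min (A^2) (2 * (A * D)) with hRdef
    have h := BF_core M N hN hM c hc β θ R (fun m hm => by
      have r1 := (row_sum M N hN hM c hc ‖θ‖ (norm_nonneg _) m hm).1
      have r2 := (row_sum M N hN hM c hc ‖θ‖ (norm_nonneg _) m hm).2 h0
      refine le_min r1 ?_
      rcases le_total A D with hAD | hAD
      · refine r1.trans ?_
        change A^2 ≤ _
        nlinarith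
      · refine r2.trans ?_
        change 2 * D^2 ≤ _
        nlinarith)
    refine h.trans ?_
    have hR1 : R ≤ A^2 := min_le_left _ _
    have hR2 : R ≤ 2 * (A * D) := min_le_right _ _
    have e : 180 * ‖(c:ℂ)‖^2 * (2 + 13 * N * ‖θ‖ / ‖(c:ℂ)‖) * (R * B) = (360 * ‖(c:ℂ)‖^2 * R + 2340 * ‖(c:ℂ)‖ * N * ‖θ‖ * R) * B := by
      field_simp; ring
    rw [e]
    refine mul_le_mul_of_nonneg_right ?_ hB
    calc 360 * ‖(c:ℂ)‖^2 * R + 2340 * ‖(c:ℂ)‖ * N * ‖θ‖ * R ≤ 360 * ‖(c:ℂ)‖^2 * A^2 + 2340 * ‖(c:ℂ)‖ * N * ‖θ‖ * (2 * (A * D)) := by gcongr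
      _ = 360 * (‖(c:ℂ)‖ * A)^2 + 4680 * N * (‖(c:ℂ)‖ * A) * (‖θ‖ * D) := by ring
      _ = 360 * (‖(c:ℂ)‖ + 6 * N)^2 + 4680 * N * (‖(c:ℂ)‖ + 6 * N) * (1 + ‖θ‖) := by rw [hcA, hDθ]
      _ ≤ 360 * (6 * (‖(c:ℂ)‖ + N))^2 * (1 + ‖θ‖) + 4680 * (‖(c:ℂ)‖ + N) * (6 * (‖(c:ℂ)‖ + N)) * (1 + ‖θ‖) := by
          have a1 : 360 * (‖(c:ℂ)‖ + 6 * N)^2 ≤ 360 * (6 * (‖(c:ℂ)‖ + N))^2 * (1 + ‖θ‖) := by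
            calc _ ≤ 360 * (6 * (‖(c:ℂ)‖ + N))^2 * 1 := by rw [mul_one]; gcongr; linarith
              _ ≤ _ := by gcongr; linarith
          have a2 : 4680 * N * (‖(c:ℂ)‖ + 6 * N) * (1 + ‖θ‖) ≤ 4680 * (‖(c:ℂ)‖ + N) * (6 * (‖(c:ℂ)‖ + N)) * (1 + ‖θ‖) := by
            gcongr <;> linarith
          linarith
      _ = 41040 * ((1 + ‖θ‖) * (‖(c:ℂ)‖ + N)^2) := by ring
      _ ≤ 60000 * ((1 + ‖θ‖) * (‖(c:ℂ)‖ + N)^2) := by gcongr; norm_num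
      _ = _ := by ring

/-- Gaussian decay -/
def Gd (g : ℝ → ℝ) : Prop := Continuous g ∧ ∃ C a : ℝ, 0 < a ∧ ∀ x, |g x| ≤ C * Real.exp (-a * x^2)

lemma Gd.integrable {g : ℝ → ℝ} (h : Gd g) : Integrable g := by
  obtain ⟨hc, C, a, ha, hb⟩ := h
  exact ((integrable_exp_neg_mul_sq ha).const_mul C).mono' hc.aestronglyMeasurable
    (Filter.Eventually.of_forall fun x => by simpa using hb x)

lemma Gd.mul_bdd {g f : ℝ → ℝ} (h : Gd g) (hf : Continuous f) (hf1 : ∀ x, |f x| ≤ 1) : Gd (fun x => f x * g x) := by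
  obtain ⟨hc, C, a, ha, hb⟩ := h
  refine ⟨hf.mul hc, C, a, ha, fun x => ?_⟩
  rw [abs_mul]
  calc |f x| * |g x| ≤ 1 * |g x| := by gcongr; exact hf1 x
    _ ≤ _ := by rw [one_mul]; exact hb x

/-- exponential growth -/
def Gr (f : ℝ → ℝ) : Prop := Continuous f ∧ ∃ C : ℝ, ∀ x, |f x| ≤ C * Real.exp (2 * |x|)

lemma Gd.mul_gr {g f : ℝ → ℝ} (h : Gd g) (hf : Gr f) : Gd (fun x => f x * g x) := by
  obtain ⟨hc, C, a, ha, hb⟩ := h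
  obtain ⟨hfc, D, hD⟩ := hf
  refine ⟨hfc.mul hc, D * C * Real.exp (2/a), a/2, by positivity, fun x => ?_⟩
  rw [abs_mul]
  calc |f x| * |g x| ≤ (D * Real.exp (2 * |x|)) * (C * Real.exp (-a * x^2)) :=
        mul_le_mul (hD x) (hb x) (abs_nonneg _) ((abs_nonneg _).trans (hD x))
    _ = D * C * Real.exp (2 * |x| + -a * x^2) := by rw [Real.exp_add]; ring
    _ ≤ D * C * Real.exp (2/a + -(a/2) * x^2) := by
        have hD0 : 0 ≤ D := by
          have := (abs_nonneg _).trans (hD 0); simpa using this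
        have hC0 : 0 ≤ C := by
          have := (abs_nonneg _).trans (hb 0); simpa using this
        refine mul_le_mul_of_nonneg_left (Real.exp_le_exp.mpr ?_) (by positivity)
        have : 2/a + -(a/2) * x^2 - (2 * |x| + -a * x^2) = (a * |x| - 2)^2 / (2 * a) := by
          rw [← sq_abs x]; field_simp; ring
        have : 0 ≤ (a * |x| - 2)^2 / (2 * a) := by positivity
        linarith
    _ = _ := by rw [Real.exp_add]; ring

/-- first derivative of kfun -/
noncomputable def kd1 (K r : ℝ) : ℝ := -(2 * K^2 * r) * kfun K r
/-- second derivative of kfun -/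
noncomputable def kd2 (K r : ℝ) : ℝ := (4 * K^4 * r^2 - 2 * K^2) * kfun K r

lemma kfun_deriv (K r : ℝ) : HasDerivAt (kfun K) (kd1 K r) r := by
  have h : HasDerivAt (fun r : ℝ => -(K^2 * r^2)) (-(K^2 * (2 * r))) r :=
    (((hasDerivAt_id r).fun_pow 2).const_mul (K^2)).fun_neg.congr_deriv (by simp)
  have h2 := h.exp.const_mul (Real.sqrt π * K)
  exact h2.congr_deriv (by simp only [kd1, kfun]; ring)

lemma kd1_deriv (K r : ℝ) : HasDerivAt (kd1 K) (kd2 K r) r := by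
  have h : HasDerivAt (fun r : ℝ => -(2 * K^2 * r)) (-(2 * K^2)) r :=
    ((hasDerivAt_id r).const_mul (2 * K^2)).fun_neg.congr_deriv (by simp)
  have h2 := h.fun_mul (kfun_deriv K r)
  exact h2.congr_deriv (by simp only [kd2, kd1]; ring)

lemma kfun_nonneg {K : ℝ} (hK : 0 < K) (r : ℝ) : 0 ≤ kfun K r := by unfold kfun; positivity

lemma kfun_gd {K : ℝ} (hK : 0 < K) : Gd (kfun K) := by
  refine ⟨by unfold kfun; fun_prop, Real.sqrt π * K, K^2, by positivity, fun x => ?_⟩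
  rw [abs_of_nonneg (kfun_nonneg hK x)]
  simp [kfun]

lemma kd1_gd {K : ℝ} (hK : 0 < K) : Gd (kd1 K) := by
  have : kd1 K = fun x => (-(2 * K^2 * x)) * kfun K x := rfl
  rw [this]
  refine (kfun_gd hK).mul_gr ⟨by fun_prop, 2 * K^2, fun x => ?_⟩
  rw [abs_neg, abs_mul, abs_of_nonneg (by positivity : (0:ℝ) ≤ 2 * K^2)]
  gcongr
  have := Real.add_one_le_exp (2 * |x|)
  linarith [abs_nonneg x]

lemma kd2_gd {K : ℝ} (hK : 0 < K) : Gd (kd2 K) := by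
  have : kd2 K = fun x => (4 * K^4 * x^2 - 2 * K^2) * kfun K x := rfl
  rw [this]
  refine (kfun_gd hK).mul_gr ⟨by fun_prop, 4 * K^4 + 2 * K^2, fun x => ?_⟩
  have h1 : |4 * K^4 * x^2 - 2 * K^2| ≤ 4 * K^4 * x^2 + 2 * K^2 := by
    rw [abs_le]; constructor <;> nlinarith [sq_nonneg x, sq_nonneg K, mul_nonneg (sq_nonneg (K^2)) (sq_nonneg x)]
  have h2 : x^2 ≤ Real.exp (2 * |x|) := by
    have := Real.add_one_le_exp |x|
    have h3 : Real.exp (2 * |x|) = Real.exp |x| ^ 2 := by rw [← Real.exp_nat_mul]; norm_num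
    rw [h3, ← sq_abs x]
    have := abs_nonneg x
    gcongr; linarith
  have h3 : 1 ≤ Real.exp (2 * |x|) := Real.one_le_exp (by positivity)
  have hk : 0 < K^2 := by positivity
  have hk4 : 0 < K^4 := by positivity
  calc _ ≤ _ := h1
    _ ≤ 4 * K^4 * Real.exp (2 * |x|) + 2 * K^2 * Real.exp (2 * |x|) := by
        nlinarith [mul_le_mul_of_nonneg_left h2 hk4.le, mul_le_mul_of_nonneg_left h3 hk.le]
    _ = _ := by ring

lemma Gd.shift_bound {g : ℝ → ℝ} (h : Gd g) (R : ℝ) : ∃ u : ℤ → ℝ, Summable u ∧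
    ∀ q : ℤ, ∀ x, |x| ≤ R → |g (x + π * q)| ≤ u q := by
  obtain ⟨hc, C, a, ha, hb⟩ := h
  have hC0 : 0 ≤ C := by
    have := (abs_nonneg _).trans (hb 0); simpa using this
  refine ⟨fun q => (C * Real.exp (a * R^2)) * Real.exp (-(a * π^2 / 2 * (q:ℝ)^2)), ((exp_sum_one (a * π^2 / 2) (by positivity)).1).mul_left _, fun q x hx => ?_⟩
  refine (hb _).trans ?_
  change _ ≤ C * Real.exp (a*R^2) * Real.exp (-(a*π^2/2*(q:ℝ)^2))
  rw [mul_assoc, ← Real.exp_add]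
  refine mul_le_mul_of_nonneg_left (Real.exp_le_exp.mpr ?_) hC0
  have h1 : x^2 ≤ R^2 := by rw [← sq_abs x]; have := abs_nonneg x; gcongr
  have h2 : (π * q)^2 ≤ 2 * (x + π * q)^2 + 2 * x^2 := by nlinarith [sq_nonneg (2 * x + π * q)]
  nlinarith

lemma theta_deriv {g g' : ℝ → ℝ} (hg : Gd g) (hg' : Gd g') (hd : ∀ x, HasDerivAt g (g' x) x) (x : ℝ) :
    HasDerivAt (fun ω => ∑' q : ℤ, g (ω + π * q)) (∑' q : ℤ, g' (x + π * q)) x := by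
  obtain ⟨u, hu, hub⟩ := hg'.shift_bound (|x| + 1)
  obtain ⟨v, hv, hvb⟩ := hg.shift_bound (|x| + 1)
  refine hasDerivAt_tsum_of_isPreconnected (t := Metric.ball 0 (|x|+1)) hu Metric.isOpen_ball (convex_ball _ _).isPreconnected
    (g := fun (q : ℤ) ω => g (ω + π * q)) (g' := fun (q : ℤ) ω => g' (ω + π * q)) ?_ ?_ (y₀ := x) ?_ ?_ ?_
  · intro q y _
    exact (hd (y + π * q)).comp_add_const y (π * q)
  · intro q y hy
    refine hub q y ?_
    simpa using (mem_ball_zero_iff.mp hy).le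
  · simp
  · exact Summable.of_norm_bounded hv fun q => hvb q x (by linarith)
  · simp

lemma thetafun_eq (P ω : ℝ) : thetafun P ω = ∑' q : ℤ, kfun P (ω + π * q) := by
  rw [thetafun, ← tsum_mul_left]; rfl

lemma thetafun_dd {P : ℝ} (hP : 0 < P) (ω : ℝ) : deriv (deriv (thetafun P)) ω = ∑' q : ℤ, kd2 P (ω + π * q) := by
  have h1 : deriv (thetafun P) = fun ω => ∑' q : ℤ, kd1 P (ω + π * q) := by
    funext ω
    have : thetafun P = fun ω => ∑' q : ℤ, kfun P (ω + π * q) := funext (thetafun_eq P)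
    rw [this]
    exact (theta_deriv (kfun_gd hP) (kd1_gd hP) (kfun_deriv P) ω).deriv
  rw [h1]
  exact (theta_deriv (kd1_gd hP) (kd2_gd hP) (kd1_deriv P) ω).deriv

lemma kfun_dd (K r : ℝ) : deriv (deriv (kfun K)) r = kd2 K r := by
  have h1 : deriv (kfun K) = kd1 K := funext fun r => (kfun_deriv K r).deriv
  rw [h1]; exact (kd1_deriv K r).deriv

lemma unfold_theta {g F : ℝ → ℝ} (hg : Gd g) (hF : Continuous F) (hF1 : ∀ x, |F x| ≤ 1)
    (hper : Function.Periodic F π) :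
    ∫ ω in (0:ℝ)..π, F ω * ∑' q : ℤ, g (ω + π * q) = ∫ ω, F ω * g ω := by
  have hFq : ∀ (q : ℤ) x, F (x + π * q) = F x := by
    intro q x
    have := hper.int_mul q x
    rw [mul_comm] at this; exact this
  obtain ⟨u, hu, hub⟩ := hg.shift_bound π
  have hbd : ∀ (q : ℤ), ∀ x ∈ Set.uIoc 0 π, |F x * g (x + π * q)| ≤ u q := by
    intro q x hx
    rw [Set.uIoc_of_le Real.pi_pos.le] at hx
    have h1 := hub q x (by rw [abs_of_pos hx.1]; exact hx.2)
    rw [abs_mul]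
    calc |F x| * |g (x + π * q)| ≤ 1 * |g (x + π * q)| := by gcongr; exact hF1 x
      _ ≤ _ := by rw [one_mul]; exact h1
  have h1 : HasSum (fun q : ℤ => ∫ ω in (0:ℝ)..π, F ω * g (ω + π * q)) (∫ ω in (0:ℝ)..π, F ω * ∑' q : ℤ, g (ω + π * q)) := by
    refine intervalIntegral.hasSum_integral_of_dominated_convergence (fun q _ => u q) ?_ ?_ ?_ ?_ ?_
    · intro q
      have := hg.1
      exact Continuous.aestronglyMeasurable (by fun_prop)
    · intro q; exact Filter.Eventually.of_forall fun x hx => hbd q x hx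
    · exact Filter.Eventually.of_forall fun x _ => hu
    · exact intervalIntegrable_const
    · refine Filter.Eventually.of_forall fun x hx => ?_
      rw [Set.uIoc_of_le Real.pi_pos.le] at hx
      refine HasSum.mul_left _ (Summable.hasSum ?_)
      exact Summable.of_norm_bounded hu fun q => hub q x (by rw [abs_of_pos hx.1]; exact hx.2)
  have hintF : Integrable (fun x => F x * g x) := (hg.mul_bdd hF hF1).integrable
  have h2 := (hintF.comp_mul_left' Real.pi_ne_zero).hasSum_intervalIntegral_comp_add_int
  have h3 := h2.mul_left π
  have e1 : π * ∫ x, F (π * x) * g (π * x) = ∫ ω, F ω * g ω := by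
    rw [Measure.integral_comp_mul_left (fun x => F x * g x) π, abs_of_pos (inv_pos.mpr Real.pi_pos), smul_eq_mul,
      ← mul_assoc, mul_inv_cancel₀ Real.pi_ne_zero, one_mul]
  rw [e1] at h3
  have e2 : ∀ q : ℤ, (π * ∫ x in (0:ℝ)..1, F (π * (x + q)) * g (π * (x + q))) = ∫ ω in (0:ℝ)..π, F ω * g (ω + π * q) := by
    intro q
    have := intervalIntegral.mul_integral_comp_mul_left (a := 0) (b := 1) (f := fun ω => F ω * g (ω + π * q)) π
    rw [mul_zero, mul_one] at this
    rw [← this]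
    congr 2
    ext x
    rw [mul_add, hFq]
  simp only [e2] at h3
  exact h1.unique h3

/-- phase -/
noncomputable def ph (x y r w : ℝ) : ℝ := 2 * (x * (Real.cosh r * Real.cos w) - y * (Real.sinh r * Real.sin w))
/-- r-derivative of the phase -/
noncomputable def ph1 (x y r w : ℝ) : ℝ := 2 * (x * (Real.sinh r * Real.cos w) - y * (Real.cosh r * Real.sin w))
/-- w-derivative of the phase -/
noncomputable def ph2 (x y r w : ℝ) : ℝ := 2 * (x * (Real.cosh r * -Real.sin w) - y * (Real.sinh r * Real.cos w))

lemma ph_eq (z : ℂ) (r w : ℝ) : 2 * (z * trh r w).re = ph z.re z.im r w := by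
  have h1 : (trh r w).re = Real.cosh r * Real.cos w := by
    unfold trh; rw [add_re, I_mul_re, ofReal_re, ofReal_im, neg_zero, add_zero]
  have h2 : (trh r w).im = Real.sinh r * Real.sin w := by
    unfold trh; rw [add_im, I_mul_im, ofReal_re, ofReal_im, zero_add]
  rw [mul_re, h1, h2, ph]

lemma ph_r (x y r w : ℝ) : HasDerivAt (fun r => ph x y r w) (ph1 x y r w) r := by
  unfold ph ph1
  exact ((((Real.hasDerivAt_cosh r).mul_const _).const_mul _).fun_sub (((Real.hasDerivAt_sinh r).mul_const _).const_mul _)).const_mul _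

lemma ph1_r (x y r w : ℝ) : HasDerivAt (fun r => ph1 x y r w) (ph x y r w) r := by
  unfold ph ph1
  exact ((((Real.hasDerivAt_sinh r).mul_const _).const_mul _).fun_sub (((Real.hasDerivAt_cosh r).mul_const _).const_mul _)).const_mul _

lemma ph_w (x y r w : ℝ) : HasDerivAt (fun w => ph x y r w) (ph2 x y r w) w := by
  unfold ph ph2
  exact ((((Real.hasDerivAt_cos w).const_mul _).const_mul _).fun_sub (((Real.hasDerivAt_sin w).const_mul _).const_mul _)).const_mul _

lemma ph2_w (x y r w : ℝ) : HasDerivAt (fun w => ph2 x y r w) (-ph x y r w) w := by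
  unfold ph ph2
  exact (((((Real.hasDerivAt_sin w).fun_neg.const_mul _).const_mul _).fun_sub (((Real.hasDerivAt_cos w).const_mul _).const_mul _)).const_mul 2).congr_deriv (by ring)

lemma ph_sq (x y r w : ℝ) : ph1 x y r w ^2 + ph2 x y r w ^2 = 4 * (x^2+y^2) * (Real.sinh r ^2 + Real.sin w ^2) := by
  unfold ph1 ph2
  have h1 := Real.cosh_sq r
  have h2 := Real.sin_sq_add_cos_sq w
  have h3 : Real.cos w ^2 = 1 - Real.sin w ^2 := by linarith
  have : (2 * (x * (Real.sinh r * Real.cos w) - y * (Real.cosh r * Real.sin w)))^2 + (2 * (x * (Real.cosh r * -Real.sin w) - y * (Real.sinh r * Real.cos w)))^2 = 4 * (x^2+y^2) * (Real.sinh r ^2 * Real.cos w ^2 + Real.cosh r ^2 * Real.sin w ^2) := by ring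
  rw [this, h3, h1]; ring

lemma cosh_le_exp (r : ℝ) : Real.cosh r ≤ Real.exp |r| := by
  rw [← Real.cosh_abs, Real.cosh_eq]
  have := Real.exp_le_exp.mpr (by linarith [abs_nonneg r] : -|r| ≤ |r|)
  linarith

lemma abs_sinh_le_cosh (r : ℝ) : |Real.sinh r| ≤ Real.cosh r := by
  rw [abs_le]; constructor
  · have : 0 ≤ Real.sinh r + Real.cosh r := by rw [Real.sinh_add_cosh]; positivity
    linarith
  · have := (Real.sinh_lt_cosh r).le; exact this

lemma aux_bd {a b c : ℝ} (x y : ℝ) (ha : |a| ≤ c) (hb : |b| ≤ c) {u v : ℝ} (hu : |u| ≤ 1) (hv : |v| ≤ 1) :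
    |2 * (x * (a * u) - y * (b * v))| ≤ 2 * (|x| + |y|) * c := by
  rw [abs_mul, abs_two, mul_assoc]
  have h0 : 0 ≤ c := (abs_nonneg _).trans ha
  have h1 : |x * (a * u)| ≤ |x| * c := by
    rw [abs_mul, abs_mul]
    exact mul_le_mul_of_nonneg_left (by nlinarith [abs_nonneg a, abs_nonneg u]) (abs_nonneg _)
  have h2 : |y * (b * v)| ≤ |y| * c := by
    rw [abs_mul, abs_mul]
    exact mul_le_mul_of_nonneg_left (by nlinarith [abs_nonneg b, abs_nonneg v]) (abs_nonneg _)
  have := abs_sub (x * (a * u)) (y * (b * v))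
  linarith

lemma abs_cosh_le (r : ℝ) : |Real.cosh r| ≤ Real.cosh r := by rw [abs_of_pos (Real.cosh_pos r)]

lemma ph_bd (x y r w : ℝ) : |ph x y r w| ≤ 2 * (|x|+|y|) * Real.cosh r :=
  aux_bd x y (abs_cosh_le r) (abs_sinh_le_cosh r) (Real.abs_cos_le_one w) (Real.abs_sin_le_one w)
lemma ph1_bd (x y r w : ℝ) : |ph1 x y r w| ≤ 2 * (|x|+|y|) * Real.cosh r :=
  aux_bd x y (abs_sinh_le_cosh r) (abs_cosh_le r) (Real.abs_cos_le_one w) (Real.abs_sin_le_one w)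
lemma ph2_bd (x y r w : ℝ) : |ph2 x y r w| ≤ 2 * (|x|+|y|) * Real.cosh r :=
  aux_bd x y (abs_cosh_le r) (abs_sinh_le_cosh r) (by rw [abs_neg]; exact Real.abs_sin_le_one w) (Real.abs_cos_le_one w)

lemma ibp2 {F F1 F2 k k1 k2 : ℝ → ℝ} (hF : ∀ x, HasDerivAt F (F1 x) x) (hF1 : ∀ x, HasDerivAt F1 (F2 x) x)
    (gF : Gr F) (gF1 : Gr F1) (gF2 : Gr F2) (hk : ∀ x, HasDerivAt k (k1 x) x) (hk1 : ∀ x, HasDerivAt k1 (k2 x) x)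
    (dk : Gd k) (dk1 : Gd k1) (dk2 : Gd k2) : ∫ x, F x * k2 x = ∫ x, F2 x * k x := by
  have e1 := integral_mul_deriv_eq_deriv_mul_of_integrable (u := F) (v := k1) (u' := F1) (v' := k2) (fun x _ => hF x) (fun x _ => hk1 x)
    (dk2.mul_gr gF).integrable (dk1.mul_gr gF1).integrable (dk1.mul_gr gF).integrable
  have e2 := integral_mul_deriv_eq_deriv_mul_of_integrable (u := F1) (v := k) (u' := F2) (v' := k1) (fun x _ => hF1 x) (fun x _ => hk x)
    (dk1.mul_gr gF1).integrable (dk.mul_gr gF2).integrable (dk.mul_gr gF1).integrable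
  rw [e1, e2, neg_neg]

lemma prod_int {f : ℝ → ℝ → ℝ} {g h : ℝ → ℝ} (hf : Continuous (fun p : ℝ × ℝ => f p.1 p.2)) {C : ℝ}
    (hb : ∀ r w, |f r w| ≤ C * Real.exp (2 * |r|)) (hg : Gd g) (hh : Gd h) :
    Integrable (fun p : ℝ × ℝ => f p.1 p.2 * (g p.1 * h p.2)) (volume.prod volume) := by
  have h1 : Gd (fun r => Real.exp (2 * |r|) * g r) := hg.mul_gr ⟨by fun_prop, 1, fun x => by simp⟩
  have h2 := (h1.integrable.abs.const_mul C).mul_prod hh.integrable.abs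
  refine h2.mono' ?_ ?_
  · have := hg.1; have := hh.1
    exact Continuous.aestronglyMeasurable (by fun_prop)
  · refine Filter.Eventually.of_forall fun p => ?_
    simp only [Real.norm_eq_abs, abs_mul, Real.abs_exp]
    have := mul_le_mul_of_nonneg_right (hb p.1 p.2) (by positivity : 0 ≤ |g p.1| * |h p.2|)
    linarith

lemma Gd.add {g h : ℝ → ℝ} (hg : Gd g) (hh : Gd h) : Gd (fun x => g x + h x) := by
  obtain ⟨c1, C, a, ha, hb⟩ := hg
  obtain ⟨c2, D, b, hb0, hD⟩ := hh
  have hC0 : 0 ≤ C := by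
    have := (abs_nonneg _).trans (hb 0); simpa using this
  have hD0 : 0 ≤ D := by
    have := (abs_nonneg _).trans (hD 0); simpa using this
  refine ⟨c1.add c2, C + D, min a b, lt_min ha hb0, fun x => ?_⟩
  have e1 : Real.exp (-a * x^2) ≤ Real.exp (-(min a b) * x^2) := Real.exp_le_exp.mpr (by nlinarith [min_le_left a b, sq_nonneg x])
  have e2 : Real.exp (-b * x^2) ≤ Real.exp (-(min a b) * x^2) := Real.exp_le_exp.mpr (by nlinarith [min_le_right a b, sq_nonneg x])
  calc |g x + h x| ≤ |g x| + |h x| := abs_add_le _ _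
    _ ≤ C * Real.exp (-a * x^2) + D * Real.exp (-b * x^2) := add_le_add (hb x) (hD x)
    _ ≤ _ := by nlinarith [mul_le_mul_of_nonneg_left e1 hC0, mul_le_mul_of_nonneg_left e2 hD0]

lemma Gd.const_mul {g : ℝ → ℝ} (hg : Gd g) (t : ℝ) : Gd (fun x => t * g x) :=
  hg.mul_gr ⟨continuous_const, |t|, fun x => by
    have h3 : 1 ≤ Real.exp (2 * |x|) := Real.one_le_exp (by positivity)
    nlinarith [abs_nonneg t]⟩

lemma Gd.summable {g : ℝ → ℝ} (hg : Gd g) (x : ℝ) : Summable fun q : ℤ => g (x + π * q) := by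
  obtain ⟨u, hu, hub⟩ := hg.shift_bound |x|
  exact Summable.of_norm_bounded hu fun q => hub q x le_rfl

lemma ph_cont (x y : ℝ) : Continuous (fun p : ℝ × ℝ => ph x y p.1 p.2) := by unfold ph; fun_prop
lemma ph1_cont (x y : ℝ) : Continuous (fun p : ℝ × ℝ => ph1 x y p.1 p.2) := by unfold ph1; fun_prop
lemma ph2_cont (x y : ℝ) : Continuous (fun p : ℝ × ℝ => ph2 x y p.1 p.2) := by unfold ph2; fun_prop

lemma HH_rep1 {K P : ℝ} (hP : 0 < P) (z : ℂ) :
    HH K P z = -∫ r : ℝ, ∫ w : ℝ, Real.cos (2 * (z * trh r w).re) * (kd2 K r * kfun P w + kfun K r * kd2 P w) := by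
  unfold HH
  congr 1
  congr 1
  funext r
  have hg : Gd (fun w => kd2 K r * kfun P w + kfun K r * kd2 P w) :=
    ((kfun_gd hP).const_mul _).add ((kd2_gd hP).const_mul _)
  have hF : Continuous (fun w => Real.cos (2 * (z * trh r w).re)) := by
    simp only [ph_eq]
    exact Real.continuous_cos.comp ((ph_cont z.re z.im).comp (by fun_prop : Continuous fun w : ℝ => (r, w)))
  have := unfold_theta hg hF (fun x => Real.abs_cos_le_one _) (by
    intro w
    simp only [ph_eq, ph, Real.cos_add_pi, Real.sin_add_pi]
    rw [← Real.cos_neg]; congr 1; ring)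
  rw [← this]
  congr 1
  funext w
  rw [kfun_dd, thetafun_dd hP, thetafun_eq, ← tsum_mul_left, ← tsum_mul_left, Summable.tsum_add]
  · exact ((kfun_gd hP).summable w).mul_left _
  · exact ((kd2_gd hP).summable w).mul_left _

set_option maxHeartbeats 1600000 in
lemma HH_rep2 {K P : ℝ} (hK : 0 < K) (hP : 0 < P) (z : ℂ) :
    HH K P z = ∫ r : ℝ, ∫ w : ℝ, Real.cos (2 * (z * trh r w).re) * (4 * ‖z‖^2 * (Real.sinh r ^2 + Real.sin w ^2) * (kfun K r * kfun P w)) := by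
  rw [HH_rep1 hP]
  simp only [ph_eq]
  set x := z.re
  set y := z.im
  have hz : ‖z‖^2 = x^2 + y^2 := by rw [← Complex.normSq_eq_norm_sq, Complex.normSq_apply]; ring
  set A := 2 * (|x| + |y|) with hA
  have hA0 : 0 ≤ A := by positivity
  have hE1 : ∀ r : ℝ, 1 ≤ Real.exp (2 * |r|) := fun r => Real.one_le_exp (by positivity)
  have hE2 : ∀ r : ℝ, Real.cosh r ≤ Real.exp (2 * |r|) := fun r => (cosh_le_exp r).trans (Real.exp_le_exp.mpr (by linarith [abs_nonneg r]))
  have hE3 : ∀ r : ℝ, Real.cosh r ^2 ≤ Real.exp (2 * |r|) := fun r => by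
    have h3 : Real.exp (2 * |r|) = Real.exp |r| ^ 2 := by rw [← Real.exp_nat_mul]; norm_num
    rw [h3]
    have := Real.cosh_pos r
    exact pow_le_pow_left₀ this.le (cosh_le_exp r) 2
  -- bounds
  have hb0 : ∀ r w, |Real.cos (ph x y r w)| ≤ 1 * Real.exp (2 * |r|) := fun r w => by
    rw [one_mul]; exact (Real.abs_cos_le_one _).trans (hE1 r)
  have hb1 : ∀ (r s : ℝ), |s| ≤ A * Real.cosh r → ∀ w, |-Real.sin (ph x y r w) * s| ≤ A * Real.exp (2 * |r|) := fun r s hs w => by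
    rw [abs_mul, abs_neg]
    have := Real.abs_sin_le_one (ph x y r w)
    nlinarith [abs_nonneg s, mul_le_mul_of_nonneg_left (hE2 r) hA0]
  have hb2 : ∀ (r s t : ℝ), |s| ≤ A * Real.cosh r → |t| ≤ A * Real.cosh r → ∀ w, |-(Real.cos (ph x y r w) * s) * s + -Real.sin (ph x y r w) * t| ≤ (A^2 + A) * Real.exp (2 * |r|) := fun r s t hs ht w => by
    have h1 := hb1 r t ht w
    have h2 : |-(Real.cos (ph x y r w) * s) * s| ≤ A^2 * Real.exp (2 * |r|) := by
      have : -(Real.cos (ph x y r w) * s) * s = -(Real.cos (ph x y r w) * s^2) := by ring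
      rw [this, abs_neg, abs_mul, abs_of_nonneg (sq_nonneg s)]
      have h4 := Real.abs_cos_le_one (ph x y r w)
      have h5 : s^2 ≤ (A * Real.cosh r)^2 := by rw [← sq_abs s]; exact pow_le_pow_left₀ (abs_nonneg s) hs 2
      calc _ ≤ 1 * s^2 := mul_le_mul_of_nonneg_right h4 (sq_nonneg s)
        _ ≤ A^2 * Real.cosh r^2 := by rw [one_mul, ← mul_pow]; exact h5
        _ ≤ _ := mul_le_mul_of_nonneg_left (hE3 r) (sq_nonneg A)
    refine (abs_add_le _ _).trans ?_
    linarith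
  have cph := ph_cont x y
  have cph1 := ph1_cont x y
  have cph2 := ph2_cont x y
  -- derivatives
  have d1 : ∀ r w, HasDerivAt (fun r => Real.cos (ph x y r w)) (-Real.sin (ph x y r w) * ph1 x y r w) r := fun r w => (ph_r x y r w).cos
  have d2 : ∀ r w, HasDerivAt (fun r => -Real.sin (ph x y r w) * ph1 x y r w) (-(Real.cos (ph x y r w) * ph1 x y r w) * ph1 x y r w + -Real.sin (ph x y r w) * ph x y r w) r :=
    fun r w => (ph_r x y r w).sin.fun_neg.fun_mul (ph1_r x y r w)
  have d3 : ∀ r w, HasDerivAt (fun w => Real.cos (ph x y r w)) (-Real.sin (ph x y r w) * ph2 x y r w) w := fun r w => (ph_w x y r w).cos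
  have d4 : ∀ r w, HasDerivAt (fun w => -Real.sin (ph x y r w) * ph2 x y r w) (-(Real.cos (ph x y r w) * ph2 x y r w) * ph2 x y r w + -Real.sin (ph x y r w) * -ph x y r w) w :=
    fun r w => (ph_w x y r w).sin.fun_neg.fun_mul (ph2_w x y r w)
  have gphn : ∀ r w, |-ph x y r w| ≤ A * Real.cosh r := fun r w => by rw [abs_neg]; exact ph_bd x y r w
  have I1 := prod_int (f := fun r w => Real.cos (ph x y r w)) (by fun_prop) hb0 (kd2_gd hK) (kfun_gd hP)
  have I2 := prod_int (f := fun r w => Real.cos (ph x y r w)) (by fun_prop) hb0 (kfun_gd hK) (kd2_gd hP)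
  have I3 := prod_int (f := fun r w => -(Real.cos (ph x y r w) * ph1 x y r w) * ph1 x y r w + -Real.sin (ph x y r w) * ph x y r w) (by fun_prop)
    (fun r w => hb2 r _ _ (ph1_bd x y r w) (ph_bd x y r w) w) (kfun_gd hK) (kfun_gd hP)
  have I4 := prod_int (f := fun r w => -(Real.cos (ph x y r w) * ph2 x y r w) * ph2 x y r w + -Real.sin (ph x y r w) * -ph x y r w) (by fun_prop)
    (fun r w => hb2 r _ _ (ph2_bd x y r w) (gphn r w) w) (kfun_gd hK) (kfun_gd hP)
  have hr : ∀ w : ℝ, Continuous (fun r : ℝ => (r, w)) := fun w => by fun_prop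
  have hw : ∀ r : ℝ, Continuous (fun w : ℝ => (r, w)) := fun r => by fun_prop
  have e1 : ∀ w, ∫ r, Real.cos (ph x y r w) * (kd2 K r * kfun P w) = ∫ r, (-(Real.cos (ph x y r w) * ph1 x y r w) * ph1 x y r w + -Real.sin (ph x y r w) * ph x y r w) * (kfun K r * kfun P w) := by
    intro w
    simp only [← mul_assoc]
    rw [integral_mul_const, integral_mul_const]
    congr 1
    have c0 : Continuous fun r => ph x y r w := cph.comp (hr w)
    have c1 : Continuous fun r => ph1 x y r w := cph1.comp (hr w)
    exact ibp2 (fun r => d1 r w) (fun r => d2 r w) ⟨by fun_prop, 1, fun r => hb0 r w⟩ ⟨by fun_prop, A, fun r => hb1 r _ (ph1_bd x y r w) w⟩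
      ⟨by fun_prop, _, fun r => hb2 r _ _ (ph1_bd x y r w) (ph_bd x y r w) w⟩ (kfun_deriv K) (kd1_deriv K) (kfun_gd hK) (kd1_gd hK) (kd2_gd hK)
  have e2 : ∀ r, ∫ w, Real.cos (ph x y r w) * (kfun K r * kd2 P w) = ∫ w, (-(Real.cos (ph x y r w) * ph2 x y r w) * ph2 x y r w + -Real.sin (ph x y r w) * -ph x y r w) * (kfun K r * kfun P w) := by
    intro r
    have m1 : ∀ a b : ℝ, a * (kfun K r * b) = kfun K r * (a * b) := fun a b => by ring
    simp only [m1]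
    rw [integral_const_mul, integral_const_mul]
    congr 1
    have c0 : Continuous fun w => ph x y r w := cph.comp (hw r)
    have c1 : Continuous fun w => ph2 x y r w := cph2.comp (hw r)
    have up : ∀ {B : ℝ} (w : ℝ), 0 ≤ B → B ≤ B * Real.exp (2 * |w|) := fun w hB => le_mul_of_one_le_right hB (hE1 w)
    exact ibp2 (fun w => d3 r w) (fun w => d4 r w) ⟨by fun_prop, _, fun w => (hb0 r w).trans (up w (by positivity))⟩ ⟨by fun_prop, _, fun w => (hb1 r _ (ph2_bd x y r w) w).trans (up w (by positivity))⟩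
      ⟨by fun_prop, _, fun w => (hb2 r _ _ (ph2_bd x y r w) (gphn r w) w).trans (up w (by positivity))⟩ (kfun_deriv P) (kd1_deriv P) (kfun_gd hP) (kd1_gd hP) (kd2_gd hP)
  have s1 : ∫ r : ℝ, ∫ w : ℝ, Real.cos (ph x y r w) * (kd2 K r * kfun P w + kfun K r * kd2 P w)
      = (∫ r : ℝ, ∫ w : ℝ, Real.cos (ph x y r w) * (kd2 K r * kfun P w)) + ∫ r : ℝ, ∫ w : ℝ, Real.cos (ph x y r w) * (kfun K r * kd2 P w) := by
    rw [← integral_integral_add I1 I2]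
    simp only [mul_add]
  rw [s1, integral_integral_swap I1]
  simp only [e1, e2]
  rw [← integral_integral_swap I3, ← integral_integral_add I3 I4, ← integral_neg]
  congr 1; funext r
  rw [← integral_neg]
  congr 1; funext w
  rw [hz]
  have := ph_sq x y r w
  calc _ = Real.cos (ph x y r w) * (ph1 x y r w ^ 2 + ph2 x y r w ^ 2) * (kfun K r * kfun P w) := by ring
    _ = _ := by rw [this]; ring

lemma gauss_prod {K P : ℝ} (hK : 0 < K) (hP : 0 < P) :
    Integrable (fun p : ℝ × ℝ => Real.exp (-(K^2/4) * p.1^2) * Real.exp (-(P^2/5) * p.2^2)) (volume.prod volume) ∧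
    K * P * ∫ p : ℝ × ℝ, Real.exp (-(K^2/4) * p.1^2) * Real.exp (-(P^2/5) * p.2^2) ∂(volume.prod volume) ≤ 15 := by
  have hk : 0 < K^2/4 := by positivity
  have hp : 0 < P^2/5 := by positivity
  refine ⟨(integrable_exp_neg_mul_sq hk).mul_prod (integrable_exp_neg_mul_sq hp), ?_⟩
  rw [integral_prod_mul (fun x : ℝ => Real.exp (-(K^2/4) * x^2)) (fun x : ℝ => Real.exp (-(P^2/5) * x^2)), integral_gaussian, integral_gaussian]
  have e1 : Real.sqrt (π / (K^2/4)) = 2 * Real.sqrt π / K := by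
    rw [Real.sqrt_div Real.pi_pos.le, Real.sqrt_div (sq_nonneg K), Real.sqrt_sq hK.le]
    rw [show (4:ℝ) = 2^2 by norm_num, Real.sqrt_sq (by norm_num)]; field_simp
  have e2 : Real.sqrt (π / (P^2/5)) = Real.sqrt 5 * Real.sqrt π / P := by
    rw [Real.sqrt_div Real.pi_pos.le, Real.sqrt_div (sq_nonneg P), Real.sqrt_sq hP.le]; field_simp
  rw [e1, e2]
  have : K * P * (2 * Real.sqrt π / K * (Real.sqrt 5 * Real.sqrt π / P)) = 2 * Real.sqrt 5 * π := by
    have := Real.mul_self_sqrt Real.pi_pos.le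
    field_simp; rw [sq, this]
  rw [this]
  have h5 : Real.sqrt 5 ≤ 2.24 := by rw [Real.sqrt_le_left (by norm_num)]; norm_num
  have := Real.pi_lt_d2
  nlinarith [Real.pi_pos, Real.sqrt_nonneg 5]

lemma trh_norm_le (r w : ℝ) : ‖trh r w‖ ≤ Real.cosh r := by
  have h1 : (trh r w).re = Real.cosh r * Real.cos w := by
    unfold trh; rw [add_re, I_mul_re, ofReal_re, ofReal_im, neg_zero, add_zero]
  have h2 : (trh r w).im = Real.sinh r * Real.sin w := by
    unfold trh; rw [add_im, I_mul_im, ofReal_re, ofReal_im, zero_add]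
  refine abs_le_of_sq_le_sq' ?_ (Real.cosh_pos r).le |>.2
  rw [← Complex.normSq_eq_norm_sq, Complex.normSq_apply, h1, h2]
  have h3 := Real.cosh_sq r
  have h4 := Real.sin_sq_add_cos_sq w
  nlinarith [sq_nonneg (Real.sin w), sq_nonneg (Real.sinh r)]

lemma trh_norm_ge (r w : ℝ) (hw : |w| ≤ 6/5) : 1/4 ≤ ‖trh r w‖ := by
  have h1 : (trh r w).re = Real.cosh r * Real.cos w := by
    unfold trh; rw [add_re, I_mul_re, ofReal_re, ofReal_im, neg_zero, add_zero]
  have h2 := Complex.re_le_norm (trh r w)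
  rw [h1] at h2
  have h3 := Real.one_sub_sq_div_two_le_cos (x := w)
  have h4 := Real.one_le_cosh r
  have h5 : w^2 ≤ 36/25 := by rw [← sq_abs]; nlinarith [abs_nonneg w]
  nlinarith

/-- size of the dyadic form -/
noncomputable def DD (P N x : ℝ) : ℝ := x^2 + x * N + Real.exp (-P^2) * (x + N)^2

lemma BF_pt (M : Finset GaussianInt) (N : ℝ) (hN : 0 < N) (hM : ∀ m ∈ M, ‖(m:ℂ)‖ ≤ Real.sqrt 2 * N)
    (c : GaussianInt) (hc : c ≠ 0) (β : GaussianInt → ℂ) (P r w : ℝ) :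
    ‖BF M β (trh r w) c‖ * Real.exp (-(9/10 * P^2 * w^2)) ≤ 120000 * DD P N ‖(c:ℂ)‖ * (∑ m ∈ M, ‖β m‖^2) * Real.cosh r * Real.exp (-(P^2/5) * w^2) := by
  have hS : 0 ≤ ∑ m ∈ M, ‖β m‖^2 := Finset.sum_nonneg fun _ _ => by positivity
  have h1 := Real.one_le_cosh r
  have ht := trh_norm_le r w
  have hc0 : 0 ≤ ‖(c:ℂ)‖ := norm_nonneg _
  set S := ∑ m ∈ M, ‖β m‖^2
  set x := ‖(c:ℂ)‖
  by_cases hw : |w| ≤ 6/5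
  · have hb := BF_good M N hN hM c hc β (trh r w) (trh_norm_ge r w hw)
    have hb2 : ‖BF M β (trh r w) c‖ ≤ 120000 * DD P N x * S * Real.cosh r := by
      refine hb.trans ?_
      have : x^2 + x * N * ‖trh r w‖ ≤ DD P N x * Real.cosh r := by
        have h2 : x * N * ‖trh r w‖ ≤ x * N * Real.cosh r := mul_le_mul_of_nonneg_left ht (by positivity)
        have h3 : x^2 ≤ x^2 * Real.cosh r := le_mul_of_one_le_right (by positivity) h1
        have h4 : 0 ≤ Real.exp (-P^2) * (x+N)^2 * Real.cosh r := by positivity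
        unfold DD; nlinarith
      calc 120000 * (x^2 + x * N * ‖trh r w‖) * S ≤ 120000 * (DD P N x * Real.cosh r) * S := by gcongr
        _ = _ := by ring
    refine mul_le_mul hb2 (Real.exp_le_exp.mpr ?_) (Real.exp_pos _).le ((norm_nonneg _).trans hb2)
    nlinarith [mul_nonneg (sq_nonneg P) (sq_nonneg w)]
  · push Not at hw
    have hb := BF_all M N hN hM c hc β (trh r w)
    have hw2 : 36/25 ≤ w^2 := by rw [← sq_abs]; nlinarith
    have he : Real.exp (-(9/10 * P^2 * w^2)) ≤ Real.exp (-P^2) * Real.exp (-(P^2/5) * w^2) := by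
      rw [← Real.exp_add]
      refine Real.exp_le_exp.mpr ?_
      nlinarith [mul_le_mul_of_nonneg_left hw2 (sq_nonneg P)]
    have hb2 : ‖BF M β (trh r w) c‖ ≤ 120000 * (x+N)^2 * S * Real.cosh r := by
      refine hb.trans ?_
      calc 60000 * (1 + ‖trh r w‖) * (x + N)^2 * S ≤ 60000 * (2 * Real.cosh r) * (x+N)^2 * S := by gcongr; linarith
        _ = _ := by ring
    calc _ ≤ (120000 * (x+N)^2 * S * Real.cosh r) * (Real.exp (-P^2) * Real.exp (-(P^2/5) * w^2)) :=
          mul_le_mul hb2 he (Real.exp_pos _).le ((norm_nonneg _).trans hb2)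
      _ = 120000 * (Real.exp (-P^2) * (x+N)^2) * S * Real.cosh r * Real.exp (-(P^2/5) * w^2) := by ring
      _ ≤ _ := by
          gcongr
          unfold DD
          have : 0 ≤ x^2 + x * N := by positivity
          linarith

/-- admissible weight -/
def Wt (K P A : ℝ) (ρ : ℝ → ℝ → ℝ) : Prop := Continuous (fun p : ℝ × ℝ => ρ p.1 p.2) ∧
  ∀ r w, |ρ r w| * Real.cosh r ≤ A * (K * P) * (Real.exp (-(K^2/4) * r^2) * Real.exp (-(9/10 * P^2 * w^2)))

lemma Wt.abs_le {K P A : ℝ} {ρ : ℝ → ℝ → ℝ} (h : Wt K P A ρ) (hA : 0 ≤ A) (hK : 0 < K) (hP : 0 < P) (r w : ℝ) :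
    |ρ r w| ≤ A * (K * P) * (Real.exp (-(K^2/4) * r^2) * Real.exp (-(P^2/5) * w^2)) := by
  have h1 := h.2 r w
  have h2 : |ρ r w| ≤ |ρ r w| * Real.cosh r := le_mul_of_one_le_right (abs_nonneg _) (Real.one_le_cosh r)
  refine (h2.trans h1).trans ?_
  have : Real.exp (-(9/10 * P^2 * w^2)) ≤ Real.exp (-(P^2/5) * w^2) := Real.exp_le_exp.mpr (by nlinarith [mul_nonneg (sq_nonneg P) (sq_nonneg w)])
  gcongr

lemma trh_phase_cont (z : ℂ) : Continuous fun p : ℝ × ℝ => Real.cos (2 * (z * trh p.1 p.2).re) := by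
  simp only [ph_eq]
  exact Real.continuous_cos.comp (ph_cont _ _)

lemma Wt.integrable {K P A : ℝ} {ρ : ℝ → ℝ → ℝ} (h : Wt K P A ρ) (hA : 0 ≤ A) (hK : 0 < K) (hP : 0 < P) (z : ℂ) :
    Integrable (fun p : ℝ × ℝ => Real.cos (2 * (z * trh p.1 p.2).re) * ρ p.1 p.2) (volume.prod volume) := by
  refine ((gauss_prod hK hP).1.const_mul (A * (K * P))).mono' ((trh_phase_cont z).mul h.1).aestronglyMeasurable ?_
  refine Filter.Eventually.of_forall fun p => ?_
  rw [Real.norm_eq_abs, abs_mul]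
  refine le_trans ?_ (h.abs_le hA hK hP p.1 p.2)
  have := Real.abs_cos_le_one (2 * (z * trh p.1 p.2).re)
  nlinarith [abs_nonneg (ρ p.1 p.2)]

lemma Wt.int_bound {K P A : ℝ} {ρ : ℝ → ℝ → ℝ} (h : Wt K P A ρ) (hA : 0 ≤ A) (hK : 0 < K) (hP : 0 < P) (z : ℂ) :
    |∫ r, ∫ w, Real.cos (2 * (z * trh r w).re) * ρ r w| ≤ 15 * A := by
  rw [← integral_prod _ (h.integrable hA hK hP z), ← Real.norm_eq_abs]
  refine (norm_integral_le_of_norm_le ((gauss_prod hK hP).1.const_mul (A * (K * P))) (Filter.Eventually.of_forall fun p => ?_)).trans ?_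
  · rw [Real.norm_eq_abs, abs_mul]
    refine le_trans ?_ (h.abs_le hA hK hP p.1 p.2)
    have := Real.abs_cos_le_one (2 * (z * trh p.1 p.2).re)
    nlinarith [abs_nonneg (ρ p.1 p.2)]
  · rw [integral_const_mul]
    have := mul_le_mul_of_nonneg_left (gauss_prod hK hP).2 hA
    linarith

lemma Phi_int (M : Finset GaussianInt) (N : ℝ) (hN : 0 < N) (hM : ∀ m ∈ M, ‖(m:ℂ)‖ ≤ Real.sqrt 2 * N)
    (c : GaussianInt) (hc : c ≠ 0) (β : GaussianInt → ℂ) {K P A : ℝ} {ρ : ℝ → ℝ → ℝ} (h : Wt K P A ρ) (hA : 0 ≤ A) (hK : 0 < K) (hP : 0 < P) :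
    ‖∑ m ∈ M, ∑ n ∈ M, β m * conj (β n) * kloosterman m n c *
      ((∫ r, ∫ w, Real.cos (2 * (2 * Real.pi * ((m:ℂ)*(n:ℂ))^((1:ℂ)/2) / (c:ℂ) * trh r w).re) * ρ r w : ℝ) : ℂ)‖
      ≤ 1800000 * A * DD P N ‖(c:ℂ)‖ * ∑ m ∈ M, ‖β m‖^2 := by
  have hS : 0 ≤ ∑ m ∈ M, ‖β m‖^2 := Finset.sum_nonneg fun _ _ => by positivity
  have hc0 : 0 ≤ ‖(c:ℂ)‖ := norm_nonneg _
  have hD : 0 ≤ DD P N ‖(c:ℂ)‖ := by unfold DD; positivity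
  have e : ∑ m ∈ M, ∑ n ∈ M, β m * conj (β n) * kloosterman m n c *
      ((∫ r, ∫ w, Real.cos (2 * (2 * Real.pi * ((m:ℂ)*(n:ℂ))^((1:ℂ)/2) / (c:ℂ) * trh r w).re) * ρ r w : ℝ) : ℂ)
      = ∫ p : ℝ × ℝ, BF M β (trh p.1 p.2) c * ((ρ p.1 p.2 : ℝ) : ℂ) ∂(volume.prod volume) := by
    have hi : ∀ m n : GaussianInt, Integrable (fun p : ℝ × ℝ => β m * conj (β n) * kloosterman m n c * ((Real.cos (2 * (2 * Real.pi * ((m:ℂ)*(n:ℂ))^((1:ℂ)/2) / (c:ℂ) * trh p.1 p.2).re) * ρ p.1 p.2 : ℝ) : ℂ)) (volume.prod volume) :=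
      fun m n => ((h.integrable hA hK hP _).ofReal).const_mul _
    have e1 : ∀ p : ℝ × ℝ, BF M β (trh p.1 p.2) c * ((ρ p.1 p.2 : ℝ) : ℂ) = ∑ m ∈ M, ∑ n ∈ M, β m * conj (β n) * kloosterman m n c * ((Real.cos (2 * (2 * Real.pi * ((m:ℂ)*(n:ℂ))^((1:ℂ)/2) / (c:ℂ) * trh p.1 p.2).re) * ρ p.1 p.2 : ℝ) : ℂ) := by
      intro p
      unfold BF
      rw [Finset.sum_mul]
      refine Finset.sum_congr rfl fun m _ => ?_
      rw [Finset.sum_mul]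
      refine Finset.sum_congr rfl fun n _ => ?_
      rw [ofReal_mul]; ring
    simp only [e1]
    rw [integral_finsetSum _ (fun m _ => integrable_finsetSum _ (fun n _ => hi m n))]
    refine Finset.sum_congr rfl fun m _ => ?_
    rw [integral_finsetSum _ (fun n _ => hi m n)]
    refine Finset.sum_congr rfl fun n _ => ?_
    rw [integral_const_mul]
    congr 1
    refine Eq.trans ?_ integral_complex_ofReal.symm
    rw [integral_prod _ (h.integrable hA hK hP _)]
  rw [e]
  set S := ∑ m ∈ M, ‖β m‖^2
  set D := DD P N ‖(c:ℂ)‖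
  refine (norm_integral_le_of_norm_le ((gauss_prod hK hP).1.const_mul (120000 * D * S * (A * (K * P)))) (Filter.Eventually.of_forall fun p => ?_)).trans ?_
  · rw [norm_mul, Complex.norm_real, Real.norm_eq_abs]
    have b1 := BF_pt M N hN hM c hc β P p.1 p.2
    have b2 := h.2 p.1 p.2
    have hch := Real.cosh_pos p.1
    set X := ‖BF M β (trh p.1 p.2) c‖
    set q := Real.cosh p.1
    have hX : 0 ≤ X := norm_nonneg _
    have key : X * |ρ p.1 p.2| * q ≤ (120000 * D * S * (A * (K * P)) * (Real.exp (-(K^2/4) * p.1^2) * Real.exp (-(P^2/5) * p.2^2))) * q := by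
      calc X * |ρ p.1 p.2| * q = X * (|ρ p.1 p.2| * q) := by ring
        _ ≤ X * (A * (K * P) * (Real.exp (-(K^2/4) * p.1^2) * Real.exp (-(9/10 * P^2 * p.2^2)))) := mul_le_mul_of_nonneg_left b2 hX
        _ = (A * (K * P) * Real.exp (-(K^2/4) * p.1^2)) * (X * Real.exp (-(9/10 * P^2 * p.2^2))) := by ring
        _ ≤ (A * (K * P) * Real.exp (-(K^2/4) * p.1^2)) * (120000 * D * S * q * Real.exp (-(P^2/5) * p.2^2)) := mul_le_mul_of_nonneg_left b1 (by positivity)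
        _ = _ := by ring
    exact le_of_mul_le_mul_right key hch
  · rw [integral_const_mul]
    have := mul_le_mul_of_nonneg_left (gauss_prod hK hP).2 (by positivity : 0 ≤ 120000 * D * S * A)
    linarith

lemma abs_sinh_le (r : ℝ) : |Real.sinh r| ≤ |r| * Real.exp |r| := by
  rw [Real.abs_sinh, Real.sinh_eq]
  have h := Real.add_one_le_exp (-(2 * |r|))
  have h2 : Real.exp (-|r|) = Real.exp |r| * Real.exp (-(2*|r|)) := by rw [← Real.exp_add]; congr 1; ring
  rw [h2]
  nlinarith [Real.exp_pos |r|]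

lemma exp3 {K : ℝ} (hK : 1/2 ≤ K) (r : ℝ) : Real.exp (3 * |r|) * Real.exp (-(9/10 * (K^2 * r^2))) ≤ Real.exp 14 * Real.exp (-(K^2/4) * r^2) := by
  rw [← Real.exp_add, ← Real.exp_add]
  refine Real.exp_le_exp.mpr ?_
  have h1 : 1/4 * r^2 ≤ K^2 * r^2 := mul_le_mul_of_nonneg_right (by nlinarith) (sq_nonneg r)
  have h2 : |r|^2 = r^2 := sq_abs r
  nlinarith [sq_nonneg (13 * |r| - 120)]

lemma poly_exp (x : ℝ) : x ≤ 10 * Real.exp (x/10) := by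
  have := Real.add_one_le_exp (x/10); linarith

lemma kfun_mul (K P r w : ℝ) : kfun K r * kfun P w = π * (K * P) * (Real.exp (-(K^2*r^2)) * Real.exp (-(P^2*w^2))) := by
  unfold kfun
  have := Real.mul_self_sqrt Real.pi_pos.le
  calc _ = (Real.sqrt π * Real.sqrt π) * (K * P) * (Real.exp (-(K^2*r^2)) * Real.exp (-(P^2*w^2))) := by ring
    _ = _ := by rw [this]

lemma exp_split (x : ℝ) : Real.exp (-x) = Real.exp (-(x/10)) * Real.exp (-(9/10 * x)) := by
  rw [← Real.exp_add]; congr 1; ring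

/-- common final step -/
lemma wt_fin {K P : ℝ} (hK : 1/2 ≤ K) (hP : 1/2 ≤ P) {A X r w : ℝ} (hA : 0 ≤ A)
    (h : X ≤ A * (K * P) * (Real.exp (3 * |r|) * Real.exp (-(9/10 * (K^2 * r^2))) * Real.exp (-(9/10 * (P^2 * w^2))))) :
    X ≤ A * Real.exp 14 * (K * P) * (Real.exp (-(K^2/4) * r^2) * Real.exp (-(9/10 * P^2 * w^2))) := by
  refine h.trans ?_
  have h3 := exp3 hK r
  have e : -(9/10 * P^2 * w^2) = -(9/10 * (P^2 * w^2)) := by ring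
  rw [e]
  have := mul_le_mul_of_nonneg_left h3 (by positivity : 0 ≤ A * (K * P) * Real.exp (-(9/10 * (P^2 * w^2))))
  linarith

lemma wt1 {K P : ℝ} (hK : 1/2 ≤ K) (hP : 1/2 ≤ P) :
    Wt K P (160 * (K^2+P^2) * Real.exp 14) (fun r w => kd2 K r * kfun P w + kfun K r * kd2 P w) := by
  have hK0 : 0 < K := by linarith
  have hP0 : 0 < P := by linarith
  constructor
  · have := (kd2_gd hK0).1; have := (kd2_gd hP0).1; have := (kfun_gd hK0).1; have := (kfun_gd hP0).1
    fun_prop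
  intro r w
  refine wt_fin hK hP (by positivity) ?_
  beta_reduce
  have e : kd2 K r * kfun P w + kfun K r * kd2 P w = (2 * K^2 * (2 * (K^2 * r^2) - 1) + 2 * P^2 * (2 * (P^2 * w^2) - 1)) * (kfun K r * kfun P w) := by
    unfold kd2; ring
  rw [e, kfun_mul, abs_mul, abs_of_nonneg (by positivity : 0 ≤ π * (K * P) * (Real.exp (-(K^2*r^2)) * Real.exp (-(P^2*w^2))))]
  set x := K^2 * r^2 with hx
  set y := P^2 * w^2 with hy
  have hx0 : 0 ≤ x := by positivity
  have hy0 : 0 ≤ y := by positivity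
  have a1 : |2 * K^2 * (2 * x - 1) + 2 * P^2 * (2 * y - 1)| ≤ 40 * (K^2 + P^2) * (Real.exp (x/10) * Real.exp (y/10)) := by
    have b1 : |2 * x - 1| ≤ 20 * (Real.exp (x/10) * Real.exp (y/10)) := by
      have p1 := poly_exp x
      have p2 := Real.add_one_le_exp (x/10)
      have p3 : 1 ≤ Real.exp (y/10) := Real.one_le_exp (by positivity)
      have : Real.exp (x/10) ≤ Real.exp (x/10) * Real.exp (y/10) := le_mul_of_one_le_right (by positivity) p3
      rw [abs_le]; constructor <;> linarith
    have b2 : |2 * y - 1| ≤ 20 * (Real.exp (x/10) * Real.exp (y/10)) := by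
      have p1 := poly_exp y
      have p2 := Real.add_one_le_exp (y/10)
      have p3 : 1 ≤ Real.exp (x/10) := Real.one_le_exp (by positivity)
      have : Real.exp (y/10) ≤ Real.exp (x/10) * Real.exp (y/10) := le_mul_of_one_le_left (by positivity) p3
      rw [abs_le]; constructor <;> linarith
    calc _ ≤ |2 * K^2 * (2 * x - 1)| + |2 * P^2 * (2 * y - 1)| := abs_add_le _ _
      _ = 2 * K^2 * |2 * x - 1| + 2 * P^2 * |2 * y - 1| := by
          rw [abs_mul, abs_mul (2 * P^2), abs_of_nonneg (by positivity : 0 ≤ 2 * K^2), abs_of_nonneg (by positivity : 0 ≤ 2 * P^2)]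
      _ ≤ 2 * K^2 * (20 * (Real.exp (x/10) * Real.exp (y/10))) + 2 * P^2 * (20 * (Real.exp (x/10) * Real.exp (y/10))) := by gcongr
      _ = _ := by ring
  have ch : Real.cosh r ≤ Real.exp (3 * |r|) := (cosh_le_exp r).trans (Real.exp_le_exp.mpr (by linarith [abs_nonneg r]))
  have hch := Real.cosh_pos r
  have hx1 : Real.exp (-x) = Real.exp (-(x/10)) * Real.exp (-(9/10*x)) := exp_split x
  have hy1 : Real.exp (-y) = Real.exp (-(y/10)) * Real.exp (-(9/10*y)) := exp_split y
  have hx2 : Real.exp (x/10) * Real.exp (-(x/10)) = 1 := by rw [← Real.exp_add]; simp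
  have hy2 : Real.exp (y/10) * Real.exp (-(y/10)) = 1 := by rw [← Real.exp_add]; simp
  calc _ ≤ (40 * (K^2 + P^2) * (Real.exp (x/10) * Real.exp (y/10))) * (4 * (K * P) * (Real.exp (-x) * Real.exp (-y))) * Real.exp (3 * |r|) := by
        have := Real.pi_le_four
        gcongr
    _ = 160 * (K^2 + P^2) * (K * P) * (Real.exp (3 * |r|) * ((Real.exp (x/10) * Real.exp (-(x/10))) * Real.exp (-(9/10*x))) * ((Real.exp (y/10) * Real.exp (-(y/10))) * Real.exp (-(9/10*y)))) := by
        rw [hx1, hy1]; ring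
    _ = _ := by rw [hx2, hy2, one_mul, one_mul]
    _ ≤ _ := le_rfl

lemma wt2 {K P : ℝ} (hK : 1/2 ≤ K) (hP : 1/2 ≤ P) :
    Wt K P (40 * (1/K^2+1/P^2) * Real.exp 14) (fun r w => (Real.sinh r ^2 + Real.sin w ^2) * (kfun K r * kfun P w)) := by
  have hK0 : 0 < K := by linarith
  have hP0 : 0 < P := by linarith
  constructor
  · have := (kfun_gd hK0).1; have := (kfun_gd hP0).1
    fun_prop
  intro r w
  refine wt_fin hK hP (by positivity) ?_
  beta_reduce
  rw [abs_of_nonneg (mul_nonneg (by positivity) (mul_nonneg (kfun_nonneg hK0 r) (kfun_nonneg hP0 w))), kfun_mul]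
  set x := K^2 * r^2 with hx
  set y := P^2 * w^2 with hy
  have hx0 : 0 ≤ x := by positivity
  have hy0 : 0 ≤ y := by positivity
  have ce := cosh_le_exp r
  have hch := Real.cosh_pos r
  have a1 : (Real.sinh r ^2 + Real.sin w ^2) * Real.cosh r ≤ 10 * (1/K^2+1/P^2) * (Real.exp (x/10) * Real.exp (y/10)) * Real.exp (3 * |r|) := by
    have p3 : 1 ≤ Real.exp (y/10) := Real.one_le_exp (by positivity)
    have p4 : 1 ≤ Real.exp (x/10) := Real.one_le_exp (by positivity)
    have e2 : Real.exp (2 * |r|) = Real.exp |r| ^ 2 := by rw [← Real.exp_nat_mul]; norm_num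
    have e3 : Real.exp (3 * |r|) = Real.exp (2 * |r|) * Real.exp |r| := by rw [← Real.exp_add]; congr 1; ring
    have s1 : Real.sinh r ^2 ≤ r^2 * Real.exp (2 * |r|) := by
      rw [e2, ← sq_abs r, ← mul_pow, ← sq_abs (Real.sinh r)]
      exact pow_le_pow_left₀ (abs_nonneg _) (abs_sinh_le r) 2
    have s2 : r^2 ≤ 10 * (1/K^2) * (Real.exp (x/10) * Real.exp (y/10)) := by
      have : r^2 = 1/K^2 * x := by rw [hx]; field_simp
      rw [this]
      have q1 := poly_exp x
      have : Real.exp (x/10) ≤ Real.exp (x/10) * Real.exp (y/10) := le_mul_of_one_le_right (by positivity) p3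
      have : x ≤ 10 * (Real.exp (x/10) * Real.exp (y/10)) := by linarith
      have := mul_le_mul_of_nonneg_left this (by positivity : 0 ≤ 1/K^2)
      linarith
    have s3 : Real.sin w^2 ≤ 10 * (1/P^2) * (Real.exp (x/10) * Real.exp (y/10)) := by
      have t : Real.sin w^2 ≤ w^2 := Real.sin_sq_le_sq
      refine t.trans ?_
      have : w^2 = 1/P^2 * y := by rw [hy]; field_simp
      rw [this]
      have q1 := poly_exp y
      have : Real.exp (y/10) ≤ Real.exp (x/10) * Real.exp (y/10) := le_mul_of_one_le_left (by positivity) p4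
      have : y ≤ 10 * (Real.exp (x/10) * Real.exp (y/10)) := by linarith
      have := mul_le_mul_of_nonneg_left this (by positivity : 0 ≤ 1/P^2)
      linarith
    have s4 : Real.sin w^2 ≤ (10 * (1/P^2) * (Real.exp (x/10) * Real.exp (y/10))) * Real.exp (2 * |r|) :=
      s3.trans (le_mul_of_one_le_right (by positivity) (Real.one_le_exp (by positivity)))
    calc (Real.sinh r ^2 + Real.sin w ^2) * Real.cosh r ≤ ((10 * (1/K^2) * (Real.exp (x/10) * Real.exp (y/10))) * Real.exp (2 * |r|) + (10 * (1/P^2) * (Real.exp (x/10) * Real.exp (y/10))) * Real.exp (2 * |r|)) * Real.exp |r| := by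
          refine mul_le_mul (add_le_add (s1.trans ?_) s4) ce hch.le (by positivity)
          exact mul_le_mul_of_nonneg_right s2 (by positivity)
      _ = _ := by rw [e3]; ring
  have hx1 : Real.exp (-x) = Real.exp (-(x/10)) * Real.exp (-(9/10*x)) := exp_split x
  have hy1 : Real.exp (-y) = Real.exp (-(y/10)) * Real.exp (-(9/10*y)) := exp_split y
  have hx2 : Real.exp (x/10) * Real.exp (-(x/10)) = 1 := by rw [← Real.exp_add]; simp
  have hy2 : Real.exp (y/10) * Real.exp (-(y/10)) = 1 := by rw [← Real.exp_add]; simp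
  calc _ = ((Real.sinh r ^2 + Real.sin w ^2) * Real.cosh r) * (π * (K * P) * (Real.exp (-x) * Real.exp (-y))) := by ring
    _ ≤ (10 * (1/K^2+1/P^2) * (Real.exp (x/10) * Real.exp (y/10)) * Real.exp (3 * |r|)) * (4 * (K * P) * (Real.exp (-x) * Real.exp (-y))) := by
        have := Real.pi_le_four
        refine mul_le_mul a1 ?_ (by positivity) (by positivity)
        gcongr
    _ = 40 * (1/K^2+1/P^2) * (K * P) * (Real.exp (3 * |r|) * ((Real.exp (x/10) * Real.exp (-(x/10))) * Real.exp (-(9/10*x))) * ((Real.exp (y/10) * Real.exp (-(y/10))) * Real.exp (-(9/10*y)))) := by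
        rw [hx1, hy1]; ring
    _ = _ := by rw [hx2, hy2, one_mul, one_mul]

/-- the annulus as a finset -/
noncomputable def MM (N : ℝ) : Finset GaussianInt := (inAnn_finite N).toFinset

lemma mem_MM {N : ℝ} {m : GaussianInt} : m ∈ MM N ↔ InAnn N m := by simp [MM]

lemma sqNorm_eq (a : GaussianInt → ℂ) (N : ℝ) : sqNorm a N = ∑ m ∈ MM N, ‖a m‖^2 := by
  unfold sqNorm MM
  exact finsum_mem_eq_finite_toFinset_sum _ _

lemma PhiSum_eq (K P N : ℝ) (a : GaussianInt → ℂ) (c : GaussianInt) :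
    PhiSum K P N a c = ∑ m ∈ MM N, ∑ n ∈ MM N, a m * conj (a n) * kloosterman m n c *
      ((HH K P (2 * Real.pi * ((m : ℂ) * (n : ℂ)) ^ ((1:ℂ)/2) / (c : ℂ)) : ℝ) : ℂ) := by
  unfold PhiSum MM
  rw [finsum_mem_eq_finite_toFinset_sum _ (inAnn_finite N)]
  refine Finset.sum_congr rfl fun m _ => ?_
  exact finsum_mem_eq_finite_toFinset_sum _ _

lemma MM_le {N : ℝ} : ∀ m ∈ MM N, ‖(m:ℂ)‖ ≤ Real.sqrt 2 * N := fun _ hm => (mem_MM.mp hm).2.2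
lemma MM_ne {N : ℝ} : ∀ m ∈ MM N, m ≠ 0 := fun _ hm => (mem_MM.mp hm).1.1

/-- global constant -/
noncomputable def C0 : ℝ := 10^11 * Real.exp 14
lemma C0_pos : 0 < C0 := by unfold C0; positivity

lemma sqNorm_nonneg (a : GaussianInt → ℂ) (N : ℝ) : 0 ≤ sqNorm a N := by
  rw [sqNorm_eq]; exact Finset.sum_nonneg fun _ _ => by positivity

lemma DD_nonneg {P N x : ℝ} (hN : 0 < N) (hx : 0 ≤ x) : 0 ≤ DD P N x := by unfold DD; positivity

lemma R1 {K P N : ℝ} (hK : 1/2 ≤ K) (hP : 1/2 ≤ P) (hN : 0 < N) (a : GaussianInt → ℂ) (c : GaussianInt) (hc : c ≠ 0) :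
    ‖PhiSum K P N a c‖ ≤ C0 * (K^2+P^2) * DD P N ‖(c:ℂ)‖ * sqNorm a N := by
  have hK0 : 0 < K := by linarith
  have hP0 : 0 < P := by linarith
  have h := Phi_int (MM N) N hN MM_le c hc a (wt1 hK hP) (by positivity) hK0 hP0
  rw [PhiSum_eq]
  simp only [HH_rep1 hP0, ofReal_neg, mul_neg, Finset.sum_neg_distrib, norm_neg]
  refine h.trans ?_
  rw [← sqNorm_eq]
  have h1 := sqNorm_nonneg a N
  have h2 : 0 ≤ DD P N ‖(c:ℂ)‖ := DD_nonneg hN (norm_nonneg _)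
  unfold C0
  calc _ = 288000000 * (Real.exp 14 * (K^2+P^2) * DD P N ‖(c:ℂ)‖ * sqNorm a N) := by ring
    _ ≤ 10^11 * (Real.exp 14 * (K^2+P^2) * DD P N ‖(c:ℂ)‖ * sqNorm a N) := by gcongr; norm_num
    _ = _ := by ring

lemma norm_sqrt_sq (z : ℂ) : ‖z^((1:ℂ)/2)‖^2 = ‖z‖ := by rw [← norm_pow, half_sq]

lemma inv_add {K P : ℝ} (hK : 0 < K) (hP : 0 < P) : 1/K^2 + 1/P^2 = (K^2+P^2)/(K*P)^2 := by field_simp; ring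

lemma R2 {K P N : ℝ} (hK : 1/2 ≤ K) (hP : 1/2 ≤ P) (hN : 0 < N) (a : GaussianInt → ℂ) (c : GaussianInt) (hc : c ≠ 0) :
    ‖PhiSum K P N a c‖ ≤ C0 * (K^2+P^2) / (K*P)^2 * (N^2 / ‖(c:ℂ)‖^2) * DD P N ‖(c:ℂ)‖ * sqNorm a N := by
  have hK0 : 0 < K := by linarith
  have hP0 : 0 < P := by linarith
  have hc0 : 0 < ‖(c:ℂ)‖ := by linarith [gi_one_le hc]
  have h := Phi_int (MM N) N hN MM_le c hc (fun m => a m * ((‖(m:ℂ)‖:ℝ):ℂ)) (wt2 hK hP) (by positivity) hK0 hP0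
  have hS : ∑ m ∈ MM N, ‖a m * ((‖(m:ℂ)‖:ℝ):ℂ)‖^2 ≤ 2 * N^2 * sqNorm a N := by
    rw [sqNorm_eq, Finset.mul_sum]
    refine Finset.sum_le_sum fun m hm => ?_
    rw [norm_mul, Complex.norm_real, norm_norm, mul_pow, mul_comm]
    have h1 := MM_le m hm
    have : ‖(m:ℂ)‖^2 ≤ 2 * N^2 := by
      calc _ ≤ (Real.sqrt 2 * N)^2 := pow_le_pow_left₀ (norm_nonneg _) h1 2
        _ = _ := by rw [mul_pow, Real.sq_sqrt (by norm_num)]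
    gcongr
  have h2 : 0 ≤ DD P N ‖(c:ℂ)‖ := DD_nonneg hN (norm_nonneg _)
  have e : PhiSum K P N a c = ((16 * π^2 / ‖(c:ℂ)‖^2 : ℝ) : ℂ) * ∑ m ∈ MM N, ∑ n ∈ MM N, (a m * ((‖(m:ℂ)‖:ℝ):ℂ)) * conj (a n * ((‖(n:ℂ)‖:ℝ):ℂ)) * kloosterman m n c *
      ((∫ r, ∫ w, Real.cos (2 * (2 * Real.pi * ((m:ℂ)*(n:ℂ))^((1:ℂ)/2) / (c:ℂ) * trh r w).re) * ((Real.sinh r ^2 + Real.sin w ^2) * (kfun K r * kfun P w)) : ℝ) : ℂ) := by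
    rw [PhiSum_eq, Finset.mul_sum]
    refine Finset.sum_congr rfl fun m _ => ?_
    rw [Finset.mul_sum]
    refine Finset.sum_congr rfl fun n _ => ?_
    rw [HH_rep2 hK0 hP0]
    have hz : 4 * ‖2 * (π:ℂ) * ((m:ℂ)*(n:ℂ))^((1:ℂ)/2) / (c:ℂ)‖^2 = 16 * π^2 / ‖(c:ℂ)‖^2 * (‖(m:ℂ)‖ * ‖(n:ℂ)‖) := by
      rw [norm_div, norm_mul, norm_mul, div_pow, mul_pow, norm_sqrt_sq, norm_mul, Complex.norm_real, Real.norm_eq_abs, abs_of_pos Real.pi_pos, Complex.norm_ofNat]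
      ring
    rw [hz]
    have e3 : ∀ r w : ℝ, Real.cos (2 * (2 * Real.pi * ((m:ℂ)*(n:ℂ))^((1:ℂ)/2) / (c:ℂ) * trh r w).re) * (16 * π^2 / ‖(c:ℂ)‖^2 * (‖(m:ℂ)‖ * ‖(n:ℂ)‖) * (Real.sinh r ^2 + Real.sin w ^2) * (kfun K r * kfun P w)) =
        (16 * π^2 / ‖(c:ℂ)‖^2 * (‖(m:ℂ)‖ * ‖(n:ℂ)‖)) * (Real.cos (2 * (2 * Real.pi * ((m:ℂ)*(n:ℂ))^((1:ℂ)/2) / (c:ℂ) * trh r w).re) * ((Real.sinh r ^2 + Real.sin w ^2) * (kfun K r * kfun P w))) := fun r w => by ring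
    simp only [e3, integral_const_mul]
    rw [ofReal_mul, ofReal_mul, ofReal_mul, map_mul, Complex.conj_ofReal]
    ring
  rw [e, norm_mul, Complex.norm_real, Real.norm_eq_abs, abs_of_nonneg (by positivity)]
  have hpi : 16 * π^2 ≤ 160 := by nlinarith [Real.pi_lt_d2, Real.pi_pos]
  have hS0 := sqNorm_nonneg a N
  calc _ ≤ (160 / ‖(c:ℂ)‖^2) * (1800000 * (40 * (1/K^2+1/P^2) * Real.exp 14) * DD P N ‖(c:ℂ)‖ * (2 * N^2 * sqNorm a N)) := by
        refine mul_le_mul (by gcongr) (h.trans ?_) (norm_nonneg _) (by positivity)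
        gcongr
    _ = 23040000000 * (Real.exp 14 * (K^2+P^2) / (K*P)^2 * (N^2 / ‖(c:ℂ)‖^2) * DD P N ‖(c:ℂ)‖ * sqNorm a N) := by rw [inv_add hK0 hP0]; ring
    _ ≤ 10^11 * (Real.exp 14 * (K^2+P^2) / (K*P)^2 * (N^2 / ‖(c:ℂ)‖^2) * DD P N ‖(c:ℂ)‖ * sqNorm a N) := by gcongr; norm_num
    _ = _ := by unfold C0; ring

lemma R3 {K P N : ℝ} (hK : 1/2 ≤ K) (hP : 1/2 ≤ P) (hN : 1 ≤ Real.sqrt 2 * N) (a : GaussianInt → ℂ) (c : GaussianInt) (hc : c ≠ 0) :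
    ‖PhiSum K P N a c‖ ≤ C0 * (K^2+P^2) / (K*P)^2 * (N^2 / ‖(c:ℂ)‖^2) * (N^2 * N^((1:ℝ)/2) * (‖(c:ℂ)‖^((3:ℝ)/2) * tauG c)) * sqNorm a N := by
  have hK0 : 0 < K := by linarith
  have hP0 : 0 < P := by linarith
  have hN0 : 0 < N := by
    by_contra hh
    push Not at hh
    nlinarith [Real.sqrt_nonneg 2]
  have hc0 : 0 < ‖(c:ℂ)‖ := by linarith [gi_one_le hc]
  have hS0 := sqNorm_nonneg a N
  have hH : ∀ m ∈ MM N, ∀ n ∈ MM N, |HH K P (2 * Real.pi * ((m : ℂ) * (n : ℂ)) ^ ((1:ℂ)/2) / (c : ℂ))| ≤ 200000 * Real.exp 14 * (K^2+P^2) / (K*P)^2 * (N^2 / ‖(c:ℂ)‖^2) := by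
    intro m hm n hn
    rw [HH_rep2 hK0 hP0]
    set z := 2 * (π:ℂ) * ((m:ℂ)*(n:ℂ))^((1:ℂ)/2) / (c:ℂ)
    have hz : ‖z‖^2 = 4 * π^2 / ‖(c:ℂ)‖^2 * (‖(m:ℂ)‖ * ‖(n:ℂ)‖) := by
      rw [norm_div, norm_mul, norm_mul, div_pow, mul_pow, norm_sqrt_sq, norm_mul, Complex.norm_real, Real.norm_eq_abs, abs_of_pos Real.pi_pos, Complex.norm_ofNat]
      ring
    have hz2 : ‖z‖^2 ≤ 80 * (N^2 / ‖(c:ℂ)‖^2) := by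
      rw [hz]
      have h1 : ‖(m:ℂ)‖ * ‖(n:ℂ)‖ ≤ (Real.sqrt 2 * N) * (Real.sqrt 2 * N) := mul_le_mul (MM_le m hm) (MM_le n hn) (norm_nonneg _) (by positivity)
      have h2 : (Real.sqrt 2 * N) * (Real.sqrt 2 * N) = 2 * N^2 := by
        have := Real.mul_self_sqrt (by norm_num : (0:ℝ) ≤ 2)
        calc _ = (Real.sqrt 2 * Real.sqrt 2) * N^2 := by ring
          _ = _ := by rw [this]
      have hpi : 4 * π^2 ≤ 40 := by nlinarith [Real.pi_lt_d2, Real.pi_pos]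
      calc _ ≤ 40 / ‖(c:ℂ)‖^2 * (2 * N^2) := by
            rw [h2] at h1; gcongr
        _ = _ := by ring
    have e3 : ∀ r w : ℝ, Real.cos (2 * (z * trh r w).re) * (4 * ‖z‖^2 * (Real.sinh r ^2 + Real.sin w ^2) * (kfun K r * kfun P w)) =
        (4 * ‖z‖^2) * (Real.cos (2 * (z * trh r w).re) * ((Real.sinh r ^2 + Real.sin w ^2) * (kfun K r * kfun P w))) := fun r w => by ring
    simp only [e3, integral_const_mul]
    rw [abs_mul, abs_of_nonneg (by positivity : 0 ≤ 4 * ‖z‖^2)]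
    have hb := (wt2 hK hP).int_bound (by positivity) hK0 hP0 z
    calc _ ≤ (4 * (80 * (N^2 / ‖(c:ℂ)‖^2))) * (15 * (40 * (1/K^2+1/P^2) * Real.exp 14)) := by
          refine mul_le_mul (by linarith) hb (abs_nonneg _) (by positivity)
      _ = 192000 * (Real.exp 14 * (K^2+P^2) / (K*P)^2 * (N^2 / ‖(c:ℂ)‖^2)) := by rw [inv_add hK0 hP0]; ring
      _ ≤ 200000 * (Real.exp 14 * (K^2+P^2) / (K*P)^2 * (N^2 / ‖(c:ℂ)‖^2)) := by gcongr; norm_num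
      _ = _ := by ring
  have hkl : ∀ m ∈ MM N, ∀ n ∈ MM N, ‖kloosterman m n c‖ ≤ 78 * (N^((1:ℝ)/2) * (‖(c:ℂ)‖^((3:ℝ)/2) * tauG c)) := by
    intro m hm n _
    refine (kloosterman_bound m n c hc (MM_ne m hm)).trans ?_
    have h2 : Real.sqrt 2 ≤ 4 := by rw [Real.sqrt_le_left (by norm_num)]; norm_num
    have h1 : ‖(m:ℂ)‖^((1:ℝ)/2) ≤ 2 * N^((1:ℝ)/2) := by
      calc _ ≤ (4 * N)^((1:ℝ)/2) := by
            refine Real.rpow_le_rpow (norm_nonneg _) ((MM_le m hm).trans ?_) (by norm_num)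
            gcongr
        _ = _ := by
            rw [Real.mul_rpow (by norm_num) hN0.le]
            congr 1
            rw [show (4:ℝ) = 2^(2:ℝ) by norm_num, ← Real.rpow_mul (by norm_num)]; norm_num
    calc _ ≤ 39 * (2 * N^((1:ℝ)/2)) * ‖(c:ℂ)‖^((3:ℝ)/2) * tauG c := by gcongr
      _ = _ := by ring
  have hcard : ((MM N).card : ℝ) ≤ 18 * N^2 := by
    refine (gi_card_le (Real.sqrt 2 * N) (by linarith) (MM N) MM_le).trans ?_
    calc (2 * (Real.sqrt 2 * N) + 1)^2 ≤ (3 * (Real.sqrt 2 * N))^2 := by gcongr; linarith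
      _ = 18 * N^2 := by rw [mul_pow, mul_pow, Real.sq_sqrt (by norm_num)]; ring
  set H := 200000 * Real.exp 14 * (K^2+P^2) / (K*P)^2 * (N^2 / ‖(c:ℂ)‖^2) with hHd
  set L := N^((1:ℝ)/2) * (‖(c:ℂ)‖^((3:ℝ)/2) * tauG c) with hL
  have hL0 : 0 ≤ L := by positivity
  have hH0 : 0 ≤ H := by positivity
  have hcs : (∑ m ∈ MM N, ‖a m‖)^2 ≤ (MM N).card * sqNorm a N := by
    rw [sqNorm_eq]; exact sq_sum_le_card_mul_sum_sq
  rw [PhiSum_eq]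
  calc _ ≤ ∑ m ∈ MM N, ∑ n ∈ MM N, ‖a m‖ * ‖a n‖ * ((78 * L) * H) := by
        refine (norm_sum_le _ _).trans (Finset.sum_le_sum fun m hm => ?_)
        refine (norm_sum_le _ _).trans (Finset.sum_le_sum fun n hn => ?_)
        rw [norm_mul, norm_mul, norm_mul, RCLike.norm_conj, mul_assoc, Complex.norm_real, Real.norm_eq_abs]
        refine mul_le_mul_of_nonneg_left ?_ (by positivity)
        exact mul_le_mul (hkl m hm n hn) (hH m hm n hn) (abs_nonneg _) (by positivity)
    _ = (∑ m ∈ MM N, ‖a m‖)^2 * ((78 * L) * H) := by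
        rw [sq, Finset.sum_mul_sum, Finset.sum_mul]
        refine Finset.sum_congr rfl fun m _ => ?_
        rw [Finset.sum_mul]
    _ ≤ (18 * N^2 * sqNorm a N) * ((78 * L) * H) := by
        refine mul_le_mul_of_nonneg_right (hcs.trans ?_) (by positivity)
        gcongr
    _ = 280800000 * (Real.exp 14 * (K^2+P^2) / (K*P)^2 * (N^2 / ‖(c:ℂ)‖^2) * (N^2 * L) * sqNorm a N) := by rw [hHd]; ring
    _ ≤ 10^11 * (Real.exp 14 * (K^2+P^2) / (K*P)^2 * (N^2 / ‖(c:ℂ)‖^2) * (N^2 * L) * sqNorm a N) := by gcongr; norm_num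
    _ = _ := by rw [hL]; unfold C0; ring

lemma tau_summable (s : ℝ) (hs : 2 < s) : Summable (fun c : {c : GaussianInt // c ≠ 0} => ‖((c:GaussianInt):ℂ)‖^(-s) * tauG c) := by
  have h0 : Summable (fun c : {c : GaussianInt // c ≠ 0} => ‖((c:GaussianInt):ℂ)‖^(-s)) := (gi_summable s hs).comp_injective Subtype.val_injective
  have h1 := h0.mul_of_nonneg h0 (fun _ => by positivity) (fun _ => by positivity)
  let mu : {c : GaussianInt // c ≠ 0} × {c : GaussianInt // c ≠ 0} → {c : GaussianInt // c ≠ 0} := fun p => ⟨p.1.1 * p.2.1, mul_ne_zero p.1.2 p.2.2⟩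
  have h2 := h1.comp_injective (Equiv.sigmaFiberEquiv mu).injective
  have h3 := h2.sigma
  refine h3.congr fun c => ?_
  have e : ∀ x : {p // mu p = c}, ((fun x : {c : GaussianInt // c ≠ 0} × {c : GaussianInt // c ≠ 0} => ‖((x.1:GaussianInt):ℂ)‖^(-s) * ‖((x.2:GaussianInt):ℂ)‖^(-s)) ∘ (Equiv.sigmaFiberEquiv mu)) ⟨c, x⟩ = ‖((c:GaussianInt):ℂ)‖^(-s) := by
    rintro ⟨p, rfl⟩
    simp only [Function.comp, Equiv.sigmaFiberEquiv_apply, mu]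
    rw [← Real.mul_rpow (norm_nonneg _) (norm_nonneg _), ← norm_mul, ← map_mul]
  simp only [e]
  rw [tsum_const, nsmul_eq_mul, mul_comm]
  congr 2
  rw [tauG, ← Nat.card_coe_set_eq]
  refine (Nat.card_congr (Equiv.ofBijective (fun x : {p // mu p = c} => (⟨x.1.1.1, ⟨x.1.2.1, (congrArg Subtype.val x.2).symm⟩⟩ : {d : GaussianInt | d ∣ c})) ⟨?_, ?_⟩))
  · rintro ⟨⟨p1, p2⟩, hp⟩ ⟨⟨q1, q2⟩, hq⟩ h
    simp only [Subtype.mk.injEq] at h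
    have hpq : p1 = q1 := Subtype.ext h
    subst hpq
    have : p1.1 * p2.1 = p1.1 * q2.1 := congrArg Subtype.val (hp.trans hq.symm)
    have := mul_left_cancel₀ p1.2 this
    have : p2 = q2 := Subtype.ext this
    subst this; rfl
  · rintro ⟨d, e, he⟩
    have hne : d * e ≠ 0 := he ▸ c.2
    exact ⟨⟨(⟨d, left_ne_zero_of_mul hne⟩, ⟨e, right_ne_zero_of_mul hne⟩), Subtype.ext he.symm⟩, rfl⟩

set_option maxHeartbeats 1000000 in
lemma small_c {K P N : ℝ} (hK : 1/2 ≤ K) (hP : 1/2 ≤ P) (hKP : K * P ≤ N) (a : GaussianInt → ℂ) (c : GaussianInt) (hc : c ≠ 0) :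
    ‖PhiSum K P N a c‖ ≤ C0 * (K^2+P^2) * sqNorm a N * (13 * N^2 * (P * Real.exp (-P^2) + 1/(K*P))) := by
  have hK0 : 0 < K := by linarith
  have hP0 : 0 < P := by linarith
  have hQ0 : 0 < K * P := by positivity
  have hQ : 1/4 ≤ K * P := by nlinarith
  have hN : 0 < N := by linarith
  have hx : 0 < ‖(c:ℂ)‖ := by linarith [gi_one_le hc]
  have r1 := R1 hK hP hN a c hc
  have r2 := R2 hK hP hN a c hc
  have hS := sqNorm_nonneg a N
  have hC := C0_pos
  set Q := K * P with hQd
  set x := ‖(c:ℂ)‖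
  set S := sqNorm a N
  set E := Real.exp (-P^2)
  have hE0 : 0 < E := Real.exp_pos _
  have hE1 : E ≤ 1 := Real.exp_le_one_iff.mpr (by nlinarith)
  have hB : 0 ≤ C0 * (K^2+P^2) * S := by positivity
  set X := N / Q with hX
  have hX0 : 0 < X := by positivity
  have hNX : N = X * Q := by rw [hX]; field_simp
  -- target for the DD-part
  have key : ‖PhiSum K P N a c‖ ≤ C0 * (K^2+P^2) * S * (X^2 + X * N + 2 * E * (X^2 + N^2)) := by
    rcases le_total x X with h | h
    · refine r1.trans ?_
      have : DD P N x ≤ X^2 + X * N + 2 * E * (X^2 + N^2) := by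
        unfold DD
        have h1 : x^2 ≤ X^2 := by gcongr
        have h2 : x * N ≤ X * N := by gcongr
        have h3 : (x + N)^2 ≤ 2 * (X^2 + N^2) := by nlinarith [sq_nonneg (x - N)]
        have h4 := mul_le_mul_of_nonneg_left h3 hE0.le
        change x^2 + x * N + E * (x+N)^2 ≤ _
        linarith
      have := mul_le_mul_of_nonneg_left this hB
      linarith
    · have e : C0 * (K^2+P^2) / Q^2 * (N^2 / x^2) * DD P N x * S = C0 * (K^2+P^2) * S * (X^2/x^2 * DD P N x) := by
        rw [hX]; field_simp
      rw [e] at r2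
      refine r2.trans (mul_le_mul_of_nonneg_left ?_ hB)
      have t0 : X^2/x^2 ≤ 1 := by rw [div_le_one (by positivity)]; gcongr
      have t1 : X^2/x^2 * x^2 = X^2 := by field_simp
      have t2 : X^2/x^2 * (x * N) ≤ X * N := by
        have : X^2/x^2 * (x * N) = X * N * (X / x) := by field_simp
        rw [this]
        have : X / x ≤ 1 := by rw [div_le_one hx]; exact h
        exact mul_le_of_le_one_right (by positivity) this
      have t3 : X^2/x^2 * (x + N)^2 ≤ 2 * (X^2 + N^2) := by
        have h3 : (x + N)^2 ≤ 2 * x^2 + 2 * N^2 := by nlinarith [sq_nonneg (x - N)]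
        have h4 := mul_le_mul_of_nonneg_left h3 (by positivity : 0 ≤ X^2/x^2)
        have h5 := mul_le_mul_of_nonneg_right t0 (by positivity : 0 ≤ N^2)
        nlinarith
      have t4 := mul_le_mul_of_nonneg_left t3 hE0.le
      change X^2/x^2 * (x^2 + x * N + E * (x+N)^2) ≤ _
      nlinarith
  refine key.trans (mul_le_mul_of_nonneg_left ?_ hB)
  have f0 : 1/Q ≤ 4 := by rw [div_le_iff₀ hQ0]; linarith
  have f1 : X^2 ≤ 4 * N^2 * (1/Q) := by
    have : X^2 = N^2 * (1/Q) * (1/Q) := by rw [hX]; field_simp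
    rw [this]
    have := mul_le_mul_of_nonneg_left f0 (by positivity : 0 ≤ N^2 * (1/Q))
    linarith
  have f2 : X * N = N^2 * (1/Q) := by rw [hX]; field_simp
  have f3 : E * X^2 ≤ X^2 := mul_le_of_le_one_left (by positivity) hE1
  have f4 : E * N^2 ≤ 2 * (P * E) * N^2 := by
    have : E ≤ 2 * (P * E) := by nlinarith
    gcongr
  have f5 : 0 ≤ P * E * N^2 := by positivity
  linarith

lemma large_c {K P N : ℝ} (hK : 1/2 ≤ K) (hP : 1/2 ≤ P) (hN : 1 ≤ Real.sqrt 2 * N) (a : GaussianInt → ℂ) (c : GaussianInt) (hc : c ≠ 0)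
    (hx : (2 * N)^(10:ℝ) ≤ ‖(c:ℂ)‖) :
    ‖PhiSum K P N a c‖ / ‖(c:ℂ)‖^2 ≤ C0 * (K^2+P^2) * sqNorm a N * (4 * N^2 * (1/(K*P)) * (‖(c:ℂ)‖^(-(9/4:ℝ)) * tauG c)) := by
  have hK0 : 0 < K := by linarith
  have hP0 : 0 < P := by linarith
  have hQ0 : 0 < K * P := by positivity
  have hQ : 1/4 ≤ K * P := by nlinarith
  have hN0 : 0 < N := by
    by_contra hh
    push Not at hh
    nlinarith [Real.sqrt_nonneg 2]
  have hx0 : 0 < ‖(c:ℂ)‖ := by linarith [gi_one_le hc]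
  have r3 := R3 hK hP hN a c hc
  have hS := sqNorm_nonneg a N
  have hC := C0_pos
  set Q := K * P with hQd
  set x := ‖(c:ℂ)‖
  set S := sqNorm a N
  have hB : 0 ≤ C0 * (K^2+P^2) * S := by positivity
  have f0 : 1/Q ≤ 4 := by rw [div_le_iff₀ hQ0]; linarith
  have f1 : 1/Q^2 ≤ 4 * (1/Q) := by
    have : 1/Q^2 = 1/Q * (1/Q) := by field_simp
    rw [this]; gcongr
  -- powers of x
  have p1 : x^((3:ℝ)/2) / x^2 / x^2 = x^(-(1/4:ℝ)) * x^(-(9/4:ℝ)) := by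
    rw [← Real.rpow_natCast, ← Real.rpow_sub hx0, ← Real.rpow_sub hx0, ← Real.rpow_add hx0]; norm_num
  have p2 : x^(-(1/4:ℝ)) ≤ (2 * N)^(-(5/2:ℝ)) := by
    calc _ ≤ ((2 * N)^(10:ℝ))^(-(1/4:ℝ)) := Real.rpow_le_rpow_of_nonpos (by positivity) hx (by norm_num)
      _ = _ := by rw [← Real.rpow_mul (by positivity)]; norm_num
  have p3 : N^2 * N^((1:ℝ)/2) * (2 * N)^(-(5/2:ℝ)) ≤ 1 := by
    have e1 : N^2 * N^((1:ℝ)/2) = N^(5/2:ℝ) := by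
      rw [← Real.rpow_natCast, ← Real.rpow_add hN0]; norm_num
    rw [e1]
    calc N^(5/2:ℝ) * (2 * N)^(-(5/2:ℝ)) ≤ (2 * N)^(5/2:ℝ) * (2 * N)^(-(5/2:ℝ)) := by
          gcongr; linarith
      _ = 1 := by rw [← Real.rpow_add (by positivity)]; norm_num
  calc _ ≤ (C0 * (K^2+P^2) / Q^2 * (N^2 / x^2) * (N^2 * N^((1:ℝ)/2) * (x^((3:ℝ)/2) * tauG c)) * S) / x^2 := by gcongr
    _ = C0 * (K^2+P^2) * S * (1/Q^2 * N^2 * (N^2 * N^((1:ℝ)/2) * (x^((3:ℝ)/2) / x^2 / x^2)) * tauG c) := by ring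
    _ = C0 * (K^2+P^2) * S * (1/Q^2 * N^2 * (N^2 * N^((1:ℝ)/2) * x^(-(1/4:ℝ))) * (x^(-(9/4:ℝ)) * tauG c)) := by rw [p1]; ring
    _ ≤ C0 * (K^2+P^2) * S * (4 * (1/Q) * N^2 * 1 * (x^(-(9/4:ℝ)) * tauG c)) := by
        refine mul_le_mul_of_nonneg_left ?_ hB
        refine mul_le_mul_of_nonneg_right ?_ (by positivity)
        refine mul_le_mul (mul_le_mul_of_nonneg_right f1 (by positivity)) ?_ (by positivity) (by positivity)
        refine le_trans ?_ p3
        gcongr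
    _ = _ := by ring

lemma each_c {K P N ε : ℝ} (hε : 0 < ε) (hK : 1/2 ≤ K) (hP : 1/2 ≤ P) (hKP : K * P ≤ N) (hN : 1 ≤ Real.sqrt 2 * N) (a : GaussianInt → ℂ) (c : GaussianInt) (hc : c ≠ 0) :
    ‖PhiSum K P N a c‖ / ‖(c:ℂ)‖^2 ≤ (C0 * (K^2+P^2) * sqNorm a N * (N^2 * (P * Real.exp (-P^2) + 1/(K*P)) * (2*N)^ε)) *
      (13 * ‖(c:ℂ)‖^(-(2+ε/10)) + 4 * (‖(c:ℂ)‖^(-(9/4:ℝ)) * tauG c)) := by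
  have hK0 : 0 < K := by linarith
  have hP0 : 0 < P := by linarith
  have hQ0 : 0 < K * P := by positivity
  have hN0 : 0 < N := by linarith
  have hx0 : 0 < ‖(c:ℂ)‖ := by linarith [gi_one_le hc]
  have hS := sqNorm_nonneg a N
  have hC := C0_pos
  have h2N : 1 ≤ 2 * N := by
    have h2 : Real.sqrt 2 ≤ 2 := by rw [Real.sqrt_le_left (by norm_num)]; norm_num
    nlinarith
  have hpw : 1 ≤ (2*N)^ε := Real.one_le_rpow h2N hε.le
  set W := P * Real.exp (-P^2) + 1/(K*P) with hW
  have hW1 : 1/(K*P) ≤ W := by rw [hW]; have : 0 ≤ P * Real.exp (-P^2) := by positivity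
                               linarith
  have hW0 : 0 < W := lt_of_lt_of_le (by positivity) hW1
  have ht : 0 ≤ (tauG c : ℝ) := by positivity
  rcases le_total ‖(c:ℂ)‖ ((2*N)^(10:ℝ)) with h | h
  · have s := small_c hK hP hKP a c hc
    have p : 1 / ‖(c:ℂ)‖^2 ≤ (2*N)^ε * ‖(c:ℂ)‖^(-(2+ε/10)) := by
      have e1 : 1 / ‖(c:ℂ)‖^2 = ‖(c:ℂ)‖^(ε/10) * ‖(c:ℂ)‖^(-(2+ε/10)) := by
        rw [← Real.rpow_add hx0, one_div, ← Real.rpow_natCast, ← Real.rpow_neg hx0.le]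
        congr 1; push_cast; ring
      rw [e1]
      gcongr
      calc ‖(c:ℂ)‖^(ε/10) ≤ ((2*N)^(10:ℝ))^(ε/10) := Real.rpow_le_rpow hx0.le h (by positivity)
        _ = _ := by rw [← Real.rpow_mul (by positivity)]; congr 1; ring
    calc _ ≤ (C0 * (K^2+P^2) * sqNorm a N * (13 * N^2 * W)) / ‖(c:ℂ)‖^2 := by gcongr
      _ = (C0 * (K^2+P^2) * sqNorm a N * (13 * N^2 * W)) * (1 / ‖(c:ℂ)‖^2) := by ring
      _ ≤ (C0 * (K^2+P^2) * sqNorm a N * (13 * N^2 * W)) * ((2*N)^ε * ‖(c:ℂ)‖^(-(2+ε/10))) := by gcongr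
      _ = (C0 * (K^2+P^2) * sqNorm a N * (N^2 * W * (2*N)^ε)) * (13 * ‖(c:ℂ)‖^(-(2+ε/10))) := by ring
      _ ≤ _ := by
          refine mul_le_mul_of_nonneg_left ?_ (by positivity)
          have : 0 ≤ 4 * (‖(c:ℂ)‖^(-(9/4:ℝ)) * tauG c) := by positivity
          linarith
  · refine (large_c hK hP hN a c hc h).trans ?_
    calc _ ≤ C0 * (K^2+P^2) * sqNorm a N * (4 * N^2 * W * (‖(c:ℂ)‖^(-(9/4:ℝ)) * tauG c)) := by gcongr
      _ = (C0 * (K^2+P^2) * sqNorm a N * (N^2 * W * 1)) * (4 * (‖(c:ℂ)‖^(-(9/4:ℝ)) * tauG c)) := by ring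
      _ ≤ (C0 * (K^2+P^2) * sqNorm a N * (N^2 * W * (2*N)^ε)) * (13 * ‖(c:ℂ)‖^(-(2+ε/10)) + 4 * (‖(c:ℂ)‖^(-(9/4:ℝ)) * tauG c)) := by
          refine mul_le_mul (by gcongr) ?_ (by positivity) (by positivity)
          have : 0 ≤ 13 * ‖(c:ℂ)‖^(-(2+ε/10)) := by positivity
          linarith

/-- Bound for the Kloosterman-term in the range `N ≥ KP`. -/
theorem kloosterman_term_bound_large_N :
    ∀ ε : ℝ, 0 < ε → ∃ C : ℝ,
      ∀ K P : ℝ, 1/2 ≤ K → 1/2 ≤ P → ∀ N : ℝ, K * P ≤ N →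
        ∀ a : GaussianInt → ℂ, (∀ m n : GaussianInt, Associated m n → a m = a n) →
          (∑' c : {c : GaussianInt // c ≠ 0},
              ‖PhiSum K P N a c‖ / ‖((c : GaussianInt) : ℂ)‖ ^ 2) ≤
            C * (K ^ 2 + P ^ 2) * N ^ (2 + ε) *
              (K * Real.exp (-K ^ 2 / 9) + P * Real.exp (-P ^ 2) + 1 / (K * P)) *
              sqNorm a N := by
  intro ε hε
  have s1 : Summable (fun c : {c : GaussianInt // c ≠ 0} => ‖((c:GaussianInt):ℂ)‖^(-(2+ε/10))) :=
    (gi_summable (2+ε/10) (by linarith)).comp_injective Subtype.val_injective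
  have s2 := tau_summable (9/4) (by norm_num)
  have s3 := (s1.mul_left 13).add (s2.mul_left 4)
  set Z := ∑' c : {c : GaussianInt // c ≠ 0}, (13 * ‖((c:GaussianInt):ℂ)‖^(-(2+ε/10)) + 4 * (‖((c:GaussianInt):ℂ)‖^(-(9/4:ℝ)) * tauG c)) with hZ
  have hZ0 : 0 ≤ Z := tsum_nonneg fun c => by positivity
  refine ⟨C0 * 2^ε * Z, fun K P hK hP N hKP a _ => ?_⟩
  have hK0 : 0 < K := by linarith
  have hP0 : 0 < P := by linarith
  have hQ0 : 0 < K * P := by positivity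
  have hN0 : 0 < N := by linarith
  have hS := sqNorm_nonneg a N
  have hC := C0_pos
  rcases (MM N).eq_empty_or_nonempty with he | ⟨m, hm⟩
  · have h1 : ∀ c, PhiSum K P N a c = 0 := fun c => by rw [PhiSum_eq, he]; simp
    simp only [h1, norm_zero, zero_div, tsum_zero]
    positivity
  have hN : 1 ≤ Real.sqrt 2 * N := (gi_one_le (MM_ne m hm)).trans (MM_le m hm)
  set B := C0 * (K^2+P^2) * sqNorm a N * (N^2 * (P * Real.exp (-P^2) + 1/(K*P)) * (2*N)^ε) with hB
  have hle : ∀ c : {c : GaussianInt // c ≠ 0}, ‖PhiSum K P N a c‖ / ‖((c : GaussianInt) : ℂ)‖ ^ 2 ≤ B * (13 * ‖((c:GaussianInt):ℂ)‖^(-(2+ε/10)) + 4 * (‖((c:GaussianInt):ℂ)‖^(-(9/4:ℝ)) * tauG c)) :=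
    fun c => each_c hε hK hP hKP hN a c c.2
  have sB := s3.mul_left B
  have sL := Summable.of_nonneg_of_le (fun c => by positivity) hle sB
  refine (sL.tsum_le_tsum hle sB).trans ?_
  rw [tsum_mul_left, ← hZ, hB, Real.mul_rpow (by norm_num) hN0.le, Real.rpow_add hN0]
  have e2 : N^(2:ℝ) = N^2 := by norm_cast
  rw [e2]
  have hw : P * Real.exp (-P^2) + 1/(K*P) ≤ K * Real.exp (-K ^ 2 / 9) + P * Real.exp (-P ^ 2) + 1 / (K * P) := by
    have : 0 ≤ K * Real.exp (-K ^ 2 / 9) := by positivity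
    linarith
  have := mul_le_mul_of_nonneg_left hw (by positivity : 0 ≤ C0 * 2^ε * Z * (K^2+P^2) * (N^2 * N^ε) * sqNorm a N)
  linarith
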